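/- For any partitions λ, μ and ν one has the explicit expression g^λ_{μ,ν}(α) = (−1)^{|μ|+|ν|−|λ|} ∑_{m≥0} (−1)^m ∑_{π1,…,πm with |λ|<|π1|<⋯<|πm|} a^λ_{π1} a^{π1}_{π2} a^{π2}_{π3} ⋯ a^{π_{m−1}}_{π_m} d^{π_m}_{μ,ν}, where the term m = 0 in the sum is interpreted as d^λ_{μ,ν} (the sums are finite since d^{π}_{μ,ν} = 0 when |π| > |μ|+|ν|). -/

import Mathlib

open scoped Classical

noncomputable section

/-- The base field `ℚ(α)` of rational functions in the Jack parameter `α`. -/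
abbrev F : Type := RatFunc ℚ

/-- The Jack deformation parameter `α`. -/
def alpha : F := RatFunc.X

/-- An integer partition, encoded as a multiset of positive integers (its parts). -/
abbrev JPartition : Type := Multiset ℕ+

/-- The size `|λ|` of a partition. -/
def psize (l : JPartition) : ℕ := (l.map fun i => (i : ℕ)).sum

/-- The length `ℓ(λ)` of a partition. -/
def plen (l : JPartition) : ℕ := Multiset.card l

/-- `m_i(λ)`, the number of parts of `λ` equal to `i`. -/
def pmult (l : JPartition) (i : ℕ+) : ℕ := Multiset.count i l

/-- `λ ∪ 1^k`, adjoining `k` parts equal to `1`. -/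
def addOnes (l : JPartition) (k : ℕ) : JPartition := l + Multiset.replicate k 1

/-- `λ̃`, the partition obtained by deleting all parts equal to `1`. -/
def removeOnes (l : JPartition) : JPartition := Multiset.filter (fun i => i ≠ 1) l

/-- Exponent vectors of monomials in the power-sum generators `p₁, p₂, …`. -/
abbrev Exp : Type := ℕ+ →₀ ℕ

/-- The exponent vector of the monomial `p_λ`. -/
def toExp (l : JPartition) : Exp := l.toFinset.sum fun i => Finsupp.single i (Multiset.count i l)

/-- The partition corresponding to an exponent vector. -/
def toPart (m : Exp) : JPartition := m.sum fun i k => Multiset.replicate k i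

/-- The weighted degree (`deg p_i = i`) of an exponent vector; this is the size of the
corresponding partition. -/
def wt (m : Exp) : ℕ := m.sum fun i k => k * (i : ℕ)

/-- The algebra `ℚ(α)[p₁, p₂, …]` of symmetric functions written in the power-sum basis. -/
abbrev SymA : Type := MvPolynomial ℕ+ F

/-- The power-sum monomial `p_λ`. -/
def pPow (l : JPartition) : SymA := (l.map fun i => MvPolynomial.X i).prod

/-- `z_λ α^{ℓ(λ)}`, attached to the exponent vector of `p_λ`. -/
def zalpha (m : Exp) : F :=
  algebraMap ℚ F (m.prod fun i k => (Nat.factorial k : ℚ) * ((i : ℕ) : ℚ) ^ k) *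
    alpha ^ (m.sum fun _ k => k)

/-- The `α`-deformed Hall scalar product: `⟨p_λ, p_μ⟩ = δ_{λμ} z_λ α^{ℓ(λ)}`. -/
def hall (f g : SymA) : F :=
  ∑ m ∈ f.support, MvPolynomial.coeff m f * MvPolynomial.coeff m g * zalpha m

/-- The parts of a partition, sorted in weakly decreasing order. -/
def sortedParts (l : JPartition) : List ℕ := ((l.map fun i => (i : ℕ)).sort (· ≤ ·)).reverse

/-- The sum of the `k` largest parts of a partition. -/
def topSum (l : JPartition) (k : ℕ) : ℕ := ((sortedParts l).take k).sum

/-- The dominance order on partitions: `μ ⊴ λ`. -/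
def dominates (mu lam : JPartition) : Prop :=
  psize mu = psize lam ∧ ∀ k, topSum mu k ≤ topSum lam k

/-- Evaluation of a symmetric function (in power-sum coordinates) in `N` variables
`x₁, …, x_N`: it sends `p_i ↦ x₁^i + ⋯ + x_N^i`. -/
def evalN (N : ℕ) : SymA →ₐ[F] MvPolynomial (Fin N) F :=
  MvPolynomial.aeval fun i : ℕ+ => ∑ j : Fin N, MvPolynomial.X j ^ (i : ℕ)

/-- The exponent of the monomial `x₁^{μ₁} ⋯ x_s^{μ_s}` in `N` variables, for `μ` a
partition; its coefficient in a symmetric polynomial is the coefficient of the monomial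
symmetric function `m_μ` (provided `N ≥ ℓ(μ)`). -/
def xexp (mu : JPartition) (N : ℕ) : Fin N →₀ ℕ :=
  Finsupp.equivFunOnFinite.symm fun j => (sortedParts mu).getD (j : ℕ) 0

/-- The defining properties of the family of Jack polynomials `J_λ^{(α)}` (Macdonald's
characterization): orthogonality for the `α`-deformed Hall product, triangularity with
respect to monomial symmetric functions in dominance order, and normalization
`[p_{1^n}] J_λ^{(α)} = 1`. -/
structure IsJackFamily (J : JPartition → SymA) : Prop where
  orthogonal : ∀ l m : JPartition, l ≠ m → hall (J l) (J m) = 0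
  triangular : ∀ l m : JPartition, ¬ dominates m l →
    MvPolynomial.coeff (xexp m (psize l + psize m + plen m))
      (evalN (psize l + psize m + plen m) (J l)) = 0
  normalized : ∀ l : JPartition, MvPolynomial.coeff (Finsupp.single 1 (psize l)) (J l) = 1

/-- The Jack character `θ_μ^{(α)}(λ)`. -/
def theta (J : JPartition → SymA) (mu lam : JPartition) : F :=
  if psize lam < psize mu then 0
  else (Nat.choose (psize lam - psize mu + pmult mu 1) (pmult mu 1) : F) *
    MvPolynomial.coeff (toExp (addOnes mu (psize lam - psize mu))) (J lam)

/-- `g` is the family of structure coefficients of Jack characters: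
`θ_μ^{(α)} θ_ν^{(α)} = ∑_π g^π_{μ,ν}(α) θ_π^{(α)}` (as functions on Young diagrams,
with finitely many nonzero terms). -/
def IsStructCoeffs (J : JPartition → SymA) (g : JPartition → JPartition → JPartition → F) :
    Prop :=
  (∀ mu nu : JPartition, {pi : JPartition | g pi mu nu ≠ 0}.Finite) ∧
  ∀ mu nu lam : JPartition,
    theta J mu lam * theta J nu lam = ∑ᶠ pi : JPartition, g pi mu nu * theta J pi lam


/-- The polynomial algebra `ℚ(α)[p₁,p₂,…][y₀,y₁,…]` containing the catalytic variables. -/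
abbrev PY : Type := MvPolynomial (ℕ+ ⊕ ℕ) F

/-- The variable `p_i` inside `PY`. -/
def pv (i : ℕ+) : PY := MvPolynomial.X (Sum.inl i)

/-- The catalytic variable `y_j` inside `PY`. -/
def yv (j : ℕ) : PY := MvPolynomial.X (Sum.inr j)

/-- The operator `Y₊ = ∑_{i≥0} y_{i+1} ∂/∂y_i`. -/
def Yplus (f : PY) : PY := ∑ᶠ j : ℕ, yv (j + 1) * MvPolynomial.pderiv (Sum.inr j) f

/-- The operator
`Γ_Y = (1+b) ∑_{i,j≥1} y_{i+j} j ∂²/(∂y_{i-1}∂p_j) + ∑_{i,j≥1} y_i p_j ∂/∂y_{i+j-1}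
      + b ∑_{i≥1} y_{i+1} i ∂/∂y_i`, with `b = α - 1`. -/
def GammaY (f : PY) : PY :=
  alpha • (∑ᶠ i : ℕ+, ∑ᶠ j : ℕ+, ((j : ℕ) : F) •
      (yv ((i : ℕ) + (j : ℕ)) *
        MvPolynomial.pderiv (Sum.inl j) (MvPolynomial.pderiv (Sum.inr ((i : ℕ) - 1)) f)))
  + (∑ᶠ i : ℕ+, ∑ᶠ j : ℕ+,
      yv (i : ℕ) * pv j * MvPolynomial.pderiv (Sum.inr ((i : ℕ) + (j : ℕ) - 1)) f)
  + (alpha - 1) • (∑ᶠ i : ℕ+, ((i : ℕ) : F) •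
      (yv ((i : ℕ) + 1) * MvPolynomial.pderiv (Sum.inr (i : ℕ)) f))

/-- The operator `Θ_Y = ∑_{i≥1} p_i ∂/∂y_i`. -/
def ThetaY (f : PY) : PY := ∑ᶠ i : ℕ+, pv i * MvPolynomial.pderiv (Sum.inr (i : ℕ)) f

/-- Ordered composite of the operators `Y₊` (for `true`) and `Γ_Y` (for `false`). -/
def wordOp : List Bool → PY → PY
  | [], f => f
  | b :: w, f => (if b then Yplus else GammaY) (wordOp w f)

/-- Projection `PY → SymA` killing the catalytic variables. -/
def dropY : PY →ₐ[F] SymA :=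
  MvPolynomial.aeval fun v => match v with
    | Sum.inl i => MvPolynomial.X i
    | Sum.inr _ => 0

/-- `Bc n ℓ` is the coefficient of `u^ℓ` in the operator
`B_n^{(α)}(p, u) = Θ_Y (Γ_Y + u Y₊)^n (y₀ / (1+b))`, viewed as an operator on `ℚ(α)[p]`. -/
def Bc (n ℓ : ℕ) (f : SymA) : SymA :=
  dropY (ThetaY (∑ s ∈ Finset.univ.filter
      (fun s : Fin n → Bool => (Finset.univ.filter fun i => s i = true).card = ℓ),
    wordOp (List.ofFn s) (alpha⁻¹ • (yv 0 * MvPolynomial.rename Sum.inl f))))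

/-- Matrix entries of `Bc n ℓ` in the basis of power-sum monomials. -/
def Bmat (n ℓ : ℕ) (m m' : Exp) : F :=
  MvPolynomial.coeff m (Bc n ℓ (MvPolynomial.monomial m' 1))

/-- The adjoint of `Bc n ℓ` with respect to the `α`-deformed Hall scalar product
(`⟨Bperp f, g⟩ = ⟨f, Bc g⟩`), given by its matrix in the power-sum basis. -/
def Bperp (n ℓ : ℕ) (f : SymA) : SymA :=
  ∑ m' ∈ f.support, MvPolynomial.coeff m' f •
    ∑ᶠ m : Exp, (Bmat n ℓ m' m * zalpha m' / zalpha m) • (MvPolynomial.monomial m (1 : F))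



/-- Application of `C_ℓ^{(α)}(t, p)` (with `+t`) to a `t`-indexed family of elements of
`ℚ(α)[p]`; the `t^n`-coefficient of `C_ℓ^{(α)}(t,p)` is `(1/n) Bc n ℓ`. -/
def applyCpPlus (ℓq : ℕ) (h : ℕ → SymA) : ℕ → SymA := fun k =>
  ∑ n ∈ Finset.Icc 1 k, ((n : F)⁻¹) • Bc n ℓq (h (k - n))

/-- Iterated application of `∏ᵢ C_{λᵢ}^{(α)}(t, p)` along a list of parts. -/
def applyCpListPlus : List ℕ+ → (ℕ → SymA) → ℕ → SymA
  | [], h => h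
  | x :: L, h => applyCpPlus (x : ℕ) (applyCpListPlus L h)

/-- The constant family `1 + 0⋅t + 0⋅t² + ⋯` in `ℚ(α)[p]⟦t⟧`. -/
def oneFam : ℕ → SymA := fun k => if k = 0 then 1 else 0

/-- The coefficient `a^λ_ξ := [t^{|ξ|} p_ξ] (∏_{i=1}^{ℓ(λ)} α λᵢ C_{λᵢ}^{(α)}(t,p)) ⬝ 1`. -/
def aCoef (lam xi : JPartition) : F :=
  (lam.map fun i => alpha * ((i : ℕ) : F)).prod *
    MvPolynomial.coeff (toExp xi) (applyCpListPlus (lam.sort (· ≤ ·)) oneFam (psize xi))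

/-- The coefficient `d^λ_{μ,ν} := ∑_{ξ∪π=λ} a^ξ_μ a^π_ν`, the sum running over all ways
of splitting the multiset of parts of `λ` into two partitions. -/
def dCoef (lam mu nu : JPartition) : F :=
  (lam.powerset.map fun xi => aCoef xi mu * aCoef (lam - xi) nu).sum

/-- The product `a^λ_{π₁} a^{π₁}_{π₂} ⋯ a^{π_{m-1}}_{π_m} d^{π_m}_{μ,ν}` along a chain of
partitions (with value `d^λ_{μ,ν}` for the empty chain). -/
def chainVal (mu nu : JPartition) : JPartition → List JPartition → F
  | lam, [] => dCoef lam mu nu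
  | lam, pi :: L => aCoef lam pi * chainVal mu nu pi L

open scoped Classical
noncomputable section

namespace JK
open MvPolynomial

/-- symmetric functions over a general field -/
abbrev Sy (K : Type) [Field K] : Type := MvPolynomial ℕ+ K
/-- the module with one catalytic variable -/
abbrev Mw (K : Type) [Field K] : Type := ℕ →₀ MvPolynomial ℕ+ K

section A1
variable {K : Type} [Field K]

def pp (a : ℕ) : Sy K := if h : 0 < a then X (Nat.toPNat a h) else 0

@[simp] lemma pp_zero : (pp 0 : Sy K) = 0 := by simp [pp]
lemma pp_coe (a : ℕ+) : (pp (a : ℕ) : Sy K) = X a := by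
  simp [pp]; rfl

def wS : Mw K →ₗ[K] Mw K := Finsupp.lmapDomain (Sy K) K (fun a => a + 1)
def io : Sy K →ₗ[K] Mw K := Finsupp.lsingle 0
def Th : Mw K →ₗ[K] Sy K := Finsupp.lsum K (fun a => LinearMap.mulLeft K (pp a))
/-- multiplication by `p_a` on `Sy` -/
def mp (a : ℕ) : Sy K →ₗ[K] Sy K := LinearMap.mulLeft K (pp a)
/-- multiplication by `p_a` on `Mw` -/
def mM (a : ℕ) : Mw K →ₗ[K] Mw K := Finsupp.mapRange.linearMap (mp a)

def cre (α : K) : Derivation K (Sy K) (Mw K) :=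
  MvPolynomial.mkDerivation K (fun k : ℕ+ => Finsupp.single (k : ℕ) (C (α * (k : ℕ)) : Sy K))

def Laux (α : K) : ℕ → (Sy K →ₗ[K] Mw K)
  | 0 => (cre α).toLinearMap
  | a + 1 => wS ∘ₗ Laux α a + io ∘ₗ mp (a+1) + (α - 1) • Finsupp.lsingle (a+1)

def L (α : K) : Mw K →ₗ[K] Mw K := Finsupp.lsum K (Laux α)

@[simp] lemma wS_single (a : ℕ) (f : Sy K) :
    wS (Finsupp.single a f : Mw K) = Finsupp.single (a+1) f := by
  simp [wS]

lemma io_def (f : Sy K) : io f = Finsupp.single 0 f := rfl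

@[simp] lemma Th_single (a : ℕ) (f : Sy K) : Th (Finsupp.single a f : Mw K) = pp a * f := by
  simp [Th]
@[simp] lemma mp_apply (a : ℕ) (f : Sy K) : mp a f = pp a * f := rfl
@[simp] lemma mM_single (a c : ℕ) (f : Sy K) :
    mM a (Finsupp.single c f : Mw K) = Finsupp.single c (pp a * f) := by
  simp [mM]

lemma L_single (α : K) (a : ℕ) (f : Sy K) : L α (Finsupp.single a f) = Laux α a f := by
  simp [L]

@[simp] lemma Th_io (f : Sy K) : Th (io f) = 0 := by simp [io_def]
@[simp] lemma mM_io (a : ℕ) (f : Sy K) : mM a (io f) = io (pp a * f) := by simp [io_def]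

lemma single_eq_w (a : ℕ) (f : Sy K) : (Finsupp.single a f : Mw K) = (wS ^ a) (io f) := by
  induction a with
  | zero => simp [io_def]
  | succ a ih => rw [pow_succ', Module.End.mul_apply, ← ih, wS_single]

/-- extension principle -/
lemma ext_w {N : Type} [AddCommGroup N] [Module K N] {A B : Mw K →ₗ[K] N}
    (h0 : ∀ f, A (io f) = B (io f))
    (h1 : ∀ x, A x = B x → A (wS x) = B (wS x)) : ∀ x, A x = B x := by
  have h : A = B := by
    apply Finsupp.lhom_ext
    intro a f
    rw [single_eq_w]
    induction a with
    | zero => simpa using h0 f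
    | succ a ih => rw [pow_succ', Module.End.mul_apply]; exact h1 _ ih
  intro x; rw [h]

lemma Th_mM (a : ℕ) (x : Mw K) : Th (mM a x) = pp a * Th x := by
  have : Th ∘ₗ mM a = mp a ∘ₗ (Th (K := K)) := by
    apply Finsupp.lhom_ext
    intro c f
    simp only [LinearMap.comp_apply, mM_single, Th_single, mp_apply]; ring
  exact LinearMap.congr_fun this x

lemma mM_wS (a : ℕ) (x : Mw K) : mM a (wS x) = wS (mM a x) := by
  have : mM a ∘ₗ wS = wS ∘ₗ (mM (K := K) a) := by
    apply Finsupp.lhom_ext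
    intro c f
    simp only [LinearMap.comp_apply, mM_single, wS_single]
  exact LinearMap.congr_fun this x

lemma L_io (α : K) (f : Sy K) : L α (io f) = cre α f := by
  rw [io_def, L_single]; rfl

lemma L_wS (α : K) (x : Mw K) :
    L α (wS x) = wS (L α x) + io (Th (wS x)) + (α - 1) • wS x := by
  have : L α ∘ₗ wS = wS ∘ₗ (L α) + io ∘ₗ Th ∘ₗ wS + (α - 1) • wS := by
    apply Finsupp.lhom_ext
    intro c f
    simp [L_single, Laux]
  exact LinearMap.congr_fun this x

lemma cre_pp (α : K) (a : ℕ) : cre α (pp a) = Finsupp.single a (C (α * a)) := by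
  rcases Nat.eq_zero_or_pos a with h | h
  · subst h; simp
  · rw [pp, dif_pos h, cre, MvPolynomial.mkDerivation_X]; rfl

lemma wpow_single (a c : ℕ) (f : Sy K) : (wS ^ a) (Finsupp.single c f : Mw K) = Finsupp.single (c+a) f := by
  induction a with
  | zero => simp
  | succ a ih => rw [pow_succ', Module.End.mul_apply, ih, wS_single]; rfl

lemma smul_mM (a : ℕ) (x : Mw K) : (pp a : Sy K) • x = mM a x := by
  ext c; simp [mM]

lemma smul_wpow (α : K) (a : ℕ) (f : Sy K) :
    f • (Finsupp.single a (C (α * a)) : Mw K) = (α * a) • (wS ^ a) (io f) := by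
  rw [← single_eq_w, Finsupp.smul_single, Finsupp.smul_single, smul_eq_mul, mul_comm, C_mul']

lemma L_mM (α : K) (a : ℕ) (x : Mw K) :
    L α (mM a x) = mM a (L α x) + (α * a) • (wS ^ a) x := by
  have := ext_w (A := L α ∘ₗ mM a) (B := mM a ∘ₗ L α + (α * a) • (wS ^ a)) ?_ ?_ x
  · simpa using this
  · intro f
    simp only [LinearMap.comp_apply, LinearMap.add_apply, LinearMap.smul_apply, mM_io, L_io,
      Derivation.leibniz, cre_pp, smul_mM, smul_wpow]
  · intro x h
    simp only [LinearMap.comp_apply, LinearMap.add_apply, LinearMap.smul_apply] at h ⊢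
    have e : (wS ^ a) (wS x) = wS ((wS ^ a) x) := by
      rw [← Module.End.mul_apply, ← Module.End.mul_apply, ← pow_succ, pow_succ']
    rw [mM_wS, L_wS, h, ← mM_wS, Th_mM, L_wS, e]
    simp only [map_add, map_smul, mM_wS, mM_io]
    abel
end A1
end JK
end

open scoped Classical
noncomputable section

set_option linter.unusedSectionVars false
set_option linter.unusedSimpArgs false
namespace JK
open MvPolynomial
section A2
variable {K : Type} [Field K]

lemma ext_p {N : Type} [AddCommGroup N] [Module K N] {A B : Sy K →ₗ[K] N}
    (h0 : A 1 = B 1)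
    (h1 : ∀ f, A f = B f → ∀ c : ℕ, A (pp c * f) = B (pp c * f)) : ∀ f, A f = B f := by
  intro f
  induction f using MvPolynomial.induction_on with
  | C a =>
    have : (C a : Sy K) = a • 1 := by rw [smul_eq_C_mul, mul_one]
    rw [this, map_smul, map_smul, h0]
  | add p q hp hq => rw [map_add, map_add, hp, hq]
  | mul_X p i hp => rw [mul_comm, ← pp_coe]; exact h1 _ hp _

def DS (α : K) : Sy K →ₗ[K] Sy K :=
  (2 * α)⁻¹ • (Th ∘ₗ (L α - (α - 1) • LinearMap.id) ∘ₗ L α ∘ₗ io)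

def Dhaux (α : K) : ℕ → (Sy K →ₗ[K] Mw K)
  | 0 => io ∘ₗ DS α
  | a + 1 => wS ∘ₗ (Dhaux α a + L α ∘ₗ Finsupp.lsingle a)

def Dh (α : K) : Mw K →ₗ[K] Mw K := Finsupp.lsum K (Dhaux α)

lemma Dh_io (α : K) (f : Sy K) : Dh α (io f) = io (DS α f) := by
  simp [Dh, io_def, Dhaux]

lemma Dh_wS (α : K) (x : Mw K) : Dh α (wS x) = wS (Dh α x) + wS (L α x) := by
  have : Dh α ∘ₗ wS = wS ∘ₗ Dh α + wS ∘ₗ L α := by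
    apply Finsupp.lhom_ext
    intro c f
    simp [Dh, Dhaux]
  exact LinearMap.congr_fun this x

lemma wpow_wS (a : ℕ) (x : Mw K) : (wS ^ a) (wS x) = (wS ^ (a+1)) x := by
  rw [← Module.End.mul_apply, ← pow_succ]
lemma wS_wpow (a : ℕ) (x : Mw K) : wS ((wS ^ a) x) = (wS ^ (a+1)) x := by
  rw [← Module.End.mul_apply, ← pow_succ']
lemma wpow_wpow (a c : ℕ) (x : Mw K) : (wS ^ a) ((wS ^ c) x) = (wS ^ (a+c)) x := by
  rw [← Module.End.mul_apply, ← pow_add]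
lemma mM_wpow (a c : ℕ) (x : Mw K) : mM a ((wS ^ c) x) = (wS ^ c) (mM a x) := by
  induction c with
  | zero => simp
  | succ c ih => rw [← wS_wpow, mM_wS, ih, wS_wpow]
lemma Th_wpow_io (a : ℕ) (f : Sy K) : Th ((wS ^ a) (io f)) = pp a * f := by
  rw [← single_eq_w, Th_single]

def Kop (α : K) (a : ℕ) : Sy K →ₗ[K] Sy K :=
  ((a : K) / 2) • (Th ∘ₗ ((wS ^ a) ∘ₗ L α + L α ∘ₗ (wS ^ a) - (α - 1) • (wS ^ a)) ∘ₗ io)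

lemma Kop_apply (α : K) (a : ℕ) (f : Sy K) : Kop α a f = ((a : K) / 2) • (Th ((wS ^ a) (L α (io f)))
    + Th (L α ((wS ^ a) (io f))) - (α - 1) • Th ((wS ^ a) (io f))) := by
  simp [Kop]

lemma DS_apply (α : K) (f : Sy K) : DS α f = (2 * α)⁻¹ • (Th (L α (L α (io f))) - (α - 1) • Th (L α (io f))) := by
  simp [DS]

variable [CharZero K]

lemma DS_pp {α : K} (hα : α ≠ 0) (a : ℕ) (f : Sy K) :
    DS α (pp a * f) = pp a * DS α f + Kop α a f := by
  rw [DS_apply, DS_apply, Kop_apply, ← mM_io]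
  simp only [L_mM, map_add, map_smul, Th_mM, Th_wpow_io, mul_smul_comm, mul_sub]
  match_scalars <;> field_simp

lemma Kop_pp (α : K) (a c : ℕ) (f : Sy K) :
    Kop α a (pp c * f) = pp c * Kop α a f + (α * a * c) • (pp (a + c) * f) := by
  rw [Kop_apply, Kop_apply, ← mM_io]
  simp only [L_mM, map_add, map_smul, Th_mM, Th_wpow_io, mul_smul_comm, mul_sub, ← mM_wpow, mul_add,
    wpow_wpow, add_comm c a]
  module

def Hop (α : K) (a : ℕ) : Mw K →ₗ[K] Mw K := Dh α ∘ₗ mM a - mM a ∘ₗ Dh α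

lemma Hop_def (α : K) (a : ℕ) (x : Mw K) : Dh α (mM a x) = mM a (Dh α x) + Hop α a x := by
  simp [Hop]

lemma Hop_io {α : K} (hα : α ≠ 0) (a : ℕ) (f : Sy K) : Hop α a (io f) = io (Kop α a f) := by
  simp [Hop, Dh_io, DS_pp hα]

lemma Hop_wS (α : K) (a : ℕ) (x : Mw K) :
    Hop α a (wS x) = wS (Hop α a x) + (α * a) • (wS ^ (a+1)) x := by
  simp [Hop, Dh_wS, mM_wS, L_mM, ← wS_wpow]
  abel

lemma Hop_wpow (α : K) (a c : ℕ) (x : Mw K) :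
    Hop α a ((wS ^ c) x) = (wS ^ c) (Hop α a x) + (α * a * c) • (wS ^ (a+c)) x := by
  induction c with
  | zero => simp
  | succ c ih =>
    rw [← wS_wpow, Hop_wS, ih, map_add, wS_wpow, map_smul, wS_wpow, wpow_wpow]
    have : a + 1 + c = a + c + 1 := by ring
    rw [this]
    push_cast
    rw [add_assoc (a := a)]
    module

lemma mM_wpow_io (a c : ℕ) (f : Sy K) : mM a ((wS ^ c) (io f)) = (wS ^ c) (io (pp a * f)) := by
  rw [mM_wpow, mM_io]

lemma Hop_mM {α : K} (hα : α ≠ 0) (a c : ℕ) (x : Mw K) :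
    Hop α a (mM c x) = mM c (Hop α a x) + (α * a * c) • mM (a+c) x := by
  have := ext_w (A := Hop α a ∘ₗ mM c) (B := mM c ∘ₗ Hop α a + (α * a * c) • mM (a+c)) ?_ ?_ x
  · simpa using this
  · intro f
    simp only [LinearMap.comp_apply, LinearMap.add_apply, LinearMap.smul_apply, mM_io, Hop_io hα,
      Kop_pp, map_add, map_smul]
  · intro x h
    simp only [LinearMap.comp_apply, LinearMap.add_apply, LinearMap.smul_apply] at h ⊢
    rw [mM_wS, Hop_wS, h, Hop_wS]
    simp only [map_add, map_smul, mM_wS, mM_wpow]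
    abel

lemma L_wpow_one (α : K) (a : ℕ) : L α ((wS ^ a) (io 1)) =
    ∑ s ∈ Finset.range a, Finsupp.single s (pp (a - s)) + ((α - 1) * a) • Finsupp.single a (1 : Sy K) := by
  induction a with
  | zero => simp [L_io]
  | succ a ih =>
    rw [← wS_wpow, L_wS, ih, wS_wpow, Th_wpow_io, Finset.sum_range_succ', map_add, map_sum]
    simp only [wS_single, map_smul, Nat.sub_zero, ← single_eq_w, mul_one, Nat.add_sub_add_right]
    rw [io_def]
    push_cast
    module

lemma Th_L_io_one (α : K) : L α (io 1) = 0 := by simp [L_io]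
lemma DS_one (α : K) : DS α 1 = 0 := by simp [DS_apply, L_io]

lemma choose_two_succ (a : ℕ) : (((a+1).choose 2 : ℕ) : K) = a.choose 2 + a := by
  rw [Nat.choose_succ_succ' a 1]; push_cast; simp; ring

lemma Dh_wpow_one (α : K) (a : ℕ) : Dh α ((wS ^ a) (io 1)) =
    ∑ s ∈ Finset.range a, (s : K) • Finsupp.single s (pp (a - s))
      + ((α - 1) * (a.choose 2 : ℕ)) • Finsupp.single a (1 : Sy K) := by
  induction a with
  | zero => simp [Dh_io, DS_one]
  | succ a ih =>
    rw [← wS_wpow, Dh_wS, ih, L_wpow_one, Finset.sum_range_succ', map_add, map_add, map_sum, map_sum,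
      choose_two_succ]
    simp only [map_smul, wS_single, Nat.add_sub_add_right, Nat.cast_succ, add_smul, Finset.sum_add_distrib]
    simp only [Nat.cast_zero, zero_smul, add_zero, one_smul]
    module

lemma DS_pp_one {α : K} (hα : α ≠ 0) (a : ℕ) : DS α (pp a) =
    ((a : K) / 2) • (∑ s ∈ Finset.range a, pp s * pp (a - s) + ((α - 1) * (a - 1)) • pp a) := by
  have := DS_pp hα a 1
  rw [mul_one, DS_one, mul_zero, zero_add] at this
  rw [this, Kop_apply, Th_L_io_one, L_wpow_one]
  simp only [map_zero, map_add, map_sum, map_smul, Th_single, mul_one, Th_wpow_io, zero_add]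
  module


lemma sum_pp_ext {N : Type} [AddCommGroup N] (a : ℕ) (g : ℕ → N) (h : g a = 0) :
    ∑ s ∈ Finset.range a, g s = ∑ s ∈ Finset.range (a+1), g s := by
  rw [Finset.sum_range_succ, h, add_zero]

lemma sum_pp1 (a : ℕ) : ∑ s ∈ Finset.range a, (s : K) • (pp s * pp (a - s) : Sy K) =
    ((a : K) / 2) • ∑ s ∈ Finset.range a, (pp s * pp (a - s) : Sy K) := by
  rw [sum_pp_ext a (fun s => (s : K) • (pp s * pp (a - s) : Sy K)) (by simp),
    sum_pp_ext a (fun s => (pp s * pp (a - s) : Sy K)) (by simp)]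
  set T := ∑ s ∈ Finset.range (a+1), (s : K) • (pp s * pp (a - s) : Sy K) with hT
  have h2 : T = ∑ s ∈ Finset.range (a+1), ((a:K) - s) • (pp s * pp (a - s) : Sy K) := by
    rw [hT, ← Finset.sum_flip]
    apply Finset.sum_congr rfl
    intro s hs
    have hs' : s ≤ a := by simpa [Nat.lt_succ_iff] using hs
    rw [Nat.cast_sub hs', Nat.sub_sub_self hs', mul_comm]
  have h3 : (2 : K) • T = (a : K) • ∑ s ∈ Finset.range (a+1), (pp s * pp (a - s) : Sy K) := by
    rw [two_smul]
    nth_rewrite 2 [h2]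
    rw [hT, ← Finset.sum_add_distrib, Finset.smul_sum]
    apply Finset.sum_congr rfl
    intro s _
    module
  have : T = (2 : K)⁻¹ • ((2 : K) • T) := by rw [smul_smul, inv_mul_cancel₀ two_ne_zero, one_smul]
  rw [this, h3, smul_smul]
  congr 1; ring

lemma sum_pp2 (α : K) (a : ℕ) : cre α (∑ s ∈ Finset.range a, (pp s * pp (a - s) : Sy K)) =
    (2 * α) • ∑ s ∈ Finset.range a, (s : K) • Finsupp.single s (pp (a - s) : Sy K) := by
  rw [sum_pp_ext a (fun s => (pp s * pp (a - s) : Sy K)) (by simp), sum_pp_ext a (fun s => (s : K) • Finsupp.single s (pp (a - s) : Sy K)) (by simp)]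
  rw [map_sum]
  have e : ∀ c d : ℕ, (pp c : Sy K) • (Finsupp.single d (C (α * d)) : Mw K) = α • (d : K) • Finsupp.single d (pp c : Sy K) := by
    intro c d
    rw [Finsupp.smul_single, Finsupp.smul_single, Finsupp.smul_single, smul_smul, smul_eq_mul, mul_comm, C_mul']
  have h1 : ∀ s ∈ Finset.range (a+1), cre α (pp s * pp (a - s) : Sy K) =
      (fun r : ℕ => α • (r : K) • Finsupp.single r (pp (a - r) : Sy K)) (a - s) +
      α • (s : K) • Finsupp.single s (pp (a - s) : Sy K) := by
    intro s hs
    have hs' : s ≤ a := by simpa [Nat.lt_succ_iff] using hs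
    rw [Derivation.leibniz, cre_pp, cre_pp, e, e]
    simp only [Nat.sub_sub_self hs']
  rw [Finset.sum_congr rfl h1, Finset.sum_add_distrib, 
    Finset.sum_flip (fun r : ℕ => α • (r : K) • Finsupp.single r (pp (a - r) : Sy K)), ← Finset.smul_sum]
  module

lemma choose_two_eq (a : ℕ) : ((a.choose 2 : ℕ) : K) = a / 2 * (a - 1) := by
  induction a with
  | zero => simp
  | succ a ih => rw [choose_two_succ, ih]; push_cast; ring

lemma DS_Th {α : K} (hα : α ≠ 0) (x : Mw K) : DS α (Th x) = Th (Dh α x) := by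
  have : DS α ∘ₗ Th = Th ∘ₗ Dh α := by
    apply Finsupp.lhom_ext
    intro a f
    rw [single_eq_w]
    have := ext_p (A := DS α ∘ₗ Th ∘ₗ (wS ^ a) ∘ₗ io) (B := Th ∘ₗ Dh α ∘ₗ (wS ^ a) ∘ₗ io) ?_ ?_ f
    · simpa only [LinearMap.comp_apply] using this
    · simp only [LinearMap.comp_apply, Th_wpow_io, mul_one, DS_pp_one hα, Dh_wpow_one, map_add, map_sum,
        map_smul, Th_single, sum_pp1, choose_two_eq]
      module
    · intro f h c
      simp only [LinearMap.comp_apply, Th_wpow_io] at h ⊢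
      rw [← mM_wpow_io, Hop_def, map_add, Th_mM, ← h, Hop_wpow, Hop_io hα]
      simp only [map_add, map_smul, Th_wpow_io, DS_pp hα, Kop_pp]
      rw [add_comm a c, mul_comm (α * (a : K)) (c : K), mul_right_comm α (c : K), mul_comm (α * (a : K)) (c : K)]
      ring
  exact LinearMap.congr_fun this x

lemma Dh_wpow (α : K) (a c : ℕ) (x : Mw K) :
    (Dh α ((wS ^ a) (mM c x)) - (wS ^ a) (Dh α (mM c x))) =
      mM c (Dh α ((wS ^ a) x) - (wS ^ a) (Dh α x)) + (α * a * c) • (wS ^ (a + c)) x := by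
  rw [← mM_wpow, Hop_def, Hop_def, Hop_wpow, map_sub, map_add, mM_wpow]
  rw [add_comm c a]
  module

lemma Dh_L_io {α : K} (hα : α ≠ 0) (f : Sy K) : Dh α (L α (io f)) = L α (io (DS α f)) := by
  have key : ∀ (a : ℕ) (f : Sy K), Hop α a (L α (io f)) +
      (α * a) • (Dh α ((wS ^ a) (io f)) - (wS ^ a) (Dh α (io f))) = L α (io (Kop α a f)) := by
    intro a f
    have := ext_p (A := Hop α a ∘ₗ L α ∘ₗ io + (α * a) • (Dh α ∘ₗ (wS ^ a) ∘ₗ io - (wS ^ a) ∘ₗ Dh α ∘ₗ io))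
        (B := L α ∘ₗ io ∘ₗ Kop α a) ?_ ?_ f
    · simpa only [LinearMap.comp_apply, LinearMap.add_apply, LinearMap.smul_apply, LinearMap.sub_apply] using this
    · have h1 := DS_pp hα a 1
      rw [mul_one, DS_one, mul_zero, zero_add] at h1
      simp only [LinearMap.comp_apply, LinearMap.add_apply, LinearMap.smul_apply, LinearMap.sub_apply]
      rw [← h1, DS_pp_one hα, L_io, L_io, Derivation.map_smul, map_add, sum_pp2, Derivation.map_smul, cre_pp, Dh_io, DS_one, 
        Dh_wpow_one, choose_two_eq]
      have : (Finsupp.single a (C (α * a)) : Mw K) = (α * a) • Finsupp.single a (1 : Sy K) := by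
        rw [Finsupp.smul_single, ← C_mul', mul_one]
      rw [this]
      simp only [Derivation.map_one_eq_zero, map_zero]
      module
    · intro f h c
      simp only [LinearMap.comp_apply, LinearMap.add_apply, LinearMap.smul_apply, LinearMap.sub_apply] at h ⊢
      rw [Kop_pp, map_add, map_add, map_smul, map_smul, ← mM_io, ← mM_io, ← mM_io, L_mM, L_mM, L_mM, ← h, Dh_wpow, map_add,
        map_smul, Hop_mM hα, Hop_wpow, Hop_io hα, map_add, map_smul]
      push_cast
      module
  have := ext_p (A := Dh α ∘ₗ L α ∘ₗ io) (B := L α ∘ₗ io ∘ₗ DS α) ?_ ?_ f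
  · simpa only [LinearMap.comp_apply] using this
  · simp [L_io, DS_one]
  · intro f h a
    simp only [LinearMap.comp_apply] at h ⊢
    rw [DS_pp hα, map_add, map_add, ← key, ← mM_io, ← mM_io, L_mM, L_mM, map_add, map_smul, Hop_def, h, Dh_io]
    module

lemma Dh_L {α : K} (hα : α ≠ 0) (x : Mw K) : Dh α (L α x) = L α (Dh α x) := by
  have := ext_w (A := Dh α ∘ₗ L α) (B := L α ∘ₗ Dh α) ?_ ?_ x
  · simpa only [LinearMap.comp_apply] using this
  · intro f
    simp only [LinearMap.comp_apply, Dh_L_io hα, Dh_io]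
  · intro x h
    simp only [LinearMap.comp_apply] at h ⊢
    simp only [L_wS, Dh_wS, map_add, map_smul, Dh_io, h, DS_Th hα]
    module
end A2
end JK
end

open scoped Classical
noncomputable section
set_option linter.unusedSectionVars false
set_option linter.unusedSimpArgs false
namespace JK
open MvPolynomial
section A3
variable {K : Type} [Field K]

lemma lieMul {R : Type} [Ring R] (a b c : R) : ⁅a, b * c⁆ = ⁅a, b⁆ * c + b * ⁅a, c⁆ := by
  simp only [Ring.lie_def]; noncomm_ring

lemma lieLie {R : Type} [Ring R] (a b c : R) : ⁅⁅a, b⁆, c⁆ = ⁅a, ⁅b, c⁆⁆ - ⁅b, ⁅a, c⁆⁆ := by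
  simp only [Ring.lie_def]; noncomm_ring
lemma addLie {R : Type} [Ring R] (a b c : R) : ⁅a + b, c⁆ = ⁅a, c⁆ + ⁅b, c⁆ := by
  simp only [Ring.lie_def]; noncomm_ring
lemma lieAdd {R : Type} [Ring R] (a b c : R) : ⁅a, b + c⁆ = ⁅a, b⁆ + ⁅a, c⁆ := by
  simp only [Ring.lie_def]; noncomm_ring
lemma lieSub {R : Type} [Ring R] (a b c : R) : ⁅a, b - c⁆ = ⁅a, b⁆ - ⁅a, c⁆ := by
  simp only [Ring.lie_def]; noncomm_ring
lemma lieNeg {R : Type} [Ring R] (a b : R) : ⁅a, -b⁆ = -⁅a, b⁆ := by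
  simp only [Ring.lie_def]; noncomm_ring
@[simp] lemma lieZero {R : Type} [Ring R] (a : R) : ⁅a, (0 : R)⁆ = 0 := by
  simp only [Ring.lie_def]; noncomm_ring
lemma lieSmul {R : Type} [Ring R] [Algebra K R] (u : K) (a b : R) : ⁅a, u • b⁆ = u • ⁅a, b⁆ := by
  simp only [Ring.lie_def, mul_smul_comm, smul_mul_assoc, smul_sub]
lemma smulLie {R : Type} [Ring R] [Algebra K R] (u : K) (a b : R) : ⁅u • a, b⁆ = u • ⁅a, b⁆ := by
  simp only [Ring.lie_def, mul_smul_comm, smul_mul_assoc, smul_sub]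

lemma liePow_zero {R : Type} [Ring R] {a b : R} (h : ⁅a, b⁆ = 0) (n : ℕ) : ⁅a, b ^ n⁆ = 0 := by
  induction n with
  | zero => simp [Ring.lie_def]
  | succ n ih => rw [pow_succ, lieMul, ih, h]; simp

lemma liePow_sq {R : Type} [Ring R] {a b : R} (h : ⁅a, b⁆ = b ^ 2) (n : ℕ) :
    ⁅a, b ^ n⁆ = n • b ^ (n+1) := by
  induction n with
  | zero => simp [Ring.lie_def]
  | succ n ih =>
    rw [pow_succ, lieMul, ih, h, smul_mul_assoc, ← pow_succ, ← pow_add, succ_nsmul]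


/-- abstract operator system -/
structure Sys (K M S : Type) [Field K] [AddCommGroup M] [Module K M] [AddCommGroup S] [Module K S] where
  α : K
  io : S →ₗ[K] M
  Th : M →ₗ[K] S
  w : Module.End K M
  L : Module.End K M
  D : Module.End K M
  P : Module.End K M
  d : Module.End K S
  q : Module.End K S
  Dio : ∀ f, D (io f) = io (d f)
  ThD : ∀ m, Th (D m) = d (Th m)
  Pio : ∀ f, P (io f) = io (q f)
  ThP : ∀ m, Th (P m) = q (Th m)
  Dw : ∀ x, D (w x) = w (D x) + w (L x)
  DL : ∀ x, D (L x) = L (D x)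
  Pw : ∀ x, P (w x) = w (P x)
  PL : ∀ x, P (L x) = L (P x) - w x
  one1 : ∀ f, d (q f) - q (d f) = α⁻¹ • Th (w (L (io f)))
  one2 : ∀ f, q f = α⁻¹ • Th (w (io f))
  Thio : ∀ f, Th (io f) = 0
  d1 : Module.End K M
  ds : Module.End K S
  c0 : M →ₗ[K] S
  c1 : M →ₗ[K] S
  d1io : ∀ f, d1 (io f) = io (ds f)
  d1w : ∀ x, d1 (w x) = w (d1 x)
  d1L : ∀ x, w (d1 (L x)) = w (L (d1 x)) + x - io (c0 x)
  dsTh : ∀ x, ds (Th x) = Th (d1 x) + c1 x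
  c1w : ∀ x, c1 (w x) = c0 x
  c0w : ∀ x, c0 (w x) = 0
  c0Lw : ∀ x, c0 (L (w x)) = Th (w x)
  c0io : ∀ f, c0 (io f) = f
  c0Lio : ∀ f, c0 (L (io f)) = 0
  Ed : Module.End K M
  ed : Module.End K S
  EdIo : ∀ f, Ed (io f) = io (ed f)
  EdTh : ∀ x, Th (Ed x) = ed (Th x)
  EdW : ∀ x, Ed (w x) = w (Ed x) + w x
  EdL : ∀ x, Ed (L x) = L (Ed x)

variable {M S : Type} [AddCommGroup M] [Module K M] [AddCommGroup S] [Module K S] (Y : Sys K M S)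
namespace Sys
variable {Y}
/-- good operators -/
def Good (Y : Sys K M S) (A : Module.End K M) (x : Module.End K S) : Prop :=
  (∀ f, A (Y.io f) = Y.io (x f)) ∧ ∀ m, Y.Th (A m) = x (Y.Th m)

lemma Good.mul {A B : Module.End K M} {x y : Module.End K S} (h : Y.Good A x) (h' : Y.Good B y) :
    Y.Good (A * B) (x * y) :=
  ⟨fun f => by simp [h'.1, h.1], fun m => by simp [h'.2, h.2]⟩
lemma Good.add {A B : Module.End K M} {x y : Module.End K S} (h : Y.Good A x) (h' : Y.Good B y) :
    Y.Good (A + B) (x + y) :=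
  ⟨fun f => by simp [h'.1, h.1], fun m => by simp [h'.2, h.2]⟩
lemma Good.sub {A B : Module.End K M} {x y : Module.End K S} (h : Y.Good A x) (h' : Y.Good B y) :
    Y.Good (A - B) (x - y) :=
  ⟨fun f => by simp [h'.1, h.1], fun m => by simp [h'.2, h.2]⟩
lemma Good.smul {A : Module.End K M} {x : Module.End K S} (h : Y.Good A x) (c : K) :
    Y.Good (c • A) (c • x) :=
  ⟨fun f => by simp [h.1], fun m => by simp [h.2]⟩
lemma Good.lie {A B : Module.End K M} {x y : Module.End K S} (h : Y.Good A x) (h' : Y.Good B y) :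
    Y.Good ⁅A, B⁆ ⁅x, y⁆ := (h.mul h').sub (h'.mul h)

variable (Y)
/-- compress an operator on `Mw` to `Sy` -/
def cpr  (A : Module.End K M) : Module.End K S := Y.α⁻¹ • (Y.Th ∘ₗ A ∘ₗ Y.io)

lemma cpr_apply  (A : Module.End K M) (f : S) : Y.cpr A f = Y.α⁻¹ • Y.Th (A (Y.io f)) := rfl

lemma cpr_add  (A B : Module.End K M) : Y.cpr (A + B) = Y.cpr A + Y.cpr B := by
  ext1; simp [cpr_apply]
lemma cpr_sub  (A B : Module.End K M) : Y.cpr (A - B) = Y.cpr A - Y.cpr B := by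
  apply LinearMap.ext; intro f; simp [cpr_apply, smul_sub]
lemma cpr_smul (c : K) (A : Module.End K M) : Y.cpr (c • A) = c • Y.cpr A := by
  apply LinearMap.ext; intro f; simp [cpr_apply, smul_smul, mul_comm]
lemma cpr_sum  {ι : Type} (s : Finset ι) (A : ι → Module.End K M) :
    Y.cpr (∑ i ∈ s, A i) = ∑ i ∈ s, Y.cpr (A i) := by
  apply LinearMap.ext; intro f; simp [cpr_apply, Finset.smul_sum]

lemma Good.cpr_lie {Y : Sys K M S} {A : Module.End K M} {x : Module.End K S} (h : Y.Good A x) 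
    (B : Module.End K M) : Y.cpr ⁅A, B⁆ = ⁅x, Y.cpr B⁆ := by
  apply LinearMap.ext; intro f
  simp [cpr_apply, Ring.lie_def, h.1, h.2, smul_sub]

def Zu (u : K) : Module.End K M := Y.w * (Y.L + u • 1)
def Bu (u : K) (n : ℕ) : Module.End K S := Y.cpr (Y.Zu u ^ n)

def E1  : Module.End K S := ⁅Y.d, Y.q⁆
def E1h  : Module.End K M := ⁅Y.D, Y.P⁆
def E2  : Module.End K S := ⁅Y.d, Y.E1⁆
def E2h  : Module.End K M := ⁅Y.D, Y.E1h⁆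
def Eu (u : K) : Module.End K S := Y.E2 + u • Y.E1
def Euh (u : K) : Module.End K M := Y.E2h + u • Y.E1h
/-- `Bh n` lifts `Bu (n+1)` -/
def Bh (Y : Sys K M S) (u : K) : ℕ → Module.End K M
  | 0 => Y.E1h + u • Y.P
  | n + 1 => ((n : K) + 1)⁻¹ • ⁅Y.Euh u, Bh Y u n⁆


lemma Good_D : Y.Good Y.D Y.d := ⟨Y.Dio, Y.ThD⟩
lemma Good_P : Y.Good Y.P Y.q := ⟨Y.Pio, Y.ThP⟩

lemma lie_D_w : ⁅Y.D, Y.w⁆ = Y.w * Y.L := by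
  apply LinearMap.ext; intro x; simp [Ring.lie_def, Y.Dw]
lemma lie_D_L : ⁅Y.D, Y.L⁆ = 0 := by
  apply LinearMap.ext; intro x; simp [Ring.lie_def, Y.DL]
lemma lie_P_w : ⁅Y.P, Y.w⁆ = 0 := by
  apply LinearMap.ext; intro x; simp [Ring.lie_def, Y.Pw]
lemma lie_P_L : ⁅Y.P, Y.L⁆ = - Y.w := by
  apply LinearMap.ext; intro x; simp [Ring.lie_def, Y.PL]



lemma Good_E1 : Y.Good (Y.E1h) (Y.E1) := (Y.Good_D).lie (Y.Good_P)
lemma Good_E2 : Y.Good (Y.E2h) (Y.E2) := (Y.Good_D).lie (Y.Good_E1)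
lemma Good_Eu (u : K) : Y.Good (Y.Euh u) (Y.Eu u) :=
  (Y.Good_E2).add ((Y.Good_E1).smul u)

lemma lie_E1_w : ⁅Y.E1h, Y.w⁆ = Y.w * Y.w := by
  rw [E1h, lieLie, Y.lie_P_w, Y.lie_D_w, lieMul, Y.lie_P_w, Y.lie_P_L]; simp
lemma lie_E1_L : ⁅Y.E1h, Y.L⁆ = - (Y.w * Y.L) := by
  rw [E1h, lieLie, Y.lie_P_L, Y.lie_D_L, lieNeg, Y.lie_D_w]; simp
lemma lie_E2_w : ⁅Y.E2h, Y.w⁆ = Y.w * Y.L * Y.w + Y.w * Y.w * Y.L := by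
  rw [E2h, lieLie, Y.lie_E1_w, Y.lie_D_w, lieMul, lieMul, Y.lie_D_w, Y.lie_E1_w, Y.lie_E1_L]
  noncomm_ring
lemma lie_E2_L : ⁅Y.E2h, Y.L⁆ = - (Y.w * Y.L * Y.L) := by
  rw [E2h, lieLie, Y.lie_E1_L, Y.lie_D_L, lieNeg, lieMul, Y.lie_D_w, Y.lie_D_L]
  simp

variable [CharZero K]
lemma lieSmulOne (u : K) (A : Module.End K M) : ⁅A, u • (1 : Module.End K M)⁆ = 0 := by
  simp [Ring.lie_def]

lemma lie_Eu_w (u : K) : ⁅Y.Euh u, Y.w⁆ =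
    Y.Zu u * Y.w + Y.w * Y.Zu u - u • (Y.w * Y.w) := by
  rw [Euh, addLie, smulLie, Y.lie_E1_w, Y.lie_E2_w, Zu]
  simp only [mul_add, add_mul, mul_smul_comm, smul_mul_assoc, mul_one, mul_assoc]
  abel
lemma lie_Eu_L (u : K) : ⁅Y.Euh u, Y.L⁆ = - (Y.Zu u * Y.L) := by
  rw [Euh, addLie, smulLie, Y.lie_E1_L, Y.lie_E2_L, Zu]
  simp only [mul_add, add_mul, mul_smul_comm, smul_mul_assoc, mul_one, mul_assoc, smul_neg]
  abel
lemma lie_Eu_Z (u : K) : ⁅Y.Euh u, Y.Zu u⁆ = Y.Zu u ^ 2 := by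
  conv_lhs => rw [Zu, lieMul, Y.lie_Eu_w, lieAdd, lieSmulOne, Y.lie_Eu_L]
  rw [Zu, pow_two]
  simp only [mul_add, add_mul, mul_smul_comm, smul_mul_assoc, mul_one, mul_assoc, smul_neg, sub_mul, mul_neg,
    smul_add, mul_zero]
  module

lemma lie_Bh_Z (u : K) (n : ℕ) : ⁅Y.Bh u n, Y.Zu u⁆ = 0 := by
  induction n with
  | zero =>
    rw [Bh, Zu, lieMul, lieAdd, lieSmulOne, addLie, addLie, smulLie, smulLie, Y.lie_E1_w, Y.lie_P_w,
      Y.lie_E1_L, Y.lie_P_L]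
    simp only [mul_add, add_mul, mul_smul_comm, smul_mul_assoc, mul_one, mul_assoc, smul_neg, smul_zero, add_zero, mul_neg]
    abel
  | succ n ih =>
    rw [Bh, smulLie, lieLie, ih, Y.lie_Eu_Z, liePow_zero ih]; simp

lemma lie_Bh_w (u : K) (n : ℕ) :
    ⁅Y.Bh u n, Y.w⁆ = ((n : K) + 1) • (Y.w * Y.Zu u ^ n * Y.w) := by
  induction n with
  | zero =>
    rw [Bh, addLie, smulLie, Y.lie_E1_w, Y.lie_P_w]; simp
  | succ n ih =>
    have h0 : (n : K) + 1 ≠ 0 := by exact_mod_cast Nat.succ_ne_zero n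
    have h1 := liePow_sq (Y.lie_Eu_Z u) n
    rw [Bh, smulLie, lieLie, ih, Y.lie_Eu_w, lieSub, lieAdd, lieMul, lieMul, lieSmul, lieMul, ih, Y.lie_Bh_Z,
      lieSmul, lieMul, lieMul, h1, Y.lie_Eu_w]
    simp only [ih, mul_add, add_mul, mul_sub, sub_mul, mul_smul_comm, smul_mul_assoc, mul_one, mul_assoc, mul_zero, zero_mul,
      zero_add, add_zero, smul_add, smul_sub, smul_smul]
    have e1 : Y.Zu u * (Y.Zu u ^ n * Y.w) = Y.Zu u ^ (n+1) * Y.w := by rw [← mul_assoc, ← pow_succ']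
    have e2 : Y.Zu u ^ n * (Y.Zu u * Y.w) = Y.Zu u ^ (n+1) * Y.w := by rw [← mul_assoc, ← pow_succ]
    simp only [e1, e2]
    push_cast
    match_scalars <;> field_simp <;> ring

lemma Bu_one (u : K) : Y.Bu u 1 = Y.E1 + u • Y.q := by
  apply LinearMap.ext; intro f
  have : Y.E1 f = Y.α⁻¹ • Y.Th (Y.w (Y.L (Y.io f))) := by
    rw [← Y.one1]; simp [E1, Ring.lie_def]
  rw [LinearMap.add_apply, this, LinearMap.smul_apply, Y.one2, Bu, cpr_apply]
  simp only [pow_one, Zu, Module.End.mul_apply, LinearMap.add_apply, LinearMap.smul_apply, Module.End.one_apply,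
    map_add, map_smul, smul_add]
  module

lemma ladder (u : K) (n : ℕ) : ⁅Y.Eu u, Y.Bu u n⁆ = (n : K) • Y.Bu u (n+1) := by
  rw [Bu, ← (Y.Good_Eu u).cpr_lie, liePow_sq (Y.lie_Eu_Z u), Bu, ← Y.cpr_smul, Nat.cast_smul_eq_nsmul]

lemma Good_Bh (u : K) (n : ℕ) : Y.Good (Y.Bh u n) (Y.Bu u (n+1)) := by
  induction n with
  | zero => rw [zero_add, Y.Bu_one]; exact (Y.Good_E1).add ((Y.Good_P).smul u)
  | succ n ih =>
    have := ((Y.Good_Eu u).lie ih).smul ((n : K) + 1)⁻¹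
    rw [Y.ladder, smul_smul] at this
    have h0 : (n : K) + 1 ≠ 0 := by exact_mod_cast Nat.succ_ne_zero n
    push_cast at this
    rw [inv_mul_cancel₀ h0, one_smul] at this
    exact this

lemma Bu_comm (u : K) (n m : ℕ) : ⁅Y.Bu u (n+1), Y.Bu u m⁆ = 0 := by
  rw [show Y.Bu u m = Y.cpr (Y.Zu u ^ m) from rfl, ← (Y.Good_Bh u n).cpr_lie, liePow_zero (Y.lie_Bh_Z u n)]
  apply LinearMap.ext; intro f; simp [cpr_apply]

/-- derivative of `Z^n` in `u` -/
def dZ (Y : Sys K M S) (u : K) : ℕ → Module.End K M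
  | 0 => 0
  | n + 1 => Y.Zu u * dZ Y u n + Y.w * Y.Zu u ^ n

lemma Zu_sub (u v : K) : Y.Zu v = Y.Zu u + (v - u) • Y.w := by
  rw [Zu, Zu]
  simp only [mul_add, mul_smul_comm, mul_one, sub_smul]
  module

/-- the sum `∑ (1/n) [B̂_n(u), Z(v)^m]`, `n+m=N` -/
def TN (u v : K) (N : ℕ) : Module.End K M :=
  ∑ n ∈ Finset.range N, ((n : K) + 1)⁻¹ • ⁅Y.Bh u n, Y.Zu v ^ (N - 1 - n)⁆

lemma tele (u v : K) (N : ℕ) : (v - u) • ∑ n ∈ Finset.range N, Y.Zu u ^ n * Y.w * Y.Zu v ^ (N - 1 - n) =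
    Y.Zu v ^ N - Y.Zu u ^ N := by
  induction N with
  | zero => simp
  | succ N ih =>
    rw [Finset.sum_range_succ', smul_add, Finset.smul_sum]
    have : ∀ n ∈ Finset.range N, (v - u) • (Y.Zu u ^ (n+1) * Y.w * Y.Zu v ^ (N + 1 - 1 - (n+1))) =
        Y.Zu u * ((v - u) • (Y.Zu u ^ n * Y.w * Y.Zu v ^ (N - 1 - n))) := by
      intro n _
      have e : N + 1 - 1 - (n+1) = N - 1 - n := by omega
      rw [e, mul_smul_comm, pow_succ', mul_assoc, mul_assoc, mul_assoc]
    rw [Finset.sum_congr rfl this, ← Finset.mul_sum, ← Finset.smul_sum, ih]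
    have h := Y.Zu_sub u v
    have h2 : (v - u) • (Y.w * Y.Zu v ^ N) = (Y.Zu v - Y.Zu u) * Y.Zu v ^ N := by
      rw [h]; simp
    simp only [pow_zero, one_mul, Nat.add_sub_cancel, Nat.sub_zero, h2]
    rw [pow_succ', pow_succ']
    simp only [mul_sub, sub_mul]; abel

lemma TN_succ (u v : K) (N : ℕ) : Y.TN u v (N+1) = Y.Zu v * Y.TN u v N +
    Y.w * (Y.Zu v ^ N - Y.Zu u ^ N) := by
  rw [TN, Finset.sum_range_succ]
  have e0 : ⁅Y.Bh u N, Y.Zu v ^ (N + 1 - 1 - N)⁆ = 0 := by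
    have : N + 1 - 1 - N = 0 := by omega
    rw [this]; simp [Ring.lie_def]
  rw [e0, smul_zero, add_zero, ← Y.tele, TN, Finset.mul_sum, Finset.smul_sum, Finset.mul_sum, ← Finset.sum_add_distrib]
  apply Finset.sum_congr rfl
  intro n hn
  have hn' := Finset.mem_range.mp hn
  have e : N + 1 - 1 - n = (N - 1 - n) + 1 := by omega
  have h0 : (n : K) + 1 ≠ 0 := by exact_mod_cast Nat.succ_ne_zero n
  have hz : ⁅Y.Bh u n, Y.Zu v⁆ = ((v - u) * ((n : K) + 1)) • (Y.w * Y.Zu u ^ n * Y.w) := by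
    rw [Y.Zu_sub u v, lieAdd, lieSmul, Y.lie_Bh_Z, Y.lie_Bh_w, smul_smul, zero_add]
  rw [e, pow_succ', lieMul, hz]
  simp only [smul_add, mul_smul_comm, smul_mul_assoc, smul_smul, mul_assoc]
  rw [add_comm]
  congr 2
  field_simp

lemma TN_eq {u v : K} (huv : v ≠ u) (N : ℕ) : Y.TN u v N = Y.dZ v N -
    (v - u)⁻¹ • (Y.Zu v ^ N - Y.Zu u ^ N) := by
  have hne : v - u ≠ 0 := sub_ne_zero.mpr huv
  induction N with
  | zero => simp [TN, dZ]
  | succ N ih =>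
    rw [Y.TN_succ, ih, dZ]
    have h := Y.Zu_sub u v
    have h2 : Y.w = (v - u)⁻¹ • (Y.Zu v - Y.Zu u) := by
      rw [h]; simp [smul_smul, inv_mul_cancel₀ hne]
    have h3 : Y.w * Y.Zu u ^ N = (v - u)⁻¹ • ((Y.Zu v - Y.Zu u) * Y.Zu u ^ N) := by
      conv_lhs => rw [h2]
      rw [smul_mul_assoc]
    rw [mul_sub Y.w, h3, pow_succ', pow_succ', mul_sub, mul_smul_comm, mul_sub, sub_mul]
    module

def dB (u : K) (N : ℕ) : Module.End K S := Y.cpr (Y.dZ u N)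

lemma A6 {u v : K} (huv : v ≠ u) (N : ℕ) :
    ∑ n ∈ Finset.range N, ((n : K) + 1)⁻¹ • ⁅Y.Bu u (n+1), Y.Bu v (N - 1 - n)⁆ =
      Y.dB v N - (v - u)⁻¹ • (Y.Bu v N - Y.Bu u N) := by
  have := congrArg (Y.cpr) (Y.TN_eq huv N)
  rw [TN, Y.cpr_sum, Y.cpr_sub, Y.cpr_smul, Y.cpr_sub] at this
  rw [dB, Bu, Bu, ← this]
  apply Finset.sum_congr rfl
  intro n _
  rw [Y.cpr_smul, (Y.Good_Bh u n).cpr_lie, ← Bu]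
end Sys
end A3
end JK
end

open scoped Classical
noncomputable section
set_option linter.unusedSectionVars false
set_option linter.unusedSimpArgs false
namespace JK
open MvPolynomial
section A4
variable {K : Type} [Field K]

/-- vanishing of polynomials with vector coefficients -/
lemma vpoly_zero [CharZero K] {V : Type} [AddCommGroup V] [Module K V] (N : ℕ) (x : ℕ → V)
    (h : ∀ u : K, ∑ i ∈ Finset.range N, u ^ i • x i = 0) : ∀ i < N, x i = 0 := by
  intro i hi
  rw [← Module.forall_dual_apply_eq_zero_iff K]
  intro φ
  have hp : (∑ i ∈ Finset.range N, Polynomial.C (φ (x i)) * Polynomial.X ^ i : Polynomial K) = 0 := by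
    apply Polynomial.funext
    intro u
    have := congrArg φ (h u)
    simp only [map_sum, map_smul, smul_eq_mul, map_zero] at this
    rw [Polynomial.eval_finsetSum]
    simp only [Polynomial.eval_mul, Polynomial.eval_C, Polynomial.eval_pow, Polynomial.eval_X, Polynomial.eval_zero]
    rw [← this]
    exact Finset.sum_congr rfl (fun _ _ => mul_comm _ _)
  have := congrArg (fun p => Polynomial.coeff p i) hp
  simpa [Polynomial.coeff_C_mul, Polynomial.coeff_X_pow, hi] using this

variable {M S : Type} [AddCommGroup M] [Module K M] [AddCommGroup S] [Module K S] (Y : Sys K M S)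
namespace Sys

/-- coefficient of `u^l` in `Z(u)^n` -/
def Wd (Y : Sys K M S) : ℕ → ℕ → Module.End K M
  | 0, 0 => 1
  | 0, _ + 1 => 0
  | n + 1, 0 => Y.w * Y.L * Wd Y n 0
  | n + 1, l + 1 => Y.w * Y.L * Wd Y n (l+1) + Y.w * Wd Y n l

def BB (n l : ℕ) : Module.End K S := Y.cpr (Y.Wd n l)

lemma Wd_zero {n l : ℕ} (h : n < l) : Y.Wd n l = 0 := by
  induction n generalizing l with
  | zero => cases l with
    | zero => omega
    | succ l => rfl
  | succ n ih => cases l with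
    | zero => omega
    | succ l => rw [Wd, ih (by omega), ih (by omega)]; simp

lemma cpr_zero : Y.cpr 0 = 0 := by
  apply LinearMap.ext; intro f; simp [cpr_apply]

lemma BB_zero {n l : ℕ} (h : n < l) : Y.BB n l = 0 := by
  rw [BB, Y.Wd_zero h, Y.cpr_zero]

lemma Wd_diag (n : ℕ) : Y.Wd n n = Y.w ^ n := by
  induction n with
  | zero => rfl
  | succ n ih => rw [Wd, Y.Wd_zero (Nat.lt_succ_self n), ih, pow_succ']; simp

lemma Zu_mul (u : K) (A : Module.End K M) : Y.Zu u * A = Y.w * Y.L * A + u • (Y.w * A) := by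
  rw [Zu]
  simp only [mul_add, add_mul, mul_smul_comm, smul_mul_assoc, mul_one]
lemma Zu_pow (u : K) (n : ℕ) (x : M) : (Y.Zu u ^ (n+1)) x = Y.Zu u ((Y.Zu u ^ n) x) := by
  rw [pow_succ', Module.End.mul_apply]

lemma Zpow (u : K) (n N : ℕ) (h : n < N) : Y.Zu u ^ n = ∑ l ∈ Finset.range N, u ^ l • Y.Wd n l := by
  induction n generalizing N with
  | zero =>
    obtain ⟨N, rfl⟩ : ∃ N', N = N' + 1 := ⟨N - 1, by omega⟩
    rw [Finset.sum_range_succ']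
    simp [Wd]
  | succ n ih =>
    obtain ⟨N, rfl⟩ : ∃ N', N = N' + 1 := ⟨N - 1, by omega⟩
    rw [Finset.sum_range_succ', pow_succ']
    simp only [Wd, smul_add, Finset.sum_add_distrib]
    rw [Zu_mul]
    conv_lhs => rw [ih (N+1) (by omega)]
    conv_lhs => enter [2]; rw [← ih (N+1) (by omega), ih N (by omega)]
    rw [Finset.mul_sum, Finset.mul_sum, Finset.sum_range_succ']
    simp only [mul_smul_comm, Finset.smul_sum, smul_smul, ← pow_succ']
    abel

lemma dZ_eq (u : K) (n N : ℕ) (h : n ≤ N) :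
    Y.dZ u n = ∑ l ∈ Finset.range N, (((l : K) + 1) * u ^ l) • Y.Wd n (l+1) := by
  induction n generalizing N with
  | zero => simp [dZ, Wd]
  | succ n ih =>
    rw [dZ]
    obtain ⟨N, rfl⟩ : ∃ N', N = N' + 1 := ⟨N - 1, by omega⟩
    rw [Zu_mul]
    conv_lhs => enter [1,1]; rw [ih (N+1) (by omega)]
    rw [ih N (by omega), Y.Zpow u n (N+1) (by omega)]
    simp only [Wd, smul_add, Finset.sum_add_distrib]
    rw [Finset.mul_sum, Finset.mul_sum, Finset.mul_sum, add_assoc]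
    congr 1
    · simp only [mul_smul_comm]
    · rw [Finset.sum_range_succ', Finset.sum_range_succ' (fun l => (((l : K) + 1) * u ^ l) • (Y.w * Y.Wd n l))]
      simp only [mul_smul_comm, Finset.smul_sum, smul_smul]
      rw [← add_assoc, ← Finset.sum_add_distrib]
      congr 1
      · apply Finset.sum_congr rfl
        intro l _
        push_cast
        rw [← add_smul]; congr 1; ring
      · simp

lemma Bu_eq (u : K) (n N : ℕ) (h : n < N) : Y.Bu u n = ∑ l ∈ Finset.range N, u ^ l • Y.BB n l := by
  rw [Bu, Y.Zpow u n N h, Y.cpr_sum]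
  simp only [cpr_smul, BB]
lemma dB_eq (u : K) (n N : ℕ) (h : n ≤ N) :
    Y.dB u n = ∑ l ∈ Finset.range N, (((l : K) + 1) * u ^ l) • Y.BB n (l+1) := by
  rw [dB, Y.dZ_eq u n N h, Y.cpr_sum]
  simp only [cpr_smul, BB]

lemma Bu_zero (u : K) : Y.Bu u 0 = 0 := by
  apply LinearMap.ext; intro f; simp [Bu, cpr_apply, Y.Thio]

variable [CharZero K]

/-- symmetric form of the bracket identity -/
lemma A6sym (u v : K) (N : ℕ) :
    ∑ n ∈ Finset.range (N+1), ((n : K)⁻¹ * ((N - n : ℕ) : K)⁻¹) • ⁅Y.Bu u n, Y.Bu v (N - n)⁆ =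
      (N : K)⁻¹ • (Y.dB v N - Y.dB u N) := by
  rcases Nat.eq_zero_or_pos N with h0 | hN
  · subst h0; simp
  have hNK : (N : K) ≠ 0 := by exact_mod_cast hN.ne'
  by_cases huv : v = u
  · subst huv
    rw [sub_self, smul_zero]
    apply Finset.sum_eq_zero
    intro n _
    cases n with
    | zero => simp
    | succ n => rw [Y.Bu_comm, smul_zero]
  have a1 := Y.A6 huv N
  have a2 := Y.A6 (Ne.symm huv) N
  have b1 : ∑ n ∈ Finset.range (N+1), (n : K)⁻¹ • ⁅Y.Bu u n, Y.Bu v (N - n)⁆ =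
     Y.dB v N - (v - u)⁻¹ • (Y.Bu v N - Y.Bu u N) := by
    rw [← a1, Finset.sum_range_succ']
    simp only [Nat.cast_zero, inv_zero, zero_smul, add_zero, Nat.cast_add, Nat.cast_one]
    apply Finset.sum_congr rfl
    intro n _
    rw [show N - (n+1) = N - 1 - n by omega]
  have b2 : ∑ n ∈ Finset.range (N+1), ((N - n : ℕ) : K)⁻¹ • ⁅Y.Bu u n, Y.Bu v (N - n)⁆ =
     - (Y.dB u N - (u - v)⁻¹ • (Y.Bu u N - Y.Bu v N)) := by
    rw [← a2, ← Finset.sum_neg_distrib, ← Finset.sum_range_reflect, Finset.sum_range_succ']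
    have : N + 1 - 1 - 0 = N := by omega
    simp only [this, Nat.sub_self, Nat.cast_zero, inv_zero, zero_smul, add_zero]
    apply Finset.sum_congr rfl
    intro n hn
    have hn := Finset.mem_range.mp hn
    rw [show N - (N + 1 - 1 - (n+1)) = n + 1 by omega, show N + 1 - 1 - (n+1) = N - 1 - n by omega]
    push_cast
    rw [← smul_neg]
    congr 1
    simp [Ring.lie_def]
  have b3 : ∑ n ∈ Finset.range (N+1), ((n : K)⁻¹ * ((N - n : ℕ) : K)⁻¹) • ⁅Y.Bu u n, Y.Bu v (N - n)⁆ =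
      (N : K)⁻¹ • (∑ n ∈ Finset.range (N+1), (n : K)⁻¹ • ⁅Y.Bu u n, Y.Bu v (N - n)⁆ + 
        ∑ n ∈ Finset.range (N+1), ((N - n : ℕ) : K)⁻¹ • ⁅Y.Bu u n, Y.Bu v (N - n)⁆) := by
    rw [← Finset.sum_add_distrib, Finset.smul_sum]
    apply Finset.sum_congr rfl
    intro n hn
    have hn := Finset.mem_range.mp hn
    rcases Nat.eq_zero_or_pos n with h | h
    · subst h
      simp [Y.Bu_zero, Ring.lie_def]
    rcases Nat.eq_zero_or_pos (N - n) with h' | h'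
    · rw [h']
      simp [Y.Bu_zero, Ring.lie_def]
    rw [← add_smul, smul_smul]
    congr 1
    have e1 : (n : K) ≠ 0 := by exact_mod_cast h.ne'
    have e2 : ((N - n : ℕ) : K) ≠ 0 := by exact_mod_cast h'.ne'
    have e3 : (N : K) = n + ((N - n : ℕ) : K) := by
      rw [← Nat.cast_add]; congr 1; omega
    rw [e3] at hNK ⊢
    field_simp
    ring
  rw [b3, b1, b2]
  have e : (u - v)⁻¹ = - (v - u)⁻¹ := by rw [← neg_sub, inv_neg]
  rw [e]
  congr 1
  module

lemma lie_sum_sum {R : Type} [Ring R] [Algebra K R] (s t : Finset ℕ) (f g : ℕ → R) :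
    ⁅∑ i ∈ s, f i, ∑ j ∈ t, g j⁆ = ∑ i ∈ s, ∑ j ∈ t, ⁅f i, g j⁆ := by
  simp only [Ring.lie_def, Finset.sum_mul_sum, Finset.sum_sub_distrib]
  congr 1
  exact Finset.sum_comm

/-- normalised operators `C_{l,n} = B_{n,l}/n` -/
def Cn (l n : ℕ) : Module.End K S := (n : K)⁻¹ • Y.BB n l

lemma Cn_lie (i j N : ℕ) : ∑ n ∈ Finset.range (N+1), ⁅Y.Cn i n, Y.Cn j (N - n)⁆ =
    (if i = 0 then ((j : K) + 1) • Y.Cn (j+1) N else 0) -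
    (if j = 0 then ((i : K) + 1) • Y.Cn (i+1) N else 0) := by
  set T := N + i + j + 2 with hT
  set X : ℕ → ℕ → Module.End K S := fun i j => ∑ n ∈ Finset.range (N+1), ⁅Y.Cn i n, Y.Cn j (N - n)⁆ -
    ((if i = 0 then ((j : K) + 1) • Y.Cn (j+1) N else 0) -
    (if j = 0 then ((i : K) + 1) • Y.Cn (i+1) N else 0)) with hX
  have key : ∀ u v : K, ∑ i ∈ Finset.range T, u ^ i • ∑ j ∈ Finset.range T, v ^ j • X i j = 0 := by
    intro u v
    have h := Y.A6sym u v N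
    rw [Y.dB_eq v N T (by omega), Y.dB_eq u N T (by omega)] at h
    have e1 : ∀ n ∈ Finset.range (N+1), ((n : K)⁻¹ * ((N - n : ℕ) : K)⁻¹) • ⁅Y.Bu u n, Y.Bu v (N - n)⁆ =
        ∑ i ∈ Finset.range T, ∑ j ∈ Finset.range T, (u ^ i * v ^ j) • ⁅Y.Cn i n, Y.Cn j (N - n)⁆ := by
      intro n hn
      have hn := Finset.mem_range.mp hn
      rw [Y.Bu_eq u n T (by omega), Y.Bu_eq v (N - n) T (by omega), lie_sum_sum (K := K)]
      simp only [Finset.smul_sum]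
      refine Finset.sum_congr rfl (fun i _ => Finset.sum_congr rfl (fun j _ => ?_))
      rw [Cn, Cn]
      simp only [smulLie, lieSmul, smul_smul]
      congr 1; ring
    rw [Finset.sum_congr rfl e1] at h
    have hT0 : 0 < T := by omega
    have e2 : ∑ i ∈ Finset.range T, u ^ i • ∑ j ∈ Finset.range T, v ^ j • 
        (if i = 0 then ((j : K) + 1) • Y.Cn (j+1) N else 0) = (N : K)⁻¹ • ∑ l ∈ Finset.range T, (((l : K) + 1) * v ^ l) • Y.BB N (l+1) := by
      rw [Finset.sum_eq_single 0]
      · simp only [if_true, pow_zero, one_smul, Finset.smul_sum, smul_smul, Cn]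
        refine Finset.sum_congr rfl (fun j _ => ?_)
        congr 1; ring
      · intro b _ hb; simp [hb]
      · intro h; simp at h
    have e3 : ∑ i ∈ Finset.range T, u ^ i • ∑ j ∈ Finset.range T, v ^ j • 
        (if j = 0 then ((i : K) + 1) • Y.Cn (i+1) N else 0) = (N : K)⁻¹ • ∑ l ∈ Finset.range T, (((l : K) + 1) * u ^ l) • Y.BB N (l+1) := by
      rw [Finset.smul_sum]
      refine Finset.sum_congr rfl (fun i _ => ?_)
      rw [Finset.sum_eq_single 0]
      · simp only [if_true, pow_zero, one_smul, smul_smul, Cn]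
        congr 1; ring
      · intro b _ hb; simp [hb]
      · intro h; simp at h
    have e4 : ∑ i ∈ Finset.range T, u ^ i • ∑ j ∈ Finset.range T, v ^ j • ∑ n ∈ Finset.range (N+1), ⁅Y.Cn i n, Y.Cn j (N - n)⁆ =
      ∑ n ∈ Finset.range (N+1), ∑ i ∈ Finset.range T, ∑ j ∈ Finset.range T, (u ^ i * v ^ j) • ⁅Y.Cn i n, Y.Cn j (N - n)⁆ := by
      simp only [Finset.smul_sum, smul_smul]
      rw [Finset.sum_comm]
      conv_rhs => rw [Finset.sum_comm]
      rw [Finset.sum_comm]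
      refine Finset.sum_congr rfl (fun i _ => ?_)
      rw [Finset.sum_comm]
    simp only [hX, smul_sub, Finset.sum_sub_distrib]
    rw [e2, e3, e4, h]
    rw [smul_sub]; abel
  have h1 : ∀ v : K, ∑ j ∈ Finset.range T, v ^ j • X i j = 0 := fun v =>
    vpoly_zero T (fun i => ∑ j ∈ Finset.range T, v ^ j • X i j) (fun u => key u v) i (by omega)
  have h2 := vpoly_zero T (fun j => X i j) h1 j (by omega)
  exact sub_eq_zero.mp h2

/-- the operator `e = io ∘ c0` kills `Z^j`, `j ≥ 1` -/
lemma d1_Z (u : K) (x : M) : Y.d1 (Y.Zu u x) = Y.Zu u (Y.d1 x) + x - Y.io (Y.c0 x) := by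
  simp only [Zu, Module.End.mul_apply, LinearMap.add_apply, LinearMap.smul_apply, Module.End.one_apply, map_add, map_smul,
    Y.d1w, Y.d1L]
  abel

lemma d1_Zpow (u : K) (n : ℕ) (x : M) : Y.d1 ((Y.Zu u ^ (n+1)) x) =
    (Y.Zu u ^ (n+1)) (Y.d1 x) + ((n : K) + 1) • (Y.Zu u ^ n) x - (Y.Zu u ^ n) (Y.io (Y.c0 x)) := by
  induction n with
  | zero => simp [Y.d1_Z]
  | succ n ih =>
    rw [Zu_pow, Y.d1_Z, ih]
    have : Y.c0 ((Y.Zu u ^ (n+1)) x) = 0 := by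
      rw [pow_succ', Module.End.mul_apply, Zu, Module.End.mul_apply, Y.c0w]
    rw [this, map_zero, sub_zero, map_sub, map_add, map_smul]
    simp only [← Zu_pow]
    push_cast
    module

lemma ds_Bu (u : K) (n : ℕ) (f : S) : Y.ds (Y.Bu u (n+1) f) = Y.Bu u (n+1) (Y.ds f) +
    (if n = 0 then (u * Y.α⁻¹) • f else ((n : K) + 1) • Y.Bu u n f) := by
  rw [Bu, cpr_apply, map_smul, Y.dsTh, Y.d1_Zpow, Y.d1io, Y.c0io, cpr_apply]
  have h1 : Y.c1 ((Y.Zu u ^ (n+1)) (Y.io f)) = if n = 0 then u • f else Y.Th ((Y.Zu u ^ n) (Y.io f)) := by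
    have h2 : ∀ y, Y.c1 (Y.Zu u y) = Y.c0 (Y.L y) + u • Y.c0 y := by
      intro y; simp [Zu, Y.c1w]
    rw [Zu_pow, h2]
    cases n with
    | zero => simp [Y.c0Lio, Y.c0io]
    | succ n =>
      rw [if_neg (Nat.succ_ne_zero n), Zu_pow]
      generalize (Y.Zu u ^ n) (Y.io f) = z
      simp [Zu, Y.c0w, Y.c0Lw]
  rw [h1, map_sub, map_add, map_smul]
  split_ifs with h
  · subst h
    simp [Y.Thio, smul_smul, mul_comm]
  · rw [Bu, cpr_apply]; module

lemma ed_BB (n l : ℕ) (f : S) : Y.ed (Y.BB n l f) = Y.BB n l (Y.ed f) + (n : K) • Y.BB n l f := by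
  have h : ∀ x, Y.Ed (Y.Wd n l x) = Y.Wd n l (Y.Ed x) + (n : K) • Y.Wd n l x := by
    induction n generalizing l with
    | zero => cases l with
      | zero => simp [Wd]
      | succ l => simp [Wd]
    | succ n ih => 
      intro x
      cases l with
      | zero =>
        simp only [Wd, Module.End.mul_apply, Y.EdW, Y.EdL, ih, map_add, map_smul]
        push_cast; module
      | succ l =>
        simp only [Wd, Module.End.mul_apply, LinearMap.add_apply, Y.EdW, Y.EdL, ih, map_add, map_smul]
        push_cast; module
  rw [BB, cpr_apply, map_smul, ← Y.EdTh, h, cpr_apply, map_add, Y.EdIo, map_smul]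
  module
end Sys
end A4
end JK
end

open scoped Classical
noncomputable section
set_option linter.unusedSectionVars false
set_option linter.unusedSimpArgs false
namespace JK
open MvPolynomial
section A5
variable {K : Type} [Field K]

/-- `∂/∂p_1` -/
def dS1 : Sy K →ₗ[K] Sy K := (pderiv (1 : ℕ+)).toLinearMap
def dM1 : Mw K →ₗ[K] Mw K := Finsupp.mapRange.linearMap dS1
/-- Euler operator -/
def eS : Sy K →ₗ[K] Sy K :=
  (MvPolynomial.mkDerivation K (fun k : ℕ+ => (((k : ℕ) : K) • X k : Sy K))).toLinearMap
def eM : Mw K →ₗ[K] Mw K := Finsupp.lsum K (fun a : ℕ => Finsupp.lsingle a ∘ₗ (eS + (a : K) • LinearMap.id))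
def cM (a : ℕ) : Mw K →ₗ[K] Sy K := Finsupp.lapply a

lemma dS1_pp (c : ℕ) : dS1 (pp c : Sy K) = if c = 1 then 1 else 0 := by
  rcases Nat.eq_zero_or_pos c with h | h
  · subst h; simp
  · rw [pp, dif_pos h]
    simp only [dS1, Derivation.coeFn_coe, pderiv_X, Pi.single_apply]
    by_cases hc : c = 1
    · subst hc; rw [if_pos rfl]; exact if_pos rfl
    · rw [if_neg hc, if_neg]
      intro h'
      apply hc
      have := congrArg PNat.val h'
      exact this

lemma dS1_mul (f g : Sy K) : dS1 (f * g) = f * dS1 g + g * dS1 f := by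
  simp [dS1]
lemma dS1_ppmul (c : ℕ) (f : Sy K) : dS1 (pp c * f) = pp c * dS1 f + if c = 1 then f else 0 := by
  rw [dS1_mul, dS1_pp]; split_ifs <;> simp
lemma dM1_single (a : ℕ) (f : Sy K) : dM1 (Finsupp.single a f : Mw K) = Finsupp.single a (dS1 f) := by
  simp [dM1]
lemma dM1_io (f : Sy K) : dM1 (io f) = io (dS1 f) := by simp [io_def, dM1_single]
lemma dM1_wS (x : Mw K) : dM1 (wS x) = wS (dM1 x) := by
  have : dM1 ∘ₗ wS = wS ∘ₗ (dM1 (K := K)) := by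
    apply Finsupp.lhom_ext
    intro c f
    simp only [LinearMap.comp_apply, dM1_single, wS_single]
  exact LinearMap.congr_fun this x
lemma dM1_mM (c : ℕ) (x : Mw K) : dM1 (mM c x) = mM c (dM1 x) + if c = 1 then x else 0 := by
  have : dM1 ∘ₗ mM c = mM c ∘ₗ (dM1 (K := K)) + if c = 1 then LinearMap.id else 0 := by
    apply Finsupp.lhom_ext
    intro a f
    split_ifs with h <;>
    simp only [LinearMap.comp_apply, dM1_single, mM_single, dS1_ppmul, LinearMap.add_apply, h, if_true, if_false, Finsupp.single_add, LinearMap.id_apply, LinearMap.zero_apply,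
      add_zero]
  have h2 := LinearMap.congr_fun this x
  split_ifs at h2 ⊢ <;> simpa using h2
lemma cM_wS0 (x : Mw K) : cM 0 (wS x) = 0 := by
  have : cM 0 ∘ₗ wS = (0 : Mw K →ₗ[K] Sy K) := by
    apply Finsupp.lhom_ext
    intro c f
    simp [cM]
  exact LinearMap.congr_fun this x
lemma cM_wS1 (x : Mw K) : cM 1 (wS x) = cM 0 x := by
  have : cM 1 ∘ₗ wS = (cM 0 : Mw K →ₗ[K] Sy K) := by
    apply Finsupp.lhom_ext
    intro c f
    simp [cM, Finsupp.single_apply]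
  exact LinearMap.congr_fun this x
lemma cM_io (f : Sy K) : cM 0 (io f) = f := by simp [cM, io_def]
lemma cM_L_wS (α : K) (x : Mw K) : cM 0 (L α (wS x)) = Th (wS x) := by
  rw [L_wS, map_add, map_add, map_smul, cM_wS0, cM_wS0, cM_io]; simp
lemma cM_mM (a c : ℕ) (x : Mw K) : cM a (mM c x) = pp c * cM a x := by
  simp [cM, mM]
lemma cM_L_io (α : K) (f : Sy K) : cM 0 (L α (io f)) = 0 := by
  have := ext_p (A := cM 0 ∘ₗ L α ∘ₗ io) (B := 0) ?_ ?_ f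
  · simpa using this
  · simp [L_io]
  · intro f h c
    simp only [LinearMap.comp_apply, LinearMap.zero_apply] at h ⊢
    rw [← mM_io, L_mM, map_add, cM_mM, h, map_smul]
    cases c with
    | zero => simp
    | succ c => rw [← wS_wpow, cM_wS0]; simp
lemma dM1_L_io (α : K) (f : Sy K) : dM1 (L α (io f)) = L α (io (dS1 f)) := by
  have := ext_p (A := dM1 ∘ₗ L α ∘ₗ io) (B := L α ∘ₗ io ∘ₗ dS1) ?_ ?_ f
  · simpa using this
  · simp [L_io, dS1]
  · intro f h c
    simp only [LinearMap.comp_apply] at h ⊢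
    have e : ∀ x : Mw K, dM1 ((wS ^ c) x) = (wS ^ c) (dM1 x) := by
      intro x
      induction c with
      | zero => simp
      | succ c ih => rw [← wS_wpow, dM1_wS, ih, wS_wpow]
    rw [← mM_io, L_mM, map_add, dM1_mM, h, map_smul, e, dM1_io, dS1_ppmul, map_add, map_add, ← mM_io, L_mM]
    split_ifs
    · abel
    · simp
lemma w_d1_L (α : K) (x : Mw K) : wS (dM1 (L α x)) = wS (L α (dM1 x)) + x - io (cM 0 x) := by
  have := ext_w (A := wS ∘ₗ dM1 ∘ₗ L α) (B := wS ∘ₗ L α ∘ₗ dM1 + LinearMap.id - io ∘ₗ cM 0) ?_ ?_ x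
  · simpa using this
  · intro f
    simp [dM1_L_io, dM1_io, cM_io]
  · intro x h
    simp only [LinearMap.comp_apply, LinearMap.add_apply, LinearMap.sub_apply, LinearMap.id_apply] at h ⊢
    have hT : dS1 (Th (wS x)) = Th (wS (dM1 x)) + cM 0 x := by
      have : dS1 ∘ₗ Th ∘ₗ wS = Th ∘ₗ wS ∘ₗ dM1 + (cM 0 : Mw K →ₗ[K] Sy K) := by
        apply Finsupp.lhom_ext
        intro a f
        simp only [LinearMap.comp_apply, LinearMap.add_apply, wS_single, Th_single, dM1_single, dS1_ppmul, cM, Finsupp.lapply_apply,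
          Finsupp.single_apply, add_eq_right]
      exact LinearMap.congr_fun this x
    rw [L_wS, dM1_wS, L_wS]
    simp only [map_add, map_smul, dM1_wS, dM1_io, hT, h, cM_wS0, map_zero, map_sub]
    abel
lemma dS1_Th (x : Mw K) : dS1 (Th x) = Th (dM1 x) + cM 1 x := by
  have : dS1 ∘ₗ Th = Th ∘ₗ dM1 + (cM 1 : Mw K →ₗ[K] Sy K) := by
    apply Finsupp.lhom_ext
    intro a f
    simp only [LinearMap.comp_apply, LinearMap.add_apply, wS_single, Th_single, dM1_single, dS1_ppmul, cM, Finsupp.lapply_apply,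
      Finsupp.single_apply]
  exact LinearMap.congr_fun this x

lemma eS_pp (c : ℕ) : eS (pp c : Sy K) = (c : K) • pp c := by
  rcases Nat.eq_zero_or_pos c with h | h
  · subst h; simp
  · rw [pp, dif_pos h]
    simp only [eS, Derivation.coeFn_coe, mkDerivation_X]
    rfl
lemma eS_ppmul (c : ℕ) (f : Sy K) : eS (pp c * f) = pp c * eS f + (c : K) • (pp c * f) := by
  have : eS (pp c * f) = pp c * eS f + f * eS (pp c) := by simp [eS]
  rw [this, eS_pp, mul_smul_comm, mul_comm f]
lemma eS_one : eS (1 : Sy K) = 0 := by simp [eS]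
lemma eM_single (a : ℕ) (f : Sy K) : eM (Finsupp.single a f : Mw K) = Finsupp.single a (eS f + (a : K) • f) := by
  simp [eM]
lemma eM_io (f : Sy K) : eM (io f) = io (eS f) := by simp [io_def, eM_single]
lemma eM_wS (x : Mw K) : eM (wS x) = wS (eM x) + wS x := by
  have : eM ∘ₗ wS = wS ∘ₗ (eM (K := K)) + wS := by
    apply Finsupp.lhom_ext
    intro c f
    simp only [LinearMap.comp_apply, eM_single, wS_single, LinearMap.add_apply, ← Finsupp.single_add]
    congr 1; push_cast; module
  exact LinearMap.congr_fun this x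
lemma eM_mM (c : ℕ) (x : Mw K) : eM (mM c x) = mM c (eM x) + (c : K) • mM c x := by
  have : eM ∘ₗ mM c = mM c ∘ₗ (eM (K := K)) + (c : K) • mM c := by
    apply Finsupp.lhom_ext
    intro a f
    simp only [LinearMap.comp_apply, eM_single, mM_single, eS_ppmul, LinearMap.add_apply, LinearMap.smul_apply, Finsupp.smul_single, ← Finsupp.single_add]
    congr 1
    rw [mul_add, mul_smul_comm]; abel
  exact LinearMap.congr_fun this x
lemma Th_eM (x : Mw K) : Th (eM x) = eS (Th x) := by
  have : Th ∘ₗ eM = eS ∘ₗ (Th (K := K)) := by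
    apply Finsupp.lhom_ext
    intro a f
    simp only [LinearMap.comp_apply, eM_single, Th_single, eS_ppmul, mul_add, mul_smul_comm]
  exact LinearMap.congr_fun this x
lemma eM_L_io (α : K) (f : Sy K) : eM (L α (io f)) = L α (io (eS f)) := by
  have := ext_p (A := eM ∘ₗ L α ∘ₗ io) (B := L α ∘ₗ io ∘ₗ eS) ?_ ?_ f
  · simpa using this
  · simp [L_io, eS]
  · intro f h c
    simp only [LinearMap.comp_apply] at h ⊢
    have e : ∀ x : Mw K, eM ((wS ^ c) x) = (wS ^ c) (eM x) + (c : K) • (wS ^ c) x := by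
      intro x
      induction c with
      | zero => simp
      | succ c ih => rw [← wS_wpow, eM_wS, ih, ← wS_wpow, map_add, map_smul]; push_cast; module
    rw [← mM_io, L_mM, map_add, eM_mM, h, map_smul, e, eM_io, eS_ppmul, map_add, map_add, ← mM_io, map_smul, map_smul, ← mM_io, L_mM, L_mM]
    module
lemma eM_L (α : K) (x : Mw K) : eM (L α x) = L α (eM x) := by
  have := ext_w (A := eM ∘ₗ L α) (B := L α ∘ₗ eM) ?_ ?_ x
  · simpa using this
  · intro f
    simp [eM_L_io, eM_io]
  · intro x h
    simp only [LinearMap.comp_apply] at h ⊢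
    rw [L_wS, eM_wS, map_add (L α), L_wS, L_wS]
    simp only [map_add, map_smul, eM_wS, eM_io, h, ← Th_eM, smul_add]
    module

variable [CharZero K]
/-- the concrete operator system -/
def JS {α : K} (hα : α ≠ 0) : Sys K (Mw K) (Sy K) where
  α := α
  io := io
  Th := Th
  w := wS
  L := L α
  D := Dh α
  P := α⁻¹ • mM 1
  d := DS α
  q := α⁻¹ • mp 1
  Dio := Dh_io α
  ThD := fun m => (DS_Th hα m).symm
  Pio := fun f => by simp
  ThP := fun f => by simp [Th_mM]
  Dw := Dh_wS α
  DL := Dh_L hα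
  Pw := fun x => by simp [mM_wS]
  PL := fun x => by
    simp only [LinearMap.smul_apply, map_smul, L_mM, smul_add, smul_smul]
    simp [hα]
  one1 := fun f => by
    simp only [LinearMap.smul_apply, map_smul, mp_apply, DS_pp hα, Kop_apply]
    simp only [pow_one, L_wS, map_add, Th_io, map_smul]
    match_scalars <;> field_simp <;> ring
  one2 := fun f => by
    have := Th_wpow_io (K := K) 1 f
    rw [pow_one] at this
    simp [this]
  Thio := Th_io
  d1 := dM1
  ds := dS1
  c0 := cM 0
  c1 := cM 1
  d1io := dM1_io
  d1w := dM1_wS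
  d1L := w_d1_L α
  dsTh := dS1_Th
  c1w := cM_wS1
  c0w := cM_wS0
  c0Lw := cM_L_wS α
  c0io := cM_io
  c0Lio := cM_L_io α
  Ed := eM
  ed := eS
  EdIo := eM_io
  EdTh := Th_eM
  EdW := eM_wS
  EdL := eM_L α

lemma BB_diag {α : K} (hα : α ≠ 0) (n : ℕ) (f : Sy K) : (JS hα).BB n n f = α⁻¹ • (pp n * f) := by
  rw [Sys.BB, Sys.cpr_apply, Sys.Wd_diag]
  have : (JS hα).Th (((JS hα).w ^ n) ((JS hα).io f)) = pp n * f := Th_wpow_io n f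
  rw [this]; rfl
lemma BB_one {α : K} (hα : α ≠ 0) (n : ℕ) : (JS hα).BB n 0 1 = 0 := by
  cases n with
  | zero => rw [BB_diag hα 0]; simp
  | succ n =>
    have h : ∀ n, (JS hα).Wd (n+1) 0 ((JS hα).io 1) = 0 := by
      intro n
      induction n with
      | zero =>
        have : (JS hα).L ((JS hα).io 1) = 0 := Th_L_io_one α
        simp [Sys.Wd, this]
      | succ n ih =>
        rw [Sys.Wd, Module.End.mul_apply, ih, map_zero]
    rw [Sys.BB, Sys.cpr_apply, h]; simp
end A5
end JK
end

open scoped Classical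
noncomputable section
set_option linter.unusedSectionVars false
set_option linter.unusedSimpArgs false
namespace JK
open MvPolynomial
section A6

lemma alpha_ne : alpha ≠ 0 := RatFunc.X_ne_zero

lemma cM_cre {K : Type} [Field K] (α : K) (k : ℕ+) (f : Sy K) :
    cM (k : ℕ) (cre α f) = (α * (k : ℕ)) • pderiv k f := by
  have := ext_p (A := cM (k : ℕ) ∘ₗ (cre α).toLinearMap) (B := (α * (k : ℕ)) • (pderiv k).toLinearMap) ?_ ?_ f
  · simpa using this
  · simp
  · intro f h c
    simp only [LinearMap.comp_apply, LinearMap.smul_apply, Derivation.coeFn_coe] at h ⊢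
    rw [Derivation.leibniz, Derivation.leibniz, cre_pp, smul_mM, map_add, cM_mM, h]
    have e : (pderiv k) (pp c : Sy K) = if c = k then 1 else 0 := by
      rcases Nat.eq_zero_or_pos c with h0 | h0
      · subst h0; rw [pp_zero, map_zero, if_neg (fun h => k.ne_zero h.symm)]
      · have : c = ((Nat.toPNat c h0) : ℕ) := rfl
        rw [this, pp_coe, pderiv_X, Pi.single_apply]
        by_cases hk : (Nat.toPNat c h0) = k
        · rw [if_pos hk, if_pos (congrArg PNat.val hk)]
        · rw [if_neg hk, if_neg (fun h => hk (PNat.eq h))]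
    rw [e]
    simp only [cM, Finsupp.lapply_apply, Finsupp.smul_apply, Finsupp.single_apply, smul_eq_mul]
    split_ifs with h1
    · simp only [smul_add, mul_smul_comm, h1]
      rw [mul_comm f, C_mul', mul_one]
    · simp

/-- the embedding of `Mw` into the polynomial ring with catalytic variables -/
def jE : Mw F →ₗ[F] PY := Finsupp.lsum F (fun a => LinearMap.mulLeft F (yv a) ∘ₗ (rename Sum.inl).toLinearMap)

lemma jE_single (a : ℕ) (f : SymA) : jE (Finsupp.single a f) = yv a * rename Sum.inl f := by
  simp [jE]

lemma jE_apply (x : Mw F) : jE x = ∑ᶠ a : ℕ, yv a * rename Sum.inl (x a) := by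
  rw [finsum_eq_sum_of_support_subset (s := x.support)]
  · rw [jE, Finsupp.lsum_apply, Finsupp.sum]; rfl
  · intro a ha
    simp only [Function.mem_support] at ha
    simp only [Finset.mem_coe, Finsupp.mem_support_iff]
    intro h; apply ha; rw [h]; simp

lemma lin_finsum {ι V W : Type} [AddCommGroup V] [Module F V] [AddCommGroup W] [Module F W] (T : ι → V →ₗ[F] W)
    (hT : ∀ f, {i | T i f ≠ 0}.Finite) : ∃ A : V →ₗ[F] W, ∀ f, A f = ∑ᶠ i, T i f := by
  refine ⟨{ toFun := fun f => ∑ᶠ i, T i f, map_add' := ?_, map_smul' := ?_ }, fun f => rfl⟩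
  · intro f g
    rw [← finsum_add_distrib (hT f) (hT g)]
    simp
  · intro c f
    simp only [map_smul, RingHom.id_apply]
    rw [smul_finsum]

lemma fin_pd (f : PY) : {v : ℕ+ ⊕ ℕ | pderiv v f ≠ 0}.Finite := by
  refine (f.vars.finite_toSet).subset (fun v hv => ?_)
  by_contra h
  exact hv (pderiv_eq_zero_of_notMem_vars h)

lemma Yplus_lin : ∃ A : PY →ₗ[F] PY, ∀ f, A f = Yplus f := by
  refine (lin_finsum (fun j : ℕ => LinearMap.mulLeft F (yv (j+1)) ∘ₗ (pderiv (R := F) (Sum.inr j : ℕ+ ⊕ ℕ)).toLinearMap) ?_).elim (fun A hA => ?_)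
  swap
  · exact ⟨A, fun f => by rw [hA]; rfl⟩
  · intro f
    refine ((fin_pd f).preimage (f := (Sum.inr : ℕ → ℕ+ ⊕ ℕ)) Sum.inr_injective.injOn).subset (fun v hv => ?_)
    simp only [Set.mem_ofPred_eq, LinearMap.comp_apply, LinearMap.mulLeft_apply, Derivation.coeFn_coe] at hv
    exact fun h => hv (by rw [h, mul_zero])

lemma ThetaY_lin : ∃ A : PY →ₗ[F] PY, ∀ f, A f = ThetaY f := by
  refine (lin_finsum (fun i : ℕ+ => LinearMap.mulLeft F (pv i) ∘ₗ (pderiv (R := F) (Sum.inr (i : ℕ) : ℕ+ ⊕ ℕ)).toLinearMap) ?_).elim (fun A hA => ?_)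
  swap
  · exact ⟨A, fun f => by rw [hA]; rfl⟩
  · intro f
    refine ((fin_pd f).preimage (f := fun i : ℕ+ => (Sum.inr (i : ℕ) : ℕ+ ⊕ ℕ)) ?_).subset (fun v hv => ?_)
    · intro a _ b _ h
      exact PNat.eq (Sum.inr_injective h)
    simp only [Set.mem_ofPred_eq, LinearMap.comp_apply, LinearMap.mulLeft_apply, Derivation.coeFn_coe] at hv
    exact fun h => hv (by rw [h, mul_zero])

lemma GammaY_lin : ∃ A : PY →ₗ[F] PY, ∀ f, A f = GammaY f := by
  have h1 : ∃ A : PY →ₗ[F] PY, ∀ f, A f = ∑ᶠ i : ℕ+, ∑ᶠ j : ℕ+, ((j : ℕ) : F) •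
      (yv ((i : ℕ) + (j : ℕ)) *
        MvPolynomial.pderiv (Sum.inl j) (MvPolynomial.pderiv (Sum.inr ((i : ℕ) - 1)) f)) := by
    have hi : ∀ i : ℕ+, ∃ A : PY →ₗ[F] PY, ∀ f, A f = ∑ᶠ j : ℕ+, ((j : ℕ) : F) •
      (yv ((i : ℕ) + (j : ℕ)) *
        MvPolynomial.pderiv (Sum.inl j) (MvPolynomial.pderiv (Sum.inr ((i : ℕ) - 1)) f)) := by
      intro i
      refine (lin_finsum (fun j : ℕ+ => ((j : ℕ) : F) • (LinearMap.mulLeft F (yv ((i : ℕ) + (j : ℕ))) ∘ₗ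
        (pderiv (R := F) (Sum.inl j : ℕ+ ⊕ ℕ)).toLinearMap ∘ₗ (pderiv (R := F) (Sum.inr ((i : ℕ) - 1) : ℕ+ ⊕ ℕ)).toLinearMap)) ?_).elim (fun A hA => ?_)
      swap
      · exact ⟨A, fun f => by rw [hA]; rfl⟩
      · intro f
        refine ((fin_pd (pderiv (Sum.inr ((i : ℕ) - 1)) f)).preimage (f := (Sum.inl : ℕ+ → ℕ+ ⊕ ℕ)) Sum.inl_injective.injOn).subset (fun v hv => ?_)
        simp only [Set.mem_ofPred_eq, LinearMap.smul_apply, LinearMap.comp_apply, LinearMap.mulLeft_apply, Derivation.coeFn_coe] at hv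
        exact fun h => hv (by rw [h, mul_zero, smul_zero])
    choose T hT using hi
    refine (lin_finsum T ?_).elim (fun A hA => ?_)
    swap
    · exact ⟨A, fun f => by rw [hA]; simp only [hT]⟩
    · intro f
      refine ((fin_pd f).preimage (f := fun i : ℕ+ => (Sum.inr ((i : ℕ) - 1) : ℕ+ ⊕ ℕ)) ?_).subset (fun v hv => ?_)
      · intro a _ b _ h
        have := Sum.inr_injective h
        have ha := a.pos
        have hb := b.pos
        exact PNat.eq (by omega)
      rw [Set.mem_ofPred_eq, hT] at hv
      exact fun h => hv (by simp [h])
  have h2 : ∃ A : PY →ₗ[F] PY, ∀ f, A f = ∑ᶠ i : ℕ+, ∑ᶠ j : ℕ+,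
      yv (i : ℕ) * pv j * MvPolynomial.pderiv (Sum.inr ((i : ℕ) + (j : ℕ) - 1)) f := by
    have hi : ∀ i : ℕ+, ∃ A : PY →ₗ[F] PY, ∀ f, A f = ∑ᶠ j : ℕ+, 
      yv (i : ℕ) * pv j * MvPolynomial.pderiv (Sum.inr ((i : ℕ) + (j : ℕ) - 1)) f := by
      intro i
      refine (lin_finsum (fun j : ℕ+ => LinearMap.mulLeft F (yv (i : ℕ) * pv j) ∘ₗ
        (pderiv (R := F) (Sum.inr ((i : ℕ) + (j : ℕ) - 1) : ℕ+ ⊕ ℕ)).toLinearMap) ?_).elim (fun A hA => ?_)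
      swap
      · exact ⟨A, fun f => by rw [hA]; rfl⟩
      · intro f
        refine ((fin_pd f).preimage (f := fun j : ℕ+ => (Sum.inr ((i : ℕ) + (j : ℕ) - 1) : ℕ+ ⊕ ℕ)) ?_).subset (fun v hv => ?_)
        · intro a _ b _ h
          have := Sum.inr_injective h
          have ha := a.pos
          have hb := b.pos
          exact PNat.eq (by omega)
        simp only [Set.mem_ofPred_eq, LinearMap.comp_apply, LinearMap.mulLeft_apply, Derivation.coeFn_coe] at hv
        exact fun h => hv (by rw [h, mul_zero])
    choose T hT using hi
    refine (lin_finsum T ?_).elim (fun A hA => ?_)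
    swap
    · exact ⟨A, fun f => by rw [hA]; simp only [hT]⟩
    · intro f
      have hfin : {a : ℕ | pderiv (Sum.inr a) f ≠ 0}.Finite := (fin_pd f).preimage (f := (Sum.inr : ℕ → ℕ+ ⊕ ℕ)) Sum.inr_injective.injOn
      obtain ⟨N, hN⟩ := hfin.bddAbove
      refine ((Set.finite_Iic N).preimage (f := fun i : ℕ+ => (i : ℕ)) (fun a _ b _ h => PNat.eq h)).subset (fun i hv => ?_)
      rw [Set.mem_ofPred_eq, hT] at hv
      by_contra hc
      simp only [Set.mem_preimage, Set.mem_Iic, not_le] at hc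
      apply hv
      have : ∀ j : ℕ+, yv (i : ℕ) * pv j * MvPolynomial.pderiv (Sum.inr ((i : ℕ) + (j : ℕ) - 1)) f = 0 := by
        intro j
        by_cases h0 : pderiv (Sum.inr ((i : ℕ) + (j : ℕ) - 1)) f = 0
        · rw [h0, mul_zero]
        · have := hN h0
          have hj := j.pos
          omega
      simp [this]
  have h3 : ∃ A : PY →ₗ[F] PY, ∀ f, A f = ∑ᶠ i : ℕ+, ((i : ℕ) : F) •
      (yv ((i : ℕ) + 1) * MvPolynomial.pderiv (Sum.inr (i : ℕ)) f) := by
    refine (lin_finsum (fun i : ℕ+ => ((i : ℕ) : F) • (LinearMap.mulLeft F (yv ((i : ℕ) + 1)) ∘ₗ (pderiv (R := F) (Sum.inr (i : ℕ) : ℕ+ ⊕ ℕ)).toLinearMap)) ?_).elim (fun A hA => ?_)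
    swap
    · exact ⟨A, fun f => by rw [hA]; rfl⟩
    · intro f
      refine ((fin_pd f).preimage (f := fun i : ℕ+ => (Sum.inr (i : ℕ) : ℕ+ ⊕ ℕ)) ?_).subset (fun v hv => ?_)
      · intro a _ b _ h
        exact PNat.eq (Sum.inr_injective h)
      simp only [Set.mem_ofPred_eq, LinearMap.comp_apply, LinearMap.smul_apply, LinearMap.mulLeft_apply, Derivation.coeFn_coe] at hv
      exact fun h => hv (by rw [h, mul_zero, smul_zero])
  obtain ⟨A1, h1⟩ := h1
  obtain ⟨A2, h2⟩ := h2
  obtain ⟨A3, h3⟩ := h3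
  refine ⟨alpha • A1 + A2 + (alpha - 1) • A3, fun f => ?_⟩
  simp only [LinearMap.add_apply, LinearMap.smul_apply, h1, h2, h3]
  rfl

lemma pd_inr (i a : ℕ) (f : SymA) : pderiv (Sum.inr i) (yv a * rename Sum.inl f) =
    if i = a then rename Sum.inl f else 0 := by
  have h0 : pderiv (Sum.inr i : ℕ+ ⊕ ℕ) (rename Sum.inl f : PY) = 0 := by
    apply pderiv_eq_zero_of_notMem_vars
    intro h
    have := vars_rename (Sum.inl : ℕ+ → ℕ+ ⊕ ℕ) f h
    simp at this
  rw [Derivation.leibniz, h0, yv, pderiv_X, Pi.single_apply]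
  by_cases h : i = a
  · subst h; simp
  · rw [if_neg, if_neg h]; · simp
    intro h'; exact h (Sum.inr_injective h').symm
  
lemma Yplus_jE (x : Mw F) : Yplus (jE x) = jE (wS x) := by
  obtain ⟨A, hA⟩ := Yplus_lin
  rw [← hA]
  have : A ∘ₗ jE = jE ∘ₗ wS := by
    apply Finsupp.lhom_ext
    intro a f
    simp only [LinearMap.comp_apply, hA, jE_single, wS_single, Yplus, pd_inr]
    rw [finsum_eq_single _ a (fun i hi => by simp [hi])]
    simp
  exact LinearMap.congr_fun this x

lemma drop_Theta_jE (x : Mw F) : dropY (ThetaY (jE x)) = Th x := by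
  obtain ⟨A, hA⟩ := ThetaY_lin
  rw [← hA]
  have : dropY.toLinearMap ∘ₗ A ∘ₗ jE = Th := by
    apply Finsupp.lhom_ext
    intro a f
    simp only [LinearMap.comp_apply, hA, jE_single, Th_single, ThetaY, pd_inr, AlgHom.toLinearMap_apply]
    have hd : dropY (rename Sum.inl f) = f := by
      rw [dropY, aeval_rename]
      exact aeval_X_left_apply f
    rcases Nat.eq_zero_or_pos a with h | h
    · subst h
      simp
    · obtain ⟨d, rfl⟩ : ∃ d : ℕ+, (d : ℕ) = a := ⟨Nat.toPNat a h, rfl⟩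
      rw [finsum_eq_single _ d]
      · rw [if_pos rfl, map_mul, hd, pp_coe]
        simp [pv, dropY]
      · intro i hi
        rw [if_neg, mul_zero]
        intro h'; apply hi; exact PNat.eq h'
  exact LinearMap.congr_fun this x

lemma L_single_explicit {K : Type} [Field K] (α : K) (a : ℕ) (f : Sy K) : L α (Finsupp.single a f) =
    (wS ^ a) (cre α f) + ∑ s ∈ Finset.range a, Finsupp.single s (pp (a - s) * f) + ((α - 1) * a) • Finsupp.single a f := by
  induction a with
  | zero => simp [← L_io, io_def]
  | succ a ih =>
    rw [← wS_single, L_wS, ih, Finset.sum_range_succ']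
    simp only [map_add, map_sum, map_smul, wS_single, wS_wpow, Th_single, io_def, Nat.sub_zero, Nat.succ_sub_succ]
    have e : ((a + 1 : ℕ) : K) = (a : K) + 1 := by push_cast; rfl
    rw [e, mul_add, add_smul, mul_one]
    abel

lemma jE_wpow (a : ℕ) (x : Mw F) : jE ((wS ^ a) x) = ∑ᶠ i : ℕ, yv (i + a) * rename Sum.inl (x i) := by
  have : (∑ i ∈ x.support, yv (i + a) * rename Sum.inl (x i)) = jE ((wS ^ a) x) := by
    conv_rhs => rw [← Finsupp.sum_single x]
    rw [Finsupp.sum, map_sum, map_sum]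
    simp only [wpow_single, jE_single]
  rw [← this, finsum_eq_sum_of_support_subset (s := x.support)]
  intro a ha
  simp only [Function.mem_support] at ha
  simp only [Finset.mem_coe, Finsupp.mem_support_iff]
  intro h; apply ha; rw [h]; simp

lemma finsum_pnat {W : Type} [AddCommGroup W] (g : ℕ → W) (h : g 0 = 0) : ∑ᶠ i : ℕ, g i = ∑ᶠ i : ℕ+, g (i : ℕ) := by
  rw [← finsum_mem_univ, ← finsum_mem_univ (f := fun i : ℕ+ => g i)]
  rw [← finsum_mem_image (f := g) (g := fun i : ℕ+ => (i : ℕ)) (fun a _ b _ h => PNat.eq h)]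
  rw [finsum_mem_def, finsum_mem_def]
  congr 1
  ext i
  simp only [Set.mem_univ, finsum_true, Set.image_univ, Set.mem_range]
  by_cases hi : i = 0
  · subst hi; simp [h]
  · rw [Set.indicator_of_mem (Set.mem_univ i), Set.indicator_of_mem]
    exact ⟨⟨i, Nat.pos_of_ne_zero hi⟩, rfl⟩

lemma GammaY_jE (x : Mw F) : GammaY (jE x) = jE (wS (L alpha x)) := by
  obtain ⟨A, hA⟩ := GammaY_lin
  rw [← hA]
  have : A ∘ₗ jE = jE ∘ₗ wS ∘ₗ L alpha := by
    apply Finsupp.lhom_ext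
    intro a f
    rw [LinearMap.comp_apply, LinearMap.comp_apply, LinearMap.comp_apply, L_single_explicit, jE_single, hA]
    simp only [map_add, map_sum, map_smul, wS_single, wS_wpow, GammaY]
    congr 1
    · congr 1
      · rw [jE_wpow, finsum_pnat _ (by
          have : cM 0 (cre alpha f) = 0 := by rw [← L_io, cM_L_io]
          have h : (cre alpha f) 0 = 0 := this
          rw [h]; simp)]
        rw [finsum_eq_single _ (Nat.succPNat a)]
        · rw [smul_finsum]
          apply finsum_congr
          intro j
          have hc : (cre alpha f) (j : ℕ) = (alpha * (j : ℕ)) • pderiv j f := cM_cre alpha j f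
          rw [hc, map_smul, pd_inr, if_pos (by simp), pderiv_rename Sum.inl_injective]
          rw [mul_smul_comm, smul_smul]
          congr 3
          simp; ring
        · intro i hi
          rw [← finsum_zero (α := ℕ+)]
          apply finsum_congr
          intro j
          rw [pd_inr, if_neg]; · simp
          intro h; apply hi
          apply PNat.eq
          have := i.pos
          simp; omega
      · have e : ∀ g : ℕ+ → PY, ∑ᶠ i : ℕ+, g i = ∑ᶠ s : ℕ, g (Nat.succPNat s) := by
          intro g
          exact (finsum_comp_equiv (Equiv.pnatEquivNat.symm) (f := g)).symm
        rw [e, finsum_eq_sum_of_support_subset (s := Finset.range a)]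
        · apply Finset.sum_congr rfl
          intro s hs
          have hs := Finset.mem_range.mp hs
          obtain ⟨d, hd⟩ : ∃ d : ℕ+, (d : ℕ) = a - s := ⟨Nat.toPNat (a - s) (by omega), rfl⟩
          rw [finsum_eq_single _ d]
          · rw [pd_inr, if_pos (by simp; omega), jE_single]
            rw [← hd, pp_coe, map_mul, rename_X, pv, mul_assoc]
            rfl
          · intro j hj
            rw [pd_inr, if_neg, mul_zero]
            intro h; apply hj
            apply PNat.eq
            simp at h
            have := j.pos
            omega
        · intro s hs
          by_contra hc
          apply hs
          rw [← finsum_zero (α := ℕ+)]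
          apply finsum_congr
          intro j
          have := j.pos
          simp at hc
          rw [pd_inr, if_neg, mul_zero]
          simp; omega
    · rw [mul_smul]
      congr 1
      rcases Nat.eq_zero_or_pos a with h | h
      · subst h
        simp only [pd_inr, PNat.ne_zero, if_false, mul_zero, smul_zero, finsum_zero, Nat.cast_zero, zero_smul]
      · obtain ⟨d, rfl⟩ : ∃ d : ℕ+, (d : ℕ) = a := ⟨Nat.toPNat a h, rfl⟩
        rw [finsum_eq_single _ d]
        · rw [pd_inr, if_pos (by rfl), jE_single]
        · intro i hi
          rw [pd_inr, if_neg]; · simp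
          intro h'; apply hi; exact PNat.eq h'
  exact LinearMap.congr_fun this x

/-- words as linear operators -/
def wl : List Bool → Mw F → Mw F
  | [], x => x
  | b :: w, x => if b then wS (wl w x) else wS (L alpha (wl w x))

lemma wordOp_jE (w : List Bool) (x : Mw F) : wordOp w (jE x) = jE (wl w x) := by
  induction w with
  | nil => rfl
  | cons b w ih =>
    cases b
    · simp [wordOp, wl, ih, GammaY_jE]
    · simp [wordOp, wl, ih, Yplus_jE]

lemma sum_wl (n l : ℕ) (x : Mw F) : ∑ s ∈ Finset.univ.filter
      (fun s : Fin n → Bool => (Finset.univ.filter fun i => s i = true).card = l), wl (List.ofFn s) x = (JS alpha_ne).Wd n l x := by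
  induction n generalizing l with
  | zero =>
    rw [Finset.sum_filter]
    simp only [Fintype.sum_unique]
    cases l with
    | zero => simp [wl, Sys.Wd]
    | succ l => simp [wl, Sys.Wd]
  | succ n ih =>
    rw [Finset.sum_filter, ← (Fin.consEquiv (fun _ => Bool)).sum_comp, Fintype.sum_prod_type, Fintype.sum_bool]
    have hc : ∀ (b : Bool) (s : Fin n → Bool), (Finset.univ.filter fun i => (Fin.consEquiv (fun _ => Bool)) (b, s) i = true).card = 
        (if b then 1 else 0) + (Finset.univ.filter fun i => s i = true).card := by
      intro b s
      rw [Fin.card_filter_univ_succ]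
      simp [Fin.consEquiv]
      split_ifs <;> simp [Function.comp_def, add_comm]
    simp only [hc]
    have ht : ∀ s : Fin n → Bool, wl (List.ofFn ((Fin.consEquiv (fun _ => Bool)) (true, s))) x = wS (wl (List.ofFn s) x) := by
      intro s; simp [Fin.consEquiv, wl]
    have hf : ∀ s : Fin n → Bool, wl (List.ofFn ((Fin.consEquiv (fun _ => Bool)) (false, s))) x = wS (L alpha (wl (List.ofFn s) x)) := by
      intro s; simp [Fin.consEquiv, wl]
    simp only [ht, hf, if_true, Bool.false_eq_true, if_false, zero_add]
    rw [← Finset.sum_filter, ← Finset.sum_filter, ← map_sum, ← map_sum, ← map_sum, ih]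
    cases l with
    | zero =>
      have : (Finset.univ.filter (fun s : Fin n → Bool => 1 + (Finset.univ.filter fun i => s i = true).card = 0)) = ∅ := by
        ext s; simp
      rw [this, Finset.sum_empty, map_zero, zero_add]
      rfl
    | succ l =>
      have : (Finset.univ.filter (fun s : Fin n → Bool => 1 + (Finset.univ.filter fun i => s i = true).card = l + 1)) =
         (Finset.univ.filter (fun s : Fin n → Bool => (Finset.univ.filter fun i => s i = true).card = l)) := by
        ext s; simp; omega
      rw [this, ih, add_comm]
      rfl

theorem Bc_eq (n l : ℕ) (f : SymA) : Bc n l f = (JS alpha_ne).BB n l f := by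
  have h : yv 0 * rename Sum.inl f = jE (io f) := by rw [io_def, jE_single]
  rw [Bc, h]
  simp only [← map_smul, wordOp_jE]
  rw [← map_sum, sum_wl, drop_Theta_jE, Sys.BB, Sys.cpr_apply, map_smul, map_smul, map_smul]
  rfl
end A6
end JK
end

open scoped Classical
noncomputable section
set_option linter.unusedSectionVars false
set_option linter.unusedSimpArgs false
namespace JK
open MvPolynomial
section B1
variable {K : Type} [Field K]

lemma ind_p {P : Sy K → Prop} (h0 : P 1) (hs : ∀ (c : K) f, P f → P (c • f))
    (ha : ∀ f g, P f → P g → P (f + g))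
    (h1 : ∀ f, P f → ∀ c : ℕ, 0 < c → P (pp c * f)) : ∀ f, P f := by
  intro f
  induction f using MvPolynomial.induction_on with
  | C a =>
    have : (C a : Sy K) = a • 1 := by rw [smul_eq_C_mul, mul_one]
    rw [this]; exact hs _ _ h0
  | add p q hp hq => exact ha _ _ hp hq
  | mul_X p i hp => rw [mul_comm, ← pp_coe]; exact h1 _ hp _ i.pos

/-- `a ∂/∂p_a` -/
def nd (a : ℕ) : Sy K →ₗ[K] Sy K := cM a ∘ₗ (cre (1 : K)).toLinearMap

lemma nd_one (a : ℕ) : nd a (1 : Sy K) = 0 := by simp [nd]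
lemma nd_pp (a c : ℕ) (f : Sy K) : nd a (pp c * f) = pp c * nd a f + if c = a then (a : K) • f else 0 := by
  simp only [nd, LinearMap.comp_apply, Derivation.coeFn_coe, Derivation.leibniz, cre_pp, smul_mM, map_add, cM_mM,
    smul_wpow, map_smul, ← single_eq_w]
  congr 1
  simp only [cM, Finsupp.lapply_apply, Finsupp.single_apply]
  split_ifs with h
  · rw [h, one_mul]
  · simp
lemma nd_zero (f : Sy K) : nd 0 f = 0 := by
  refine ind_p (P := fun f => nd 0 f = 0) (nd_one 0) ?_ ?_ ?_ f
  · intro c f h; rw [map_smul, h, smul_zero]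
  · intro f g h h'; rw [map_add, h, h', add_zero]
  · intro f h c hc; rw [nd_pp, h]; simp

/-- generating series of skewing operators -/
def TT : Sy K →ₐ[K] Polynomial (Sy K) :=
  MvPolynomial.aeval (fun i : ℕ+ => Polynomial.C (X i) + Polynomial.X ^ (i : ℕ))

def hp (k : ℤ) : Sy K →ₗ[K] Sy K :=
  if k < 0 then 0 else
    { toFun := fun f => (TT f).coeff k.toNat
      map_add' := by intro f g; simp
      map_smul' := by intro c f; simp }

lemma hp_neg {k : ℤ} (h : k < 0) (f : Sy K) : hp k f = 0 := by simp [hp, h]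
lemma hp_nat (k : ℕ) (f : Sy K) : hp (k : ℤ) f = (TT f).coeff k := by
  rw [hp, if_neg (by omega)]; simp
lemma hp_one (k : ℤ) : hp k (1 : Sy K) = if k = 0 then 1 else 0 := by
  rcases lt_or_ge k 0 with h | h
  · rw [hp_neg h, if_neg (by omega)]
  · obtain ⟨k, rfl⟩ := Int.eq_ofNat_of_zero_le h
    rw [hp_nat, map_one, Polynomial.coeff_one]; simp
lemma TT_pp (a : ℕ) (ha : 0 < a) : TT (pp a : Sy K) = Polynomial.C (pp a) + Polynomial.X ^ a := by
  obtain ⟨d, rfl⟩ : ∃ d : ℕ+, (d:ℕ)=a := ⟨Nat.toPNat a ha, rfl⟩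
  rw [pp_coe, TT, aeval_X]
lemma hp_pp (k : ℤ) (a : ℕ) (ha : 0 < a) (f : Sy K) : hp k (pp a * f) = pp a * hp k f + hp (k - a) f := by
  rcases lt_or_ge k 0 with h | h
  · rw [hp_neg h, hp_neg h, hp_neg (by omega)]; simp
  · obtain ⟨k, rfl⟩ := Int.eq_ofNat_of_zero_le h
    rw [hp_nat, hp_nat, map_mul, TT_pp a ha, add_mul, Polynomial.coeff_add, Polynomial.coeff_C_mul,
      mul_comm (Polynomial.X ^ a), Polynomial.coeff_mul_X_pow']
    congr 1
    split_ifs with h2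
    · rw [← hp_nat, Nat.cast_sub h2]
    · rw [hp_neg (by omega)]
lemma hp_zero (f : Sy K) : hp 0 f = f := by
  refine ind_p (P := fun f => hp 0 f = f) ?_ ?_ ?_ ?_ f
  · simp [hp_one]
  · intro c f h; rw [map_smul, h]
  · intro f g h h'; rw [map_add, h, h']
  · intro f h c hc; rw [hp_pp _ _ hc, h, hp_neg (by omega), add_zero]

lemma hp_comm (f : Sy K) : ∀ i j : ℤ, hp i (hp j f) = hp j (hp i f) := by
  refine ind_p (P := fun f => ∀ i j : ℤ, hp i (hp j f) = hp j (hp i f)) ?_ ?_ ?_ ?_ f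
  · intro i j
    simp only [hp_one]
    split_ifs with h1 h2 h2 <;> simp [hp_one, h1, h2]
  · intro c f h i j; simp only [map_smul, h i j]
  · intro f g h h' i j; simp only [map_add, h i j, h' i j]
  · intro f h c hc i j
    simp only [hp_pp _ _ hc, map_add, h i j, h (i - c) j, h i (j-c), h (i-c) (j-c)]
    abel

lemma hp_nd (f : Sy K) : ∀ (i : ℤ) (a : ℕ), hp i (nd a f) = nd a (hp i f) := by
  refine ind_p (P := fun f => ∀ (i : ℤ) (a : ℕ), hp i (nd a f) = nd a (hp i f)) ?_ ?_ ?_ ?_ f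
  · intro i a
    rw [nd_one, hp_one]; split_ifs <;> simp [nd_one]
  · intro c f h i j; simp only [map_smul, h i j]
  · intro f g h h' i j; simp only [map_add, h i j, h' i j]
  · intro f h c hc i a
    simp only [hp_pp _ _ hc, map_add, nd_pp, h i a, h (i - c) a]
    split_ifs
    · rw [map_smul]; abel
    · simp

/-- recursion for `hp` -/
lemma hp_rec (f : Sy K) : ∀ (k : ℤ) (N : ℕ), k ≤ N →
    (k : K) • hp k f = ∑ n ∈ Finset.range N, nd (n+1) (hp (k - (n+1 : ℕ)) f) := by
  refine ind_p (P := fun f => ∀ (k : ℤ) (N : ℕ), k ≤ N →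
    (k : K) • hp k f = ∑ n ∈ Finset.range N, nd (n+1) (hp (k - (n+1 : ℕ)) f)) ?_ ?_ ?_ ?_ f
  · intro k N hN
    rw [Finset.sum_eq_zero, hp_one]
    · split_ifs with h <;> simp [h]
    · intro n _; rw [hp_one]; split_ifs <;> simp [nd_one]
  · intro c f h k N hN; simp only [map_smul, ← Finset.smul_sum]; rw [← h k N hN, smul_comm]
  · intro f g h h' k N hN; simp only [map_add, Finset.sum_add_distrib, ← h k N hN, ← h' k N hN, smul_add]
  · intro f h c hc k N hN
    have h1 := h k N hN
    have h2 := h (k - c) N (by omega)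
    simp only [hp_pp _ _ hc, map_add, nd_pp, Finset.sum_add_distrib, smul_add]
    rw [← Finset.mul_sum, ← h1]
    have e : ∀ n : ℕ, k - (n+1 : ℕ) - c = k - c - (n+1 : ℕ) := by intro n; ring
    simp only [e]
    rw [← h2, mul_smul_comm, add_assoc]
    congr 1
    by_cases hcN : c ≤ N
    · rw [Finset.sum_eq_single (c-1)]
      · rw [if_pos (by omega), show c - 1 + 1 = c by omega, ← add_smul]
        congr 1; push_cast; ring
      · intro n _ hn; rw [if_neg (by omega)]
      · intro hn; exfalso; apply hn; simp; omega
    · rw [Finset.sum_eq_zero, hp_neg (by omega)]; · simp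
      intro n hn; rw [if_neg]; have := Finset.mem_range.1 hn; omega

lemma eS_hp (f : Sy K) : ∀ k : ℤ, hp k (eS f) = eS (hp k f) + (k : K) • hp k f := by
  refine ind_p (P := fun f => ∀ k : ℤ, hp k (eS f) = eS (hp k f) + (k : K) • hp k f) ?_ ?_ ?_ ?_ f
  · intro k
    rw [eS_one, hp_one]; split_ifs with h <;> simp [eS_one, h]
  · intro c f h k; simp only [map_smul, h k, smul_add, smul_comm c]
  · intro f g h h' k; simp only [map_add, h k, h' k, smul_add]; abel
  · intro f h c hc k
    simp only [eS_ppmul, hp_pp _ _ hc, map_add, map_smul, h k, h (k-c), mul_add, mul_smul_comm]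
    push_cast
    module

/-- left shift on `Mw` -/
def dn (i : ℕ) : Mw K →ₗ[K] Mw K :=
  Finsupp.lsum K (fun a => if i ≤ a then Finsupp.lsingle (a - i) else 0)
lemma dn_single (i a : ℕ) (f : Sy K) : dn i (Finsupp.single a f : Mw K) = if i ≤ a then Finsupp.single (a - i) f else 0 := by
  simp only [dn, Finsupp.lsum_single]; split_ifs <;> simp
lemma cM_dn (i j : ℕ) (x : Mw K) : cM j (dn i x) = cM (i+j) x := by
  have : cM j ∘ₗ dn i = (cM (i+j) : Mw K →ₗ[K] Sy K) := by
    apply Finsupp.lhom_ext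
    intro a f
    simp only [LinearMap.comp_apply, dn_single, cM]
    split_ifs with h
    · simp only [Finsupp.lapply_apply, Finsupp.single_apply]
      by_cases hh : a = i + j
      · rw [if_pos (by omega), if_pos hh]
      · rw [if_neg (by omega), if_neg hh]
    · simp only [map_zero, Finsupp.lapply_apply, Finsupp.single_apply]; rw [if_neg (by omega)]
  exact LinearMap.congr_fun this x
lemma dn_mM (i a : ℕ) (x : Mw K) : dn i (mM a x) = mM a (dn i x) := by
  ext1 j
  exact (cM_dn i j _).trans (by rw [cM_mM, ← cM_dn, ← cM_mM]; rfl)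
lemma Th_congr {x y : Mw K} (h : ∀ a, 0 < a → cM a x = cM a y) : Th x = Th y := by
  have e : ∀ x : Mw K, Th x = x.sum (fun a f => pp a * f) := by
    intro x; simp [Th, Finsupp.lsum_apply]; rfl
  rw [← sub_eq_zero, ← map_sub, e]
  apply Finset.sum_eq_zero
  intro a _
  rcases Nat.eq_zero_or_pos a with h0 | h0
  · subst h0; simp
  · have := h a h0
    simp only [cM, Finsupp.lapply_apply] at this
    simp [this]

/-- `∑_{j≥1} p_j (i+j) ∂_{i+j}` -/
def Ro (i : ℕ) : Sy K →ₗ[K] Sy K := Th ∘ₗ dn i ∘ₗ (cre (1 : K)).toLinearMap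
lemma Ro_one (i : ℕ) : Ro i (1 : Sy K) = 0 := by simp [Ro]
lemma Ro_pp (i a : ℕ) (f : Sy K) : Ro i (pp a * f) = pp a * Ro i f + (a : K) • (pp (a - i) * f) := by
  simp only [Ro, LinearMap.comp_apply, Derivation.coeFn_coe, Derivation.leibniz, cre_pp, smul_mM, map_add, dn_mM, Th_mM,
    smul_wpow, map_smul, ← single_eq_w, dn_single]
  congr 1
  split_ifs with h
  · rw [Th_single, one_mul]
  · rw [Nat.sub_eq_zero_of_le (by omega)]; simp
lemma Ro_zero (f : Sy K) : Ro 0 f = eS f := by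
  refine ind_p (P := fun f => Ro 0 f = eS f) ?_ ?_ ?_ ?_ f
  · simp [Ro_one, eS_one]
  · intro c f h; rw [map_smul, h, map_smul]
  · intro f g h h'; rw [map_add, h, h', map_add]
  · intro f h c hc; rw [Ro_pp, h, eS_ppmul]; simp
end B1
end JK
end

open scoped Classical
noncomputable section
set_option linter.unusedSectionVars false
set_option linter.unusedSimpArgs false
namespace JK
open MvPolynomial
section B2
variable {K : Type} [Field K] [CharZero K]

lemma Kop_one {α : K} (hα : α ≠ 0) (a : ℕ) : Kop α a 1 =
    ((a : K) / 2) • (∑ s ∈ Finset.range a, pp s * pp (a - s) + ((α - 1) * (a - 1)) • pp a) := by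
  have := DS_pp hα a 1
  rw [mul_one, DS_one, mul_zero, zero_add] at this
  rw [← this, DS_pp_one hα]

/-- binomial -/
def c2 (k : ℤ) : K := k * (k - 1) / 2

lemma sum_range_refl1 {N : Type} [AddCommGroup N] (b : ℕ) (g : ℕ → N) :
    ∑ i ∈ Finset.range b, g (b - i) = ∑ i ∈ Finset.range b, g (i+1) := by
  rw [← Finset.sum_range_reflect]
  apply Finset.sum_congr rfl
  intro i hi
  have := Finset.mem_range.1 hi
  congr 1; omega

lemma hp_Kop {α : K} (hα : α ≠ 0) (b : ℕ) (f : Sy K) : ∀ k : ℤ,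
    hp k (Kop α (b+1) f) = Kop α (b+1) (hp k f) + (α * (c2 k - c2 (k - (b+1 : ℕ)))) • hp (k - (b+1 : ℕ)) f
      + ((b+1 : ℕ) : K) • ∑ i ∈ Finset.range b, pp (b - i) * hp (k - (i+1 : ℕ)) f := by
  refine ind_p (P := fun f => ∀ k : ℤ,
    hp k (Kop α (b+1) f) = Kop α (b+1) (hp k f) + (α * (c2 k - c2 (k - (b+1 : ℕ)))) • hp (k - (b+1 : ℕ)) f
      + ((b+1 : ℕ) : K) • ∑ i ∈ Finset.range b, pp (b - i) * hp (k - (i+1 : ℕ)) f) ?_ ?_ ?_ ?_ f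
  · intro k
    have e0 : Kop α (b+1) 1 = (((b+1 : ℕ) : K) / 2) • (∑ s ∈ Finset.range b, pp (s+1) * (pp (b - s) * 1)
        + ((α - 1) * b) • (pp (b+1) * 1)) := by
      rw [Kop_one hα, Finset.sum_range_succ', pp_zero, zero_mul, add_zero]
      simp only [mul_one, Nat.add_sub_add_right]
      congr 3; push_cast; ring
    have e1 : hp k (Kop α (b+1) 1) = (((b+1 : ℕ) : K) / 2) • (∑ s ∈ Finset.range b, (pp (s+1) * (pp (b - s) * hp k 1)
       + pp (s+1) * hp (k - (b - s : ℕ)) 1 + pp (b-s) * hp (k - (s+1 : ℕ)) 1 + hp (k - (b+1 : ℕ)) 1)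
        + ((α - 1) * b) • (pp (b+1) * hp k 1 + hp (k - (b+1 : ℕ)) 1)) := by
      rw [e0, map_smul, map_add, map_sum, map_smul, hp_pp _ _ (by omega)]
      congr 2
      apply Finset.sum_congr rfl
      intro s hs
      have := Finset.mem_range.1 hs
      rw [hp_pp _ _ (by omega), hp_pp _ _ (by omega), hp_pp _ _ (by omega), mul_add,
        show k - (s+1 : ℕ) - (b - s : ℕ) = k - (b+1 : ℕ) by omega]
      abel
    have e2 : Kop α (b+1) (hp k 1) = (((b+1 : ℕ) : K) / 2) • (∑ s ∈ Finset.range b, (pp (s+1) * (pp (b - s) * hp k 1))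
        + ((α - 1) * b) • (pp (b+1) * hp k 1)) := by
      rw [hp_one]
      split_ifs
      · exact e0
      · simp
    rw [e1, e2]
    simp only [Finset.sum_add_distrib, Finset.sum_const, Finset.card_range]
    have e3 : ∑ s ∈ Finset.range b, pp (s+1) * hp (k - (b - s : ℕ)) (1 : Sy K) =
        ∑ s ∈ Finset.range b, pp (b-s) * hp (k - (s + 1 : ℕ)) (1 : Sy K) := by
      rw [← Finset.sum_range_reflect]
      apply Finset.sum_congr rfl
      intro s hs
      have := Finset.mem_range.1 hs
      rw [show b - 1 - s + 1 = b - s by omega, show b - (b - 1 - s) = s + 1 by omega]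
    rw [e3]
    have e4 : (α * (c2 k - c2 (k - (b+1 : ℕ)))) • hp (k - (b+1 : ℕ)) (1 : Sy K) =
        (α * (((b+1 : ℕ) : K) / 2 * b)) • hp (k - (b+1 : ℕ)) (1 : Sy K) := by
      rw [hp_one]
      split_ifs with h
      · rw [h]; congr 2
        have : k = (b+1 : ℕ) := by omega
        rw [this, c2, c2]; push_cast; ring
      · simp
    rw [e4, ← Nat.cast_smul_eq_nsmul K]
    push_cast
    module
  · intro c f h k; simp only [map_smul, h k, mul_smul_comm, ← Finset.smul_sum, smul_add, smul_comm c]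
  · intro f g h h' k; simp only [map_add, h k, h' k, mul_add, Finset.sum_add_distrib, smul_add]; abel
  · intro f h c hc k
    rw [Kop_pp, map_add, hp_pp _ _ hc, map_smul, hp_pp _ _ (by omega), h k, h (k - c), hp_pp _ _ hc, map_add, Kop_pp, hp_pp _ _ hc]
    simp only [hp_pp _ _ hc, mul_add, Finset.sum_add_distrib]
    have e1 : ∀ i : ℕ, k - (i + 1 : ℕ) - c = k - c - (i+1 : ℕ) := by intro i; ring
    have e2 : ∀ i : ℕ, pp (b - i) * (pp c * hp (k - (i+1 : ℕ)) f) = pp c * (pp (b - i) * hp (k - (i+1 : ℕ)) f) := by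
      intro i; ring
    simp only [e1, e2, ← Finset.mul_sum]
    rw [show k - (b + 1 + c : ℕ) = k - c - (b+1 : ℕ) by push_cast; ring]
    simp only [mul_smul_comm, smul_add, c2]
    push_cast
    module

lemma sum_Ro {α : K} (b : ℕ) (f : Sy K) (k : ℤ) (N : ℕ) (hN : k ≤ N) :
    ∑ i ∈ Finset.range N, pp (b + 1 - (i + 1)) * hp (k - (i+1 : ℕ)) f =
     ∑ i ∈ Finset.range b, pp (b - i) * hp (k - (i+1 : ℕ)) f := by
  simp only [Nat.add_sub_add_right]
  rcases le_total b N with h | h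
  · obtain ⟨c, rfl⟩ := Nat.exists_eq_add_of_le h
    rw [Finset.sum_range_add, add_eq_left]
    apply Finset.sum_eq_zero
    intro i _
    rw [Nat.sub_eq_zero_of_le (by omega)]; simp
  · obtain ⟨c, rfl⟩ := Nat.exists_eq_add_of_le h
    rw [Finset.sum_range_add, left_eq_add]
    apply Finset.sum_eq_zero
    intro i _
    rw [hp_neg (by omega)]; simp

lemma hp_DS {α : K} (hα : α ≠ 0) (f : Sy K) : ∀ (k : ℤ) (N : ℕ), k ≤ N →
    hp k (DS α f) = DS α (hp k f) + (α * c2 k) • hp k f +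
      ∑ i ∈ Finset.range N, Ro (i+1) (hp (k - (i+1 : ℕ)) f) := by
  refine ind_p (P := fun f => ∀ (k : ℤ) (N : ℕ), k ≤ N →
    hp k (DS α f) = DS α (hp k f) + (α * c2 k) • hp k f +
      ∑ i ∈ Finset.range N, Ro (i+1) (hp (k - (i+1 : ℕ)) f)) ?_ ?_ ?_ ?_ f
  · intro k N hN
    rw [DS_one, map_zero, Finset.sum_eq_zero, hp_one]
    · split_ifs with h <;> simp [h, DS_one, c2]
    · intro i _; rw [hp_one]; split_ifs <;> simp [Ro_one]
  · intro c f h k N hN; simp only [map_smul, h k N hN, ← Finset.smul_sum, smul_add, smul_comm c]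
  · intro f g h h' k N hN; simp only [map_add, h k N hN, h' k N hN, Finset.sum_add_distrib, smul_add]; abel
  · intro f h c hc k N hN
    obtain ⟨b, rfl⟩ : ∃ b, c = b + 1 := ⟨c - 1, by omega⟩
    rw [DS_pp hα, map_add, hp_pp _ _ hc, hp_Kop hα, h k N hN, h (k - (b+1 : ℕ)) N (by omega), hp_pp _ _ hc, map_add, DS_pp hα]
    simp only [hp_pp _ _ hc, map_add, Ro_pp, Finset.sum_add_distrib]
    have e1 : ∀ i : ℕ, k - (i + 1 : ℕ) - (b + 1 : ℕ) = k - (b + 1 : ℕ) - (i+1 : ℕ) := by intro i; ring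
    simp only [e1, ← Finset.mul_sum, ← Finset.smul_sum]
    rw [sum_Ro (α := α) b f k N hN]
    simp only [mul_smul_comm, mul_add]
    module

lemma cM_cre1 (a : ℕ) (f : Sy K) : cM a (cre (1 : K) f) = nd a f := rfl

/-- the key recursion -/
lemma hp_DS_top {α : K} (hα : α ≠ 0) (f : Sy K) (k : ℤ) (hk : 0 ≤ k) (hf : ∀ j, k < j → hp j f = 0) :
    (∀ j, k < j → hp j (DS α f) = 0) ∧ hp k (DS α f) = DS α (hp k f) + (α * c2 k) • hp k f - eS (hp k f) := by
  have key : ∀ m : ℤ, k ≤ m → ∑ i ∈ Finset.range m.toNat, Ro (i+1) (hp (m - (i+1 : ℕ)) f) =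
      if m = k then - eS (hp k f) else 0 := by
    intro m hm
    have e : ∑ i ∈ Finset.range m.toNat, Ro (i+1) (hp (m - (i+1 : ℕ)) f) =
      Th (∑ i ∈ Finset.range m.toNat, dn (i+1) (cre (1:K) (hp (m - (i+1 : ℕ)) f))) := by
      rw [map_sum]; rfl
    have e2 : (if m = k then - eS (hp k f) else 0) = Th (if m = k then - dn 0 (cre (1 : K) (hp k f)) else 0) := by
      split_ifs
      · rw [← Ro_zero, map_neg]; rfl
      · simp
    rw [e, e2]
    apply Th_congr
    intro j hj
    rw [map_sum]
    simp only [cM_dn, cM_cre1]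
    have h1 := hp_rec f (m + j) (m.toNat + j) (by omega)
    rw [hf _ (by omega), smul_zero, add_comm m.toNat, Finset.sum_range_add] at h1
    have h2 : ∑ x ∈ Finset.range m.toNat, nd (j + x + 1) (hp (m + j - (j + x + 1 : ℕ)) f) =
       ∑ x ∈ Finset.range m.toNat, nd (x + 1 + j) (hp (m - (x + 1 : ℕ)) f) := by
      apply Finset.sum_congr rfl
      intro x _
      rw [show j + x + 1 = x + 1 + j by ring, show m + j - (x + 1 + j : ℕ) = m - (x+1 : ℕ) by push_cast; ring]
    rw [h2] at h1
    rw [eq_neg_of_add_eq_zero_right h1.symm]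
    obtain ⟨j, rfl⟩ : ∃ i, j = i + 1 := ⟨j - 1, by omega⟩
    rw [Finset.sum_range_succ, Finset.sum_eq_zero, zero_add]
    · rw [show m + (j+1 : ℕ) - (j+1 : ℕ) = m by ring]
      split_ifs with h
      · rw [h, map_neg, cM_dn, cM_cre1, zero_add]
      · rw [hf _ (by omega)]; simp
    · intro x hx
      have := Finset.mem_range.1 hx
      rw [hf _ (by omega), map_zero]
  constructor
  · intro j hj
    rw [hp_DS hα f j j.toNat (by omega), hf j hj, key j (by omega), if_neg (by omega)]; simp
  · rw [hp_DS hα f k k.toNat (by omega), key k le_rfl, if_pos rfl]; abel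
end B2
end JK
end

open scoped Classical
noncomputable section
set_option linter.unusedSectionVars false
set_option linter.unusedSimpArgs false
namespace JK
open MvPolynomial
section B3
variable {K : Type} [Field K]

def zK (α : K) (m : ℕ+ →₀ ℕ) : K := m.prod fun i k => (Nat.factorial k : K) * (α * ((i : ℕ) : K)) ^ k

/-- Hall scalar product -/
def pair (α : K) : Sy K →ₗ[K] Sy K →ₗ[K] K :=
  (basisMonomials ℕ+ K).constr K (fun m => zK α m • lcoeff K m)

lemma pair_monomial (α : K) (m : ℕ+ →₀ ℕ) (a : K) (g : Sy K) :
    pair α (monomial m a) g = a * (zK α m * coeff m g) := by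
  have : (monomial m a : Sy K) = a • basisMonomials ℕ+ K m := by simp [smul_monomial]
  rw [this, map_smul, pair, Module.Basis.constr_basis]
  simp [smul_eq_mul]

lemma zK_add (α : K) (m : ℕ+ →₀ ℕ) (a : ℕ+) :
    zK α (m + Finsupp.single a 1) = zK α m * ((m a + 1 : ℕ) : K) * (α * ((a : ℕ) : K)) := by
  have h1 : ∀ m : ℕ+ →₀ ℕ, zK α m = (Nat.factorial (m a) : K) * (α * ((a : ℕ) : K)) ^ (m a) *
      (m.erase a).prod (fun i k => (Nat.factorial k : K) * (α * ((i : ℕ) : K)) ^ k) := by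
    intro m
    rw [zK]
    exact (Finsupp.mul_prod_erase' m a (fun i k => (Nat.factorial k : K) * (α * ((i : ℕ) : K)) ^ k) (by intro i; simp)).symm
  rw [h1, h1 m]
  have : (m + Finsupp.single a 1).erase a = m.erase a := by
    ext i; by_cases hi : i = a
    · simp [hi]
    · simp [Finsupp.erase_ne hi, hi, Finsupp.single_apply, Ne.symm hi]
  rw [this]
  simp only [Finsupp.add_apply, Finsupp.single_eq_same, Nat.factorial_succ]
  push_cast; ring

lemma pair_pp (α : K) (a : ℕ) (f g : Sy K) : pair α (pp a * f) g = α * pair α f (nd a g) := by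
  rcases Nat.eq_zero_or_pos a with h | h
  · subst h; simp [nd_zero]
  obtain ⟨d, rfl⟩ : ∃ d : ℕ+, (d:ℕ)=a := ⟨Nat.toPNat a h, rfl⟩
  induction f using MvPolynomial.induction_on' with
  | add p q hp hq => rw [mul_add, map_add, map_add, LinearMap.add_apply, LinearMap.add_apply, hp, hq, mul_add]
  | monomial m c =>
    rw [pp_coe, X, monomial_mul, pair_monomial, pair_monomial, add_comm, zK_add, one_mul]
    have : nd (d : ℕ) g = ((1 : K) * (d : ℕ)) • pderiv d g := cM_cre 1 d g
    rw [this, coeff_smul, coeff_pderiv, smul_eq_mul]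
    push_cast
    ring

lemma coeff0_pp (a : ℕ) (f : Sy K) : coeff 0 (pp a * f) = 0 := by
  rcases Nat.eq_zero_or_pos a with h | h
  · subst h; simp
  obtain ⟨d, rfl⟩ : ∃ d : ℕ+, (d:ℕ)=a := ⟨Nat.toPNat a h, rfl⟩
  rw [pp_coe, ← constantCoeff_eq, map_mul, constantCoeff_X, zero_mul]

lemma pair_one (α : K) (g : Sy K) : pair α 1 g = coeff 0 g := by
  have : (1 : Sy K) = monomial 0 1 := rfl
  rw [this, pair_monomial]; simp [zK]

lemma pair_symm (α : K) (f g : Sy K) : pair α f g = pair α g f := by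
  have : pair α = (pair α).flip := by
    apply (basisMonomials ℕ+ K).ext
    intro m
    apply (basisMonomials ℕ+ K).ext
    intro m'
    simp only [coe_basisMonomials, LinearMap.flip_apply, pair_monomial, coeff_monomial]
    split_ifs with h1 h2 h2
    · rw [h1]
    · exact absurd h1.symm h2
    · exact absurd h2.symm h1
    · simp
  conv_lhs => rw [this]
  rfl

lemma pair_pp' (α : K) (a : ℕ) (f g : Sy K) : pair α f (pp a * g) = α * pair α (nd a f) g := by
  rw [pair_symm, pair_pp, pair_symm]

variable [CharZero K]

lemma zK_ne {α : K} (hα : α ≠ 0) (m : ℕ+ →₀ ℕ) : zK α m ≠ 0 := by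
  rw [zK, Finsupp.prod, Finset.prod_ne_zero_iff]
  intro i _
  have : ((i : ℕ) : K) ≠ 0 := by exact_mod_cast i.ne_zero
  have h2 : ((Nat.factorial (m i) : ℕ) : K) ≠ 0 := by exact_mod_cast (Nat.factorial_ne_zero _)
  exact mul_ne_zero h2 (pow_ne_zero _ (mul_ne_zero hα this))
lemma pair_nondeg {α : K} (hα : α ≠ 0) (g : Sy K) (h : ∀ f, pair α f g = 0) : g = 0 := by
  ext m
  have := h (monomial m 1)
  rw [pair_monomial, one_mul] at this
  simpa using (mul_eq_zero.1 this).resolve_left (zK_ne hα m)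

lemma pair_eS (α : K) (f g : Sy K) : pair α (eS f) g = pair α f (eS g) := by
  refine ind_p (P := fun f => ∀ g, pair α (eS f) g = pair α f (eS g)) ?_ ?_ ?_ ?_ f g
  · intro g
    rw [eS_one, map_zero, LinearMap.zero_apply, pair_one]
    refine (ind_p (P := fun g => coeff 0 (eS g) = 0) ?_ ?_ ?_ ?_ g).symm
    · simp [eS_one]
    · intro c f h; rw [map_smul, coeff_smul, h, smul_zero]
    · intro f g h h'; rw [map_add, coeff_add, h, h', add_zero]
    · intro f h c hc
      rw [eS_ppmul, coeff_add, coeff_smul, coeff0_pp, coeff0_pp]; simp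
  · intro c f h g; simp only [map_smul, LinearMap.smul_apply, h]
  · intro f g h h' k; simp only [map_add, LinearMap.add_apply, h, h']
  · intro f h c hc g
    have : nd c (eS g) = eS (nd c g) + (c : K) • nd c g := by
      refine ind_p (P := fun g => nd c (eS g) = eS (nd c g) + (c : K) • nd c g) ?_ ?_ ?_ ?_ g
      · simp [eS_one, nd_one]
      · intro c f h; simp only [map_smul, h, smul_add, smul_comm c]
      · intro f g h h'; simp only [map_add, h, h', smul_add]; abel
      · intro f h a ha
        simp only [eS_ppmul, nd_pp, map_add, map_smul, h, mul_add, mul_smul_comm, smul_add]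
        split_ifs with hh
        · subst hh; simp only [map_smul]
        · simp only [map_zero]; module
    rw [eS_ppmul, map_add, map_smul, LinearMap.add_apply, LinearMap.smul_apply, pair_pp, pair_pp, pair_pp, this, map_add, map_smul, h]
    simp only [smul_eq_mul]; ring

/-- the pairing on `Mw` -/
def PM (α : K) : Mw K →ₗ[K] Mw K →ₗ[K] K := Finsupp.lsum K (fun a => (pair α).compl₂ (cM a))
lemma PM_single (α : K) (a : ℕ) (f : Sy K) (y : Mw K) : PM α (Finsupp.single a f) y = pair α f (cM a y) := by
  simp [PM]
lemma PM_single' (α : K) (a : ℕ) (f : Sy K) (x : Mw K) : PM α x (Finsupp.single a f) = pair α (cM a x) f := by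
  have : (PM α).flip (Finsupp.single a f) = (pair α).flip f ∘ₗ cM a := by
    apply Finsupp.lhom_ext
    intro b g
    simp only [LinearMap.flip_apply, LinearMap.comp_apply, PM_single, cM, Finsupp.lapply_apply, Finsupp.single_apply]
    split_ifs with h1 h2 h2
    · rfl
    · exact absurd h1.symm h2
    · exact absurd h2.symm h1
    · simp
  exact LinearMap.congr_fun this x

lemma cM_single (b a : ℕ) (f : Sy K) : cM b (Finsupp.single a f : Mw K) = if a = b then f else 0 := by
  simp [cM, Finsupp.single_apply]
lemma cM_wpow (a b : ℕ) (x : Mw K) : cM b ((wS ^ a) x) = if a ≤ b then cM (b - a) x else 0 := by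
  have : cM b ∘ₗ (wS ^ a) = if a ≤ b then (cM (b - a) : Mw K →ₗ[K] Sy K) else 0 := by
    apply Finsupp.lhom_ext
    intro c f
    rw [LinearMap.comp_apply, wpow_single, cM_single]
    split_ifs with h1 h2 h2
    · rw [cM_single, if_pos (by omega)]
    · omega
    · rw [cM_single, if_neg (by omega)]
    · rfl
  have h2 := LinearMap.congr_fun this x
  split_ifs at h2 ⊢ <;> exact h2
lemma cM_creA (α : K) (a : ℕ) (f : Sy K) : cM a (cre α f) = α • nd a f := by
  rcases Nat.eq_zero_or_pos a with h | h
  · subst h; rw [nd_zero, ← L_io, cM_L_io]; simp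
  obtain ⟨d, rfl⟩ : ∃ d : ℕ+, (d:ℕ)=a := ⟨Nat.toPNat a h, rfl⟩
  rw [cM_cre, ← cM_cre1, cM_cre, smul_smul, one_mul]

lemma L_entry (α : K) (a b : ℕ) (f : Sy K) : cM b (L α (Finsupp.single a f)) =
    α • nd (b - a) f + pp (a - b) * f + if a = b then ((α - 1) * a) • f else 0 := by
  rw [L_single_explicit, map_add, map_add, map_sum, map_smul, cM_wpow, cM_single, cM_creA]
  simp only [cM_single]
  congr 1
  · congr 1
    · split_ifs with h
      · rfl
      · rw [Nat.sub_eq_zero_of_le (by omega), nd_zero]; simp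
    · by_cases h : b < a
      · rw [Finset.sum_eq_single b]
        · simp
        · intro s _ hs; rw [if_neg hs]
        · intro hs; exact absurd (Finset.mem_range.2 h) hs
      · rw [Nat.sub_eq_zero_of_le (by omega), pp_zero, zero_mul]
        apply Finset.sum_eq_zero
        intro s hs; rw [if_neg]; have := Finset.mem_range.1 hs; omega
  · split_ifs <;> simp

lemma PM_L (α : K) (x y : Mw K) : PM α (L α x) y = PM α x (L α y) := by
  have : (PM α) ∘ₗ (L α) = (PM α).compl₂ (L α) := by
    apply Finsupp.lhom_ext
    intro a f
    apply Finsupp.lhom_ext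
    intro b g
    rw [LinearMap.comp_apply, LinearMap.compl₂_apply, PM_single', PM_single, L_entry, L_entry]
    simp only [map_add, LinearMap.add_apply, map_smul, LinearMap.smul_apply, smul_eq_mul, pair_pp, pair_pp']
    have : (pair α (if a = b then ((α - 1) * a) • f else 0)) g = (pair α f) (if b = a then ((α - 1) * b) • g else 0) := by
      by_cases h : a = b
      · subst h; simp
      · rw [if_neg h, if_neg (Ne.symm h)]; simp
    rw [this]; ring
  exact LinearMap.congr_fun (LinearMap.congr_fun this x) y

lemma pair_Th (α : K) (x : Mw K) (g : Sy K) : pair α (Th x) g = PM α x (L α (io g)) := by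
  have : (pair α).flip g ∘ₗ Th = (PM α).flip (L α (io g)) := by
    apply Finsupp.lhom_ext
    intro a f
    rw [LinearMap.comp_apply, LinearMap.flip_apply, LinearMap.flip_apply, Th_single, pair_pp, PM_single, L_io, cM_creA]
    simp
  exact LinearMap.congr_fun this x

lemma pair_DS (α : K) (f g : Sy K) : pair α (DS α f) g = pair α f (DS α g) := by
  rw [pair_symm α f, DS_apply, DS_apply]
  simp only [map_smul, map_sub, LinearMap.smul_apply, LinearMap.sub_apply, pair_Th]
  have : ∀ x y, PM α x y = PM α y x := by
    intro x y
    have : PM α = (PM α).flip := by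
      apply Finsupp.lhom_ext
      intro a f
      apply Finsupp.lhom_ext
      intro b g
      rw [LinearMap.flip_apply, PM_single, PM_single, cM_single, cM_single]
      by_cases h : a = b
      · subst h; simp [pair_symm α f g]
      · rw [if_neg h, if_neg (Ne.symm h)]; simp
    exact LinearMap.congr_fun (LinearMap.congr_fun this x) y
  rw [PM_L α (L α (io f)), this (L α (io f)) (L α (io g)), this (L α (io f))]

/-- truncated exponential of a sequence -/
def expo {A : Type} [Ring A] [Algebra K A] (b : ℕ → A) : ℕ → A
  | 0 => 1
  | k + 1 => ((k + 1 : ℕ) : K)⁻¹ • ∑ n : Fin (k+1), b (n + 1) * expo b (k - n)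
termination_by k => k

lemma expo_zero {A : Type} [Ring A] [Algebra K A] (b : ℕ → A) : expo (K := K) b 0 = 1 := by
  rw [expo]
lemma expo_succ {A : Type} [Ring A] [Algebra K A] (b : ℕ → A) (k : ℕ) :
    ((k + 1 : ℕ) : K) • expo (K := K) b (k+1) = ∑ n ∈ Finset.range (k+1), b (n+1) * expo (K := K) b (k - n) := by
  rw [expo, smul_smul, mul_inv_cancel₀ (by exact_mod_cast (Nat.succ_ne_zero k)), one_smul,
    ← Fin.sum_univ_eq_sum_range (fun n => b (n+1) * expo (K := K) b (k - n))]

/-- multiplication by complete functions -/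
def gop (α : K) (k : ℕ) : Module.End K (Sy K) := expo (K := K) (fun n => (α⁻¹ • mp n : Module.End K (Sy K))) k

lemma pair_gop {α : K} (hα : α ≠ 0) (k : ℕ) : ∀ f g : Sy K, pair α (gop α k f) g = pair α f (hp k g) := by
  induction k using Nat.strong_induction_on with
  | _ k ih =>
  intro f g
  cases k with
  | zero => rw [gop, expo_zero]; simp [hp_zero]
  | succ k =>
    have h0 : ((k + 1 : ℕ) : K) ≠ 0 := by exact_mod_cast (Nat.succ_ne_zero k)
    have h1 := congrArg (fun T => pair α (T f) g) (expo_succ (K := K) (fun n => (α⁻¹ • mp n : Module.End K (Sy K))) k)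
    simp only [LinearMap.smul_apply, map_smul, LinearMap.sum_apply, map_sum, Module.End.mul_apply, mp_apply, pair_pp, smul_eq_mul] at h1
    have h2 := congrArg (fun x => pair α f x) (hp_rec g ((k+1 : ℕ) : ℤ) (k+1) le_rfl)
    simp only [map_smul, map_sum, smul_eq_mul] at h2
    apply mul_left_cancel₀ h0
    have h3 : ((((k+1 : ℕ) : ℤ)) : K) = ((k+1 : ℕ) : K) := by push_cast; ring
    rw [h3] at h2
    rw [h2]
    refine h1.trans ?_
    apply Finset.sum_congr rfl
    intro n hn
    have := Finset.mem_range.1 hn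
    have h4 := ih (k - n) (by omega) f (nd (n+1) g)
    rw [gop] at h4
    rw [h4, hp_nd, ← mul_assoc, inv_mul_cancel₀ hα, one_mul]
    rw [show ((k + 1 : ℕ) : ℤ) - (n+1 : ℕ) = (k - n : ℕ) by omega]
end B3
end JK
end

open scoped Classical
noncomputable section
set_option linter.unusedSectionVars false
set_option linter.unusedSimpArgs false
namespace JK
open MvPolynomial
section B4

/-- every nonempty partition has a largest part -/
lemma part_ind {P : JPartition → Prop} (h0 : P 0)
    (h1 : ∀ (k : ℕ+) (κ : JPartition), (∀ i ∈ κ, i ≤ k) → P κ → P (k ::ₘ κ)) : ∀ l, P l := by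
  intro l
  induction hn : Multiset.card l generalizing l with
  | zero => rw [Multiset.card_eq_zero.1 hn]; exact h0
  | succ n ih =>
    have hne : l.toFinset.Nonempty := by
      rw [Multiset.toFinset_nonempty]; intro h; rw [h] at hn; simp at hn
    obtain ⟨k, hk, hmax⟩ := Finset.exists_max_image l.toFinset id hne
    rw [Multiset.mem_toFinset] at hk
    obtain ⟨κ, rfl⟩ := Multiset.exists_cons_of_mem hk
    refine h1 k κ ?_ (ih κ (by simpa using hn))
    intro i hi
    exact hmax i (by rw [Multiset.mem_toFinset]; exact Multiset.mem_cons_of_mem hi)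

lemma sP_zero : sortedParts 0 = [] := by simp [sortedParts]
lemma sP_coe (m : JPartition) : ((sortedParts m : List ℕ) : Multiset ℕ) = Multiset.map (fun i : ℕ+ => (i : ℕ)) m := by
  rw [sortedParts, Multiset.coe_reverse, Multiset.sort_eq, Multiset.map_id']
  exact Multiset.bind_singleton _ _
lemma psize_def (m : JPartition) : psize m = (Multiset.map (fun i : ℕ+ => (i : ℕ)) m).sum := by
  rw [psize, Multiset.map_id']
  exact congrArg Multiset.sum (Multiset.bind_singleton _ _)
lemma sP_cons (k : ℕ+) (κ : JPartition) (h : ∀ i ∈ κ, i ≤ k) : sortedParts (k ::ₘ κ) = (k : ℕ) :: sortedParts κ := by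
  have h1 : ∀ m : JPartition, (sortedParts m).Pairwise (· ≥ ·) := by
    intro m
    rw [sortedParts, List.pairwise_reverse]
    exact Multiset.pairwise_sort _ _
  apply List.Perm.eq_of_pairwise (le := (· ≥ ·))
  · intro a b _ _ h1 h2; exact le_antisymm h2 h1
  · exact h1 _
  · rw [List.pairwise_cons]
    refine ⟨?_, h1 _⟩
    intro a ha
    have : a ∈ ((sortedParts κ : List ℕ) : Multiset ℕ) := ha
    rw [sP_coe, Multiset.mem_map] at this
    obtain ⟨i, hi, rfl⟩ := this
    exact h i hi
  · rw [← Multiset.coe_eq_coe, ← Multiset.cons_coe, sP_coe, sP_coe, Multiset.map_cons]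
lemma sP_sum (m : JPartition) : (sortedParts m).sum = psize m := by
  rw [psize_def, ← sP_coe, Multiset.sum_coe]
lemma sP_pos (m : JPartition) : ∀ i ∈ sortedParts m, 0 < i := by
  intro a ha
  have : a ∈ ((sortedParts m : List ℕ) : Multiset ℕ) := ha
  rw [sP_coe, Multiset.mem_map] at this
  obtain ⟨i, hi, rfl⟩ := this
  exact i.pos
lemma sP_len (m : JPartition) : (sortedParts m).length = plen m := by
  rw [plen, ← Multiset.card_map (fun i : ℕ+ => (i : ℕ)), ← sP_coe, Multiset.coe_card]
lemma sP_inj {m m' : JPartition} (h : sortedParts m = sortedParts m') : m = m' := by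
  have : m.map (fun i : ℕ+ => (i : ℕ)) = m'.map (fun i : ℕ+ => (i : ℕ)) := by rw [← sP_coe, ← sP_coe, h]
  exact Multiset.map_injective PNat.coe_injective this
lemma psize_cons (k : ℕ+) (κ : JPartition) : psize (k ::ₘ κ) = k + psize κ := by simp [psize_def]
lemma psize_zero : psize 0 = 0 := by simp [psize_def]
lemma le_topSum (m : JPartition) (i : ℕ+) (hi : i ∈ m) : (i : ℕ) ≤ topSum m 1 := by
  revert hi
  refine part_ind (P := fun m => i ∈ m → (i : ℕ) ≤ topSum m 1) (by simp) ?_ m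
  intro k κ h _ hi
  rw [topSum, sP_cons k κ h]
  simp only [List.take_succ_cons, List.take_zero, List.sum_cons, List.sum_nil, add_zero]
  rcases Multiset.mem_cons.1 hi with h' | h'
  · rw [h']
  · exact h i h'

/-- finiteness of partitions of given size -/
lemma fin_part (n : ℕ) : {m : JPartition | psize m ≤ n}.Finite := by
  have : {m : JPartition | psize m ≤ n} ⊆ Set.Iic (n • ((Finset.range n).map ⟨Nat.succPNat, Nat.succPNat_injective⟩).val) := by
    intro m hm
    simp only [Set.mem_ofPred_eq] at hm
    rw [Set.mem_Iic, Multiset.le_iff_count]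
    intro i
    by_cases hi : i ∈ m
    · obtain ⟨κ, hκ⟩ := Multiset.exists_cons_of_mem hi
      have h1 : (i : ℕ) ≤ n := by
        rw [hκ, psize_cons] at hm; omega
      have h2 : Multiset.count i m ≤ n := by
        refine le_trans ?_ hm
        refine le_trans (Multiset.count_le_card i m) ?_
        rw [psize_def, ← Multiset.card_map (fun i : ℕ+ => (i : ℕ)) m]
        have := Multiset.card_nsmul_le_sum (s := m.map (fun i : ℕ+ => (i : ℕ))) (a := 1) (by
          intro x hx; obtain ⟨j, _, rfl⟩ := Multiset.mem_map.1 hx; exact j.pos)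
        simpa using this
      have h3 : i ∈ ((Finset.range n).map ⟨Nat.succPNat, Nat.succPNat_injective⟩).val := by
        rw [Finset.mem_val, Finset.mem_map]
        refine ⟨i - 1, ?_, ?_⟩
        · rw [Finset.mem_range]; have := i.pos; omega
        · exact PNat.succPNat_natPred i
      rw [Multiset.count_nsmul, Multiset.count_eq_one_of_mem (Finset.nodup _) h3]
      omega
    · rw [Multiset.count_eq_zero_of_notMem hi]; exact Nat.zero_le _
  exact (Set.finite_Iic _).subset this

/-- list statistics -/
def bL : List ℕ → ℕ
  | [] => 0
  | _ :: l => l.sum + bL l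

lemma bL_sum (l : List ℕ) : ∀ N, l.length ≤ N →
    bL l + ∑ j ∈ Finset.range N, (l.take (j+1)).sum = N * l.sum := by
  induction l with
  | nil => intro N _; simp [bL]
  | cons k l ih =>
    intro N hN
    obtain ⟨N, rfl⟩ : ∃ M, N = M + 1 := ⟨N - 1, by simp at hN; omega⟩
    have := ih N (by simpa using hN)
    simp only [List.take_succ_cons, List.sum_cons, Finset.sum_add_distrib, Finset.sum_const, Finset.card_range, bL, smul_eq_mul]
    rw [Finset.sum_range_succ']
    simp only [List.take_zero, List.sum_nil]
    nlinarith

lemma list_eq_of_take (l : List ℕ) : ∀ l' : List ℕ, (∀ i ∈ l, 0 < i) → (∀ i ∈ l', 0 < i) →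
    (∀ k, (l.take k).sum = (l'.take k).sum) → l = l' := by
  induction l with
  | nil =>
    intro l' _ h' h
    cases l' with
    | nil => rfl
    | cons k l' =>
      have := h 1; simp at this
      have h2 := h' k (by simp); omega
  | cons k l ih =>
    intro l' h1 h' h
    cases l' with
    | nil =>
      have := h 1; simp at this
      have h2 := h1 k (by simp); omega
    | cons k' l' =>
      have e : k = k' := by have := h 1; simpa using this
      subst e
      congr 1
      apply ih
      · intro i hi; exact h1 i (by simp [hi])
      · intro i hi; exact h' i (by simp [hi])
      · intro j; have := h (j+1); simpa using this

lemma bL_lt {m l : JPartition} (h : dominates m l) (hne : m ≠ l) : bL (sortedParts l) < bL (sortedParts m) := by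
  obtain ⟨hs, hd⟩ := h
  set N := (sortedParts m).length + (sortedParts l).length
  have h1 := bL_sum (sortedParts m) N (by omega)
  have h2 := bL_sum (sortedParts l) N (by omega)
  rw [sP_sum] at h1 h2
  rw [hs] at h1
  have hle : ∑ j ∈ Finset.range N, ((sortedParts m).take (j+1)).sum ≤ ∑ j ∈ Finset.range N, ((sortedParts l).take (j+1)).sum :=
    Finset.sum_le_sum (fun j _ => hd (j+1))
  rcases hle.lt_or_eq with h3 | h3
  · omega
  · exfalso
    apply hne
    apply sP_inj
    apply list_eq_of_take _ _ (sP_pos m) (sP_pos l)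
    have h3 := (Finset.sum_eq_sum_iff_of_le (f := fun j => ((sortedParts m).take (j+1)).sum) (g := fun j => ((sortedParts l).take (j+1)).sum) (fun j _ => hd (j+1))).1 h3
    intro k
    cases k with
    | zero => simp
    | succ k =>
      by_cases hk : k < N
      · exact h3 k (Finset.mem_range.2 hk)
      · rw [List.take_of_length_le (by omega), List.take_of_length_le (by omega), sP_sum, sP_sum, hs]

lemma dom_lex (m : List ℕ) : ∀ l : List ℕ, (∀ i ∈ m, 0 < i) → (∀ k, (m.take k).sum ≤ (l.take k).sum) → m < l ∨ m = l := by
  induction m with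
  | nil =>
    intro l _ _
    cases l with
    | nil => right; rfl
    | cons k l => left; exact List.nil_lt_cons _ _
  | cons j m ih =>
    intro l hm h
    cases l with
    | nil =>
      have := h 1; simp at this
      have := hm j (by simp); omega
    | cons k l =>
      have h1 := h 1
      simp at h1
      rcases h1.lt_or_eq with h2 | h2
      · left; exact List.cons_lt_cons_iff.2 (Or.inl h2)
      · have := ih l (fun i hi => hm i (by simp [hi])) (by
          intro i
          have := h (i+1)
          simp at this; omega)
        rcases this with h3 | h3
        · left; exact List.cons_lt_cons_iff.2 (Or.inr ⟨h2, h3⟩)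
        · right; rw [h2, h3]

lemma dom_cons {m κ : JPartition} {k : ℕ+} (hκ : ∀ i ∈ κ, i ≤ k) (h : dominates (k ::ₘ m) (k ::ₘ κ)) : dominates m κ := by
  obtain ⟨hs, hd⟩ := h
  have hm : ∀ i ∈ m, i ≤ k := by
    intro i hi
    have h1 := le_topSum (k ::ₘ m) i (Multiset.mem_cons_of_mem hi)
    have h2 := hd 1
    have h4 : topSum (k ::ₘ κ) 1 = k := by rw [topSum, sP_cons k κ hκ]; simp
    rw [h4] at h2
    exact_mod_cast h1.trans h2
  refine ⟨by rw [psize_cons, psize_cons] at hs; omega, ?_⟩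
  intro j
  have := hd (j+1)
  rw [topSum, topSum, sP_cons _ _ hm, sP_cons _ _ hκ] at this
  simpa [topSum] using this

lemma dom_part {m l : JPartition} {k : ℕ+} (h : dominates m l) (hl : ∀ i ∈ l, i ≤ k) : ∀ i ∈ m, i ≤ k := by
  intro i hi
  have h1 := le_topSum m i hi
  have h2 := h.2 1
  have h3 : topSum l 1 ≤ k := by
    revert hl
    refine part_ind (P := fun l => (∀ i ∈ l, i ≤ k) → topSum l 1 ≤ k) ?_ ?_ l
    · simp [topSum, sP_zero]
    · intro k' κ hκ _ h
      rw [topSum, sP_cons _ _ hκ]; simpa using h k' (by simp)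
  exact_mod_cast (h1.trans h2).trans h3

lemma dom_trans {a b c : JPartition} (h : dominates a b) (h' : dominates b c) : dominates a c :=
  ⟨h.1.trans h'.1, fun k => (h.2 k).trans (h'.2 k)⟩
lemma dom_refl (a : JPartition) : dominates a a := ⟨rfl, fun _ => le_rfl⟩

variable {K : Type} [Field K]

/-- coefficient of a monomial symmetric function -/
def ML : List ℕ → Sy K →ₗ[K] K
  | [] => lcoeff K 0
  | k :: l => ML l ∘ₗ hp (k : ℤ)

lemma ML_nil (f : Sy K) : ML [] f = coeff 0 f := rfl
lemma ML_cons (k : ℕ) (l : List ℕ) (f : Sy K) : ML (k :: l) f = ML l (hp (k : ℤ) f) := rfl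

lemma ML_perm {l l' : List ℕ} (h : l.Perm l') : ∀ f : Sy K, ML l f = ML l' f := by
  induction h with
  | nil => intro f; rfl
  | cons k _ ih => intro f; rw [ML_cons, ML_cons, ih]
  | swap a b l => intro f; rw [ML_cons, ML_cons, ML_cons, ML_cons, hp_comm]
  | trans _ _ h1 h2 => intro f; rw [h1, h2]

/-- every list reduces to a partition -/
lemma ML_red (l : List ℕ) : ∃ m : JPartition, (∀ f : Sy K, ML l f = ML (sortedParts m) f) ∧ (∀ k ∈ l, ∀ h : 0 < k, (Nat.toPNat k h) ∈ m) := by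
  induction l with
  | nil => exact ⟨0, by rw [sP_zero]; intro f; rfl, by simp⟩
  | cons k l ih =>
    obtain ⟨m, hm, hm'⟩ := ih
    rcases Nat.eq_zero_or_pos k with h | h
    · subst h
      refine ⟨m, ?_, ?_⟩
      · intro f; rw [ML_cons, ← hm]; simp [hp_zero]
      · intro k hk h
        rcases List.mem_cons.1 hk with h' | h'
        · omega
        · exact hm' k h' h
    · refine ⟨Nat.toPNat k h ::ₘ m, ?_, ?_⟩
      · intro f
        rw [ML_cons, hm, ← ML_cons]
        apply ML_perm
        rw [← Multiset.coe_eq_coe, sP_coe, Multiset.map_cons, ← sP_coe]; rfl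
      · intro k' hk h
        rcases List.mem_cons.1 hk with h' | h'
        · subst h'; exact Multiset.mem_cons_self _ _
        · exact Multiset.mem_cons_of_mem (hm' k' h' h)

lemma ML_consP (k : ℕ+) (m : JPartition) (f : Sy K) : ML (sortedParts m) (hp ((k : ℕ) : ℤ) f) = ML (sortedParts (k ::ₘ m)) f := by
  rw [← ML_cons]
  apply ML_perm
  rw [← Multiset.coe_eq_coe, sP_coe, Multiset.map_cons, ← sP_coe]; rfl

lemma coeff0_eS (g : Sy K) : coeff 0 (eS g) = 0 := by
  refine ind_p (P := fun g => coeff 0 (eS g) = 0) ?_ ?_ ?_ ?_ g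
  · simp [eS_one]
  · intro c f h; rw [map_smul, coeff_smul, h, smul_zero]
  · intro f g h h'; rw [map_add, coeff_add, h, h', add_zero]
  · intro f h c hc
    rw [eS_ppmul, coeff_add, coeff_smul, coeff0_pp, coeff0_pp]; simp

lemma ML_eS (l : List ℕ) : ∀ f : Sy K, ML l (eS f) = (l.sum : K) * ML l f := by
  induction l with
  | nil => intro f; rw [ML_nil, coeff0_eS]; simp
  | cons k l ih =>
    intro f
    rw [ML_cons, eS_hp, map_add, map_smul, ih, ML_cons, List.sum_cons, smul_eq_mul]
    push_cast; ring

variable [CharZero K]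

lemma ML_zero' (f : Sy K) (h : ∀ l : List ℕ, ML l f = 0) : f = 0 := by
  have stab : ∀ (n : ℕ) (f : Sy K), (∀ l : List ℕ, ML l f = 0) → ∀ l : List ℕ, ML l (nd n f) = 0 := by
    intro n
    induction n using Nat.strong_induction_on with
    | _ n ih =>
    intro f h l
    cases n with
    | zero => rw [nd_zero, map_zero]
    | succ n =>
      have h1 := hp_rec f ((n+1 : ℕ) : ℤ) (n+1) le_rfl
      rw [Finset.sum_range_succ, sub_self, hp_zero] at h1
      rw [eq_sub_of_add_eq' h1.symm, map_sub, map_smul, ← ML_cons, h, map_sum, Finset.sum_eq_zero]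
      · simp
      · intro x hx
        have := Finset.mem_range.1 hx
        apply ih _ (by omega)
        intro l
        rw [show ((n+1 : ℕ) : ℤ) - (x+1 : ℕ) = ((n - x : ℕ) : ℤ) by omega, ← ML_cons, h]
  ext m
  rw [coeff_zero]
  induction hd : m.degree generalizing m f with
  | zero =>
    have : m = 0 := by rw [Finsupp.degree_eq_zero_iff] at hd; exact hd
    rw [this]; exact h []
  | succ d ih =>
    have : ∃ i, m i ≠ 0 := by
      by_contra hc
      push Not at hc
      have : m = 0 := by ext i; simp [hc i]
      rw [this] at hd; simp at hd
    obtain ⟨i, hi⟩ := this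
    obtain ⟨m', rfl⟩ : ∃ m', m = m' + Finsupp.single i 1 := by
      refine ⟨m - Finsupp.single i 1, ?_⟩
      rw [tsub_add_cancel_of_le]
      rw [Finsupp.single_le_iff]; omega
    have h1 := ih (nd (i : ℕ) f) (stab i f h) m' (by
      rw [map_add, Finsupp.degree_single] at hd; omega)
    have : nd (i : ℕ) f = ((1 : K) * (i : ℕ)) • pderiv i f := cM_cre 1 i f
    rw [this, coeff_smul, coeff_pderiv, smul_eq_mul] at h1
    have h2 : ((i : ℕ) : K) ≠ 0 := by exact_mod_cast i.ne_zero
    have h3 : ((m' i : K) + 1) ≠ 0 := by exact_mod_cast Nat.succ_ne_zero (m' i)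
    simp [h2, h3] at h1
    exact h1

lemma ML_zero (f : Sy K) (h : ∀ m : JPartition, ML (sortedParts m) f = 0) : f = 0 := by
  apply ML_zero'
  intro l
  obtain ⟨m, hm, _⟩ := ML_red (K := K) l
  rw [hm, h]

/-- comparison with the frozen evaluation -/
lemma evalN_succ (N : ℕ) (f : SymA) (i : ℕ) (m : Fin N →₀ ℕ) :
    coeff (Finsupp.cons i m) (evalN (N+1) f) = coeff m (evalN N (hp (i : ℤ) f)) := by
  rw [← finSuccEquiv_coeff_coeff, hp_nat]
  have : ((finSuccEquiv F N).toAlgHom.comp (evalN (N+1))) = (Polynomial.mapAlgHom (evalN N)).comp TT := by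
    apply MvPolynomial.algHom_ext
    intro i
    simp only [AlgHom.comp_apply, evalN, TT, aeval_X, map_sum, map_pow, map_add, Polynomial.map_add, Polynomial.map_pow, Polynomial.map_C, Polynomial.map_X, Polynomial.coe_mapAlgHom]
    rw [Fin.sum_univ_succ]
    simp [finSuccEquiv_X_zero, finSuccEquiv_X_succ, add_comm, map_sum]
  have h2 := AlgHom.congr_fun this f
  simp only [AlgHom.comp_apply] at h2
  have h3 : (finSuccEquiv F N) (evalN (N+1) f) = (Polynomial.mapAlgHom (evalN N)) (TT f) := h2
  rw [h3, Polynomial.coe_mapAlgHom, Polynomial.coeff_map]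
  rfl

lemma evalN_ML : ∀ (N : ℕ) (l : List ℕ), l.length ≤ N → ∀ f : SymA,
    coeff (Finsupp.equivFunOnFinite.symm fun j : Fin N => l.getD (j : ℕ) 0) (evalN N f) = ML l f := by
  intro N
  induction N with
  | zero =>
    intro l hl f
    have : l = [] := by simpa using hl
    subst this
    rw [ML_nil]
    refine ind_p (P := fun f => coeff (Finsupp.equivFunOnFinite.symm fun j : Fin 0 => ([] : List ℕ).getD (j : ℕ) 0) (evalN 0 f) = coeff 0 f) ?_ ?_ ?_ ?_ f
    · rw [map_one, coeff_one, coeff_one, if_pos, if_pos rfl]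
      ext j; exact j.elim0
    · intro c f h; rw [map_smul, coeff_smul, coeff_smul, h]
    · intro f g h h'; rw [map_add, coeff_add, coeff_add, h, h']
    · intro f h c hc
      obtain ⟨d, rfl⟩ : ∃ d : ℕ+, (d:ℕ)=c := ⟨Nat.toPNat c hc, rfl⟩
      rw [coeff0_pp, map_mul, pp_coe, evalN, aeval_X]; simp
  | succ N ih =>
    intro l hl f
    obtain ⟨k, l', hl', h1, h2⟩ : ∃ (k : ℕ) (l' : List ℕ), l'.length ≤ N ∧ (∀ j : ℕ, l.getD j 0 = (k :: l').getD j 0) ∧ ML (K := F) l = ML (k :: l') := by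
      cases l with
      | nil =>
        refine ⟨0, [], by simp, ?_, ?_⟩
        · intro j; cases j <;> simp
        · exact LinearMap.ext fun f => by rw [ML_cons, ML_nil, ML_nil, Nat.cast_zero, hp_zero]
      | cons k l => exact ⟨k, l, by simpa using hl, fun j => rfl, rfl⟩
    have e : (Finsupp.equivFunOnFinite.symm fun j : Fin (N+1) => l.getD (j : ℕ) 0) =
        Finsupp.cons k (Finsupp.equivFunOnFinite.symm fun j : Fin N => l'.getD (j : ℕ) 0) := by
      ext j
      refine Fin.cases ?_ ?_ j
      · show l.getD 0 0 = _
        rw [h1]; rfl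
      · intro j
        show l.getD (j+1) 0 = _
        rw [h1, Finsupp.cons_succ]; rfl
    rw [e, evalN_succ, ih l' hl', h2, ML_cons]
end B4
end JK
end

open scoped Classical
noncomputable section
set_option linter.unusedSectionVars false
set_option linter.unusedSimpArgs false
namespace JK
open MvPolynomial
section B5
variable {K : Type} [Field K] [CharZero K]

/-- A Jack family over a general field -/
structure JD (α : K) (J : JPartition → Sy K) : Prop where
  hT : ∀ a b : ℤ, α * a + b = 0 → a = 0 ∧ b = 0
  orth : ∀ l m, l ≠ m → pair α (J l) (J m) = 0
  aniso : ∀ l, pair α (J l) (J l) ≠ 0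
  tri : ∀ l m, ¬ dominates m l → ML (sortedParts m) (J l) = 0
  norm : ∀ l, coeff (Finsupp.single 1 (psize l)) (J l) = 1

lemma eS_DS (α : K) (f : Sy K) : eS (DS α f) = DS α (eS f) := by
  rw [DS_apply, DS_apply, map_smul, map_sub, map_smul, ← Th_eM, ← Th_eM, eM_L, eM_L, eM_io]

lemma dS1_nd (f : Sy K) : dS1 f = nd 1 f := by
  have := cM_cre (1 : K) (1 : ℕ+) f
  have h2 : nd 1 f = ((1 : K) * ((1 : ℕ+) : ℕ)) • pderiv 1 f := this
  rw [h2]; simp [dS1]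

/-- homogeneity through monomial coefficients -/
lemma hom_ML {f : Sy K} {n : ℕ} (h : eS f = (n : K) • f) {m : JPartition} (hm : psize m ≠ n) : ML (sortedParts m) f = 0 := by
  have h1 := ML_eS (sortedParts m) f
  rw [h, map_smul, sP_sum, smul_eq_mul] at h1
  have h2 : ((psize m : K) - n) * ML (sortedParts m) f = 0 := by rw [sub_mul, h1, sub_self]
  rcases mul_eq_zero.1 h2 with h3 | h3
  · exfalso; apply hm; exact_mod_cast sub_eq_zero.1 h3
  · exact h3

lemma ML_hom {f : Sy K} {n : ℕ} (h : ∀ m : JPartition, psize m ≠ n → ML (sortedParts m) f = 0) : eS f = (n : K) • f := by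
  rw [← sub_eq_zero]
  apply ML_zero
  intro m
  rw [map_sub, map_smul, ML_eS, sP_sum, smul_eq_mul, ← sub_mul]
  by_cases hm : psize m = n
  · rw [hm]; simp
  · rw [h m hm, mul_zero]

/-- span of homogeneous elements -/
lemma hom_span (f : Sy K) : f ∈ Submodule.span K {g : Sy K | ∃ n : ℕ, eS g = (n : K) • g} := by
  refine ind_p (P := fun f => f ∈ Submodule.span K {g : Sy K | ∃ n : ℕ, eS g = (n : K) • g}) ?_ ?_ ?_ ?_ f
  · exact Submodule.subset_span ⟨0, by simp [eS_one]⟩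
  · intro c f h; exact Submodule.smul_mem _ _ h
  · intro f g h h'; exact Submodule.add_mem _ h h'
  · intro f h c _
    induction h using Submodule.span_induction with
    | mem x hx =>
      obtain ⟨n, hn⟩ := hx
      refine Submodule.subset_span ⟨c + n, ?_⟩
      rw [eS_ppmul, hn, mul_smul_comm, ← add_smul]; push_cast; rw [add_comm]
    | zero => simp
    | add x y _ _ hx hy => rw [mul_add]; exact Submodule.add_mem _ hx hy
    | smul a x _ hx => rw [mul_smul_comm]; exact Submodule.smul_mem _ _ hx

/-- vanishing of higher skewings -/
def Uk (k : ℤ) : Submodule K (Sy K) where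
  carrier := {f | ∀ j : ℤ, k < j → hp j f = 0}
  add_mem' := fun {a b} ha hb j hj => by rw [map_add, ha j hj, hb j hj, add_zero]
  zero_mem' := fun j _ => map_zero _
  smul_mem' := fun c x hx j hj => by rw [map_smul, hx j hj, smul_zero]

/-- flag of triangular subspaces -/
def VL : List ℕ → Submodule K (Sy K)
  | [] => Uk 0
  | k :: l => Uk k ⊓ (VL l).comap (hp (k : ℤ))

/-- eigenvalue of the Laplace-Beltrami operator -/
def cL (α : K) : List ℕ → K
  | [] => 0
  | k :: l => α * c2 (k : ℤ) - (l.sum : K) + cL α l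

def aL : List ℕ → ℕ
  | [] => 0
  | k :: l => k.choose 2 + aL l

lemma c2_nat (k : ℕ) : (c2 (k : ℤ) : K) = (k.choose 2 : ℕ) := by
  rw [c2, choose_two_eq]; push_cast; ring

lemma cL_eq (α : K) (l : List ℕ) : cL α l = α * (aL l : K) - (bL l : K) := by
  induction l with
  | nil => simp [cL, aL, bL]
  | cons k l ih => rw [cL, aL, bL, ih, c2_nat]; push_cast; ring

lemma eS_hp' {f : Sy K} {c : K} (h : eS f = c • f) (k : ℤ) : eS (hp k f) = (c - k) • hp k f := by
  have := eS_hp f k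
  rw [h, map_smul] at this
  rw [sub_smul, this]; abel

lemma VL_DS {α : K} (hα : α ≠ 0) (l : List ℕ) : ∀ (f : Sy K) (c : K), eS f = c • f → f ∈ VL l → DS α f ∈ VL l := by
  induction l with
  | nil => intro f c _ hf; exact (hp_DS_top hα f 0 le_rfl hf).1
  | cons k l ih =>
    rintro f c h ⟨h1, h2⟩
    obtain ⟨h3, h4⟩ := hp_DS_top hα f k (Int.natCast_nonneg k) h1
    refine ⟨h3, ?_⟩
    show hp (k : ℤ) (DS α f) ∈ VL l
    rw [h4, eS_hp' h]
    have h5 : hp (k : ℤ) f ∈ VL l := h2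
    exact Submodule.sub_mem _ (Submodule.add_mem _ (ih _ _ (eS_hp' h k) h5) (Submodule.smul_mem _ _ h5)) (Submodule.smul_mem _ _ h5)

lemma ML_DS {α : K} (hα : α ≠ 0) (l : List ℕ) : ∀ (f : Sy K), eS f = (l.sum : K) • f → f ∈ VL l →
    ML l (DS α f) = cL α l * ML l f := by
  induction l with
  | nil =>
    intro f _ _
    rw [cL, zero_mul, ML_nil, ← pair_one α, ← pair_DS, DS_one]; simp
  | cons k l ih =>
    rintro f h ⟨h1, h2⟩
    obtain ⟨h3, h4⟩ := hp_DS_top hα f k (Int.natCast_nonneg k) h1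
    have h5 : eS (hp (k : ℤ) f) = (l.sum : K) • hp (k : ℤ) f := by
      rw [eS_hp' h, List.sum_cons]; push_cast; rw [add_sub_cancel_left]
    rw [ML_cons, h4, map_sub, map_add, ih _ h5 h2, h5, map_smul, map_smul, cL, ML_cons]
    simp only [smul_eq_mul]; ring

lemma VL_lex (l : List ℕ) : ∀ (m : List ℕ) (f : Sy K), (∀ i ∈ m, 0 < i) → f ∈ VL l → l < m → ML m f = 0 := by
  induction l with
  | nil =>
    intro m f hm hf h
    cases m with
    | nil => exact absurd h (lt_irrefl _)
    | cons j m =>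
      rw [ML_cons, hf (j : ℤ) (by exact_mod_cast hm j (by simp)), map_zero]
  | cons k l ih =>
    rintro m f hm ⟨h1, h2⟩ h
    cases m with
    | nil => exact absurd h (List.not_lt_nil _)
    | cons j m =>
      rw [ML_cons]
      rcases List.cons_lt_cons_iff.1 h with h3 | ⟨h3, h4⟩
      · rw [h1 (j : ℤ) (by exact_mod_cast h3), map_zero]
      · subst h3
        exact ih m _ (fun i hi => hm i (by simp [hi])) h2 h4

def Htri (l : JPartition) (f : Sy K) : Prop := ∀ m, ¬ dominates m l → ML (sortedParts m) f = 0

lemma hp_zero_of {f : Sy K} {j : ℤ} {P : ℕ+ → Prop} (hj : 0 < j) (hP : P (Nat.toPNat j.toNat (by omega)))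
    (h : ∀ (m : JPartition) (i : ℕ+), i ∈ m → P i → ML (sortedParts m) f = 0) : hp j f = 0 := by
  obtain ⟨i, rfl⟩ : ∃ i : ℕ+, ((i : ℕ) : ℤ) = j := ⟨Nat.toPNat j.toNat (by omega), by show ((j.toNat : ℕ) : ℤ) = j; omega⟩
  apply ML_zero
  intro m
  rw [ML_consP]
  exact h _ i (Multiset.mem_cons_self _ _) (by
    convert hP
    apply PNat.eq
    show (i : ℕ) = (((i : ℕ) : ℤ)).toNat
    omega)

lemma Htri_top {k : ℕ+} {κ : JPartition} (hκ : ∀ i ∈ κ, i ≤ k) {f : Sy K} (h : Htri (k ::ₘ κ) f) :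
    (∀ j : ℤ, ((k : ℕ) : ℤ) < j → hp j f = 0) ∧ Htri κ (hp ((k : ℕ) : ℤ) f) := by
  constructor
  · intro j hj
    have hk := k.pos
    refine hp_zero_of (P := fun i => k < i) (by omega) ?_ ?_
    · rw [← PNat.coe_lt_coe]; show (k : ℕ) < j.toNat; omega
    · intro m i hi hki
      apply h
      intro hd
      have := dom_part (k := k) hd (by
        intro a ha
        rcases Multiset.mem_cons.1 ha with h' | h'
        · exact h'.le
        · exact hκ a h') i hi
      exact absurd hki (not_lt.2 this)
  · intro m hm
    rw [ML_consP]
    exact h _ (fun hd => hm (dom_cons hκ hd))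

lemma Htri_VL (l : JPartition) : ∀ f : Sy K, Htri l f → f ∈ VL (sortedParts l) := by
  refine part_ind (P := fun l => ∀ f : Sy K, Htri l f → f ∈ VL (sortedParts l)) ?_ ?_ l
  · intro f h
    rw [sP_zero]
    intro j hj
    refine hp_zero_of (P := fun _ => True) hj trivial ?_
    intro m i hi _
    apply h
    intro hd
    have := hd.1
    obtain ⟨m', rfl⟩ := Multiset.exists_cons_of_mem hi
    rw [psize_cons, psize_zero] at this
    have := i.pos; omega
  · intro k κ hκ ih f h
    rw [sP_cons k κ hκ]
    have := Htri_top hκ h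
    exact ⟨this.1, ih _ this.2⟩

end B5
end JK
end

open scoped Classical
noncomputable section
set_option linter.unusedSectionVars false
set_option linter.unusedSimpArgs false
namespace JK
open MvPolynomial
section B6
variable {K : Type} [Field K] [CharZero K]
namespace JD
variable {α : K} {J : JPartition → Sy K}

lemma hα (H : JD α J) : α ≠ 0 := by
  intro h
  have := H.hT 1 0 (by simp [h])
  omega

lemma hom (H : JD α J) (l : JPartition) : eS (J l) = (psize l : K) • J l :=
  ML_hom (fun m hm => H.tri l m (fun hd => hm hd.1))

lemma pair_span (H : JD α J) {A : Set JPartition} {κ : JPartition} (hκ : κ ∉ A) {f : Sy K} (hf : f ∈ Submodule.span K (J '' A)) :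
    pair α f (J κ) = 0 := by
  induction hf using Submodule.span_induction with
  | mem x hx =>
    obtain ⟨l, hl, rfl⟩ := hx
    exact H.orth _ _ (fun h => hκ (h ▸ hl))
  | zero => simp
  | add x y _ _ hx hy => rw [map_add, LinearMap.add_apply, hx, hy, add_zero]
  | smul a x _ hx => rw [map_smul, LinearMap.smul_apply, hx, smul_zero]

lemma bL_le {m l : JPartition} (h : dominates m l) : bL (sortedParts l) ≤ bL (sortedParts m) := by
  by_cases e : m = l
  · rw [e]
  · exact (bL_lt h e).le

lemma dom_antisymm {m l : JPartition} (h : dominates m l) (h' : dominates l m) : m = l := by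
  by_contra e
  have := bL_lt h e
  have := bL_le h'
  omega

lemma span_of (H : JD α J) : ∀ (n : ℕ) (I : Finset JPartition), I.card = n → (∀ κ ∈ I, ∀ m, dominates m κ → m ∈ I) →
    ∀ f : Sy K, (∀ m, m ∉ I → ML (sortedParts m) f = 0) → f ∈ Submodule.span K (J '' (I : Set JPartition)) := by
  intro n
  induction n with
  | zero =>
    intro I hI _ f hf
    rw [Finset.card_eq_zero] at hI
    have : f = 0 := ML_zero f (fun m => hf m (by simp [hI]))
    rw [this]; exact Submodule.zero_mem _
  | succ n ih =>
    intro I hI hlow f hf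
    have hne : I.Nonempty := by rw [← Finset.card_pos]; omega
    obtain ⟨κ, hκ, hmin⟩ := Finset.exists_min_image I (fun κ => bL (sortedParts κ)) hne
    have hlow' : ∀ ν ∈ I.erase κ, ∀ m, dominates m ν → m ∈ I.erase κ := by
      intro ν hν m hm
      rw [Finset.mem_erase] at hν ⊢
      refine ⟨?_, hlow ν hν.2 m hm⟩
      rintro rfl
      have h1 := bL_lt hm (Ne.symm hν.1)
      have h2 := hmin ν hν.2
      omega
    have IH := ih (I.erase κ) (by rw [Finset.card_erase_of_mem hκ]; omega) hlow'
    have hJ : ∀ m, m ∉ I → ML (sortedParts m) (J κ) = 0 := fun m hm => H.tri _ _ (fun hd => hm (hlow κ hκ m hd))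
    have hc : ML (sortedParts κ) (J κ) ≠ 0 := by
      intro h0
      apply H.aniso κ
      refine H.pair_span (A := ((I.erase κ : Finset JPartition) : Set JPartition)) (by simp) (IH (J κ) ?_)
      intro m hm
      rw [Finset.mem_erase, not_and_or] at hm
      rcases hm with h | h
      · rw [not_not] at h; rw [h]; exact h0
      · exact hJ m h
    have h1 : f - (ML (sortedParts κ) f / ML (sortedParts κ) (J κ)) • J κ ∈ Submodule.span K (J '' ((I.erase κ : Finset JPartition) : Set JPartition)) := by
      apply IH
      intro m hm
      rw [map_sub, map_smul, smul_eq_mul]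
      rw [Finset.mem_erase, not_and_or] at hm
      rcases hm with h | h
      · rw [not_not] at h; rw [h]; field_simp; simp
      · rw [hJ m h, hf m h]; simp
    have h2 := Submodule.span_mono (R := K) (Set.image_mono (f := J) (Finset.coe_subset.2 (Finset.erase_subset κ I))) h1
    have h3 : J κ ∈ Submodule.span K (J '' (I : Set JPartition)) := Submodule.subset_span ⟨κ, hκ, rfl⟩
    have := Submodule.add_mem _ h2 (Submodule.smul_mem _ (ML (sortedParts κ) f / ML (sortedParts κ) (J κ)) h3)
    rwa [sub_add_cancel] at this

lemma span_set (H : JD α J) (A : Set JPartition) (n : ℕ) (hA : ∀ κ, κ ∈ A → ∀ m, dominates m κ → m ∈ A)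
    (f : Sy K) (hn : eS f = (n : K) • f) (hf : ∀ m, m ∉ A → ML (sortedParts m) f = 0) :
    f ∈ Submodule.span K (J '' {m | m ∈ A ∧ psize m = n}) := by
  have hfin : {m | m ∈ A ∧ psize m = n}.Finite := (fin_part n).subset (fun m hm => hm.2.le)
  have := H.span_of _ hfin.toFinset rfl (by
    intro κ hκ m hm
    rw [Set.Finite.mem_toFinset] at hκ ⊢
    exact ⟨hA κ hκ.1 m hm, hm.1.trans hκ.2⟩) f (by
    intro m hm
    rw [Set.Finite.mem_toFinset] at hm
    by_cases h : psize m = n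
    · exact hf m (fun h' => hm ⟨h', h⟩)
    · exact hom_ML hn h)
  rwa [Set.Finite.coe_toFinset] at this

lemma MLJ (H : JD α J) (κ : JPartition) : ML (sortedParts κ) (J κ) ≠ 0 := by
  intro h0
  apply H.aniso κ
  refine H.pair_span (A := {m | m ∈ {m | dominates m κ ∧ m ≠ κ} ∧ psize m = psize κ}) ?_ (H.span_set {m | dominates m κ ∧ m ≠ κ} _ ?_ (J κ) (H.hom κ) ?_)
  · intro h; exact h.1.2 rfl
  · rintro ν ⟨h1, h2⟩ m hm
    refine ⟨dom_trans hm h1, ?_⟩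
    rintro rfl
    exact h2 (dom_antisymm h1 hm)
  · intro m hm
    by_cases h : m = κ
    · rw [h, h0]
    · exact H.tri _ _ (fun hd => hm ⟨hd, h⟩)

lemma span_top (H : JD α J) (f : Sy K) : f ∈ Submodule.span K (Set.range J) := by
  have h := hom_span f
  induction h using Submodule.span_induction with
  | mem x hx =>
    obtain ⟨n, hn⟩ := hx
    exact Submodule.span_mono (Set.image_subset_range _ _) (H.span_set Set.univ n (fun _ _ _ _ => trivial) x hn (fun m hm => absurd trivial hm))
  | zero => simp
  | add x y _ _ hx hy => exact Submodule.add_mem _ hx hy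
  | smul a x _ hx => exact Submodule.smul_mem _ _ hx

lemma ext_pair (H : JD α J) {f g : Sy K} (h : ∀ m, pair α f (J m) = pair α g (J m)) : f = g := by
  rw [← sub_eq_zero]
  apply pair_nondeg H.hα
  intro x
  rw [pair_symm]
  have := H.span_top x
  induction this using Submodule.span_induction with
  | mem x hx => obtain ⟨m, rfl⟩ := hx; rw [map_sub, LinearMap.sub_apply, h m, sub_self]
  | zero => simp
  | add x y _ _ hx hy => rw [map_add, hx, hy, add_zero]
  | smul a x _ hx => rw [map_smul, hx, smul_zero]

lemma prop_of (H : JD α J) {f : Sy K} {l : JPartition} (h : ∀ m, m ≠ l → pair α f (J m) = 0) :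
    f = (pair α f (J l) / pair α (J l) (J l)) • J l := by
  apply H.ext_pair
  intro m
  rw [map_smul, LinearMap.smul_apply, smul_eq_mul]
  by_cases e : m = l
  · subst e; rw [div_mul_cancel₀ _ (H.aniso m)]
  · rw [h m e, H.orth _ _ (Ne.symm e), mul_zero]

lemma J_VL (H : JD α J) (l : JPartition) : J l ∈ VL (sortedParts l) := Htri_VL l _ (fun m hm => H.tri l m hm)

lemma DJ (H : JD α J) (l : JPartition) : DS α (J l) = cL α (sortedParts l) • J l := by
  have key : ∀ l m : JPartition, sortedParts l < sortedParts m → pair α (DS α (J l)) (J m) = 0 := by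
    intro l m hlm
    refine H.pair_span (A := {m | m ∈ {m | sortedParts m ≤ sortedParts l} ∧ psize m = psize l}) ?_ (H.span_set {m | sortedParts m ≤ sortedParts l} (psize l) ?_ _ ?_ ?_)
    · intro h; exact absurd hlm (not_lt.2 h.1)
    · intro κ hκ m hm
      have := dom_lex (sortedParts m) (sortedParts κ) (sP_pos m) hm.2
      exact le_trans (le_iff_lt_or_eq.2 this) hκ
    · rw [eS_DS, H.hom, map_smul]
    · intro m hm
      exact VL_lex _ _ _ (sP_pos m) (VL_DS H.hα _ _ _ (H.hom l) (H.J_VL l)) (not_le.1 hm)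
  have h1 := H.prop_of (f := DS α (J l)) (l := l) (by
    intro m hm
    rcases lt_trichotomy (sortedParts l) (sortedParts m) with h | h | h
    · exact key l m h
    · exact absurd (sP_inj h).symm hm
    · rw [pair_DS, pair_symm]; exact key m l h)
  have h2 := ML_DS H.hα (sortedParts l) (J l) (by rw [sP_sum]; exact H.hom l) (H.J_VL l)
  rw [h1, map_smul, smul_eq_mul] at h2
  rw [h1, mul_right_cancel₀ (H.MLJ l) h2]

lemma J_top (H : JD α J) {k : ℕ+} {κ : JPartition} (hκ : ∀ i ∈ κ, i ≤ k) : ∀ j : ℤ, ((k : ℕ) : ℤ) < j → hp j (J (k ::ₘ κ)) = 0 :=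
  (Htri_top hκ (fun m hm => H.tri _ m hm)).1

lemma cL_ne (H : JD α J) {m l : JPartition} (h : dominates m l) (hne : m ≠ l) : cL α (sortedParts m) ≠ cL α (sortedParts l) := by
  intro e
  rw [cL_eq, cL_eq] at e
  have := H.hT ((aL (sortedParts m) : ℤ) - aL (sortedParts l)) (bL (sortedParts l) - bL (sortedParts m)) (by
    push_cast
    linear_combination e)
  have := bL_lt h hne
  omega

lemma psize_sub {k : ℕ+} {κ : JPartition} : ((psize (k ::ₘ κ) : ℕ) : K) - (((k : ℕ) : ℤ) : K) = psize κ := by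
  rw [psize_cons]; push_cast; ring

lemma J_red (H : JD α J) {k : ℕ+} {κ : JPartition} (hκ : ∀ i ∈ κ, i ≤ k) :
    ∃ r : K, r ≠ 0 ∧ hp ((k : ℕ) : ℤ) (J (k ::ₘ κ)) = r • J κ := by
  obtain ⟨h1, h2⟩ := Htri_top hκ (f := J (k ::ₘ κ)) (fun m hm => H.tri _ m hm)
  set f := hp ((k : ℕ) : ℤ) (J (k ::ₘ κ)) with hf
  have hom : eS f = (psize κ : K) • f := by
    rw [hf, eS_hp' (H.hom _), psize_sub]
  have hD : DS α f = cL α (sortedParts κ) • f := by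
    have h3 := (hp_DS_top H.hα (J (k ::ₘ κ)) ((k : ℕ) : ℤ) (Int.natCast_nonneg _) h1).2
    rw [H.DJ, map_smul, ← hf, hom, sP_cons k κ hκ, cL, sP_sum] at h3
    have h4 : DS α f = (α * c2 ((k : ℕ) : ℤ) - (psize κ : K) + cL α (sortedParts κ)) • f - (α * c2 ((k : ℕ) : ℤ)) • f + (psize κ : K) • f := by
      rw [h3]; abel
    rw [h4]; module
  have h5 := H.prop_of (f := f) (l := κ) (by
    intro m hm
    by_cases hd : dominates m κ
    · have e1 : cL α (sortedParts κ) * pair α f (J m) = cL α (sortedParts m) * pair α f (J m) := by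
        have := pair_DS α f (J m)
        rw [hD, H.DJ, map_smul, LinearMap.smul_apply, map_smul] at this
        exact this
      have e2 := H.cL_ne hd hm
      by_contra h0
      exact e2 (mul_right_cancel₀ h0 e1).symm
    · refine H.pair_span (A := {m | m ∈ {m | dominates m κ} ∧ psize m = psize κ}) (fun h => hd h.1) (H.span_set {m | dominates m κ} _ ?_ f hom ?_)
      · intro a ha b hb; exact dom_trans hb ha
      · intro m hm; exact h2 m hm)
  refine ⟨_, ?_, h5⟩
  intro h0
  rw [h0, zero_smul] at h5
  apply H.MLJ (k ::ₘ κ)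
  rw [← ML_consP, ← hf, h5, map_zero]

lemma span_le (H : JD α J) (k : ℕ) {f : Sy K} {n : ℕ} (hn : eS f = (n : K) • f) (hf : ∀ j : ℤ, (k : ℤ) < j → hp j f = 0) :
    f ∈ Submodule.span K (J '' {m | (∀ i ∈ m, (i : ℕ) ≤ k) ∧ psize m = n}) := by
  refine H.span_set {m : JPartition | ∀ i ∈ m, (i : ℕ) ≤ k} n ?_ f hn ?_
  · intro κ hκ m hm i hi
    have h1 := le_topSum m i hi
    have h2 := hm.2 1
    have h3 : topSum κ 1 ≤ k := by
      revert hκ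
      refine part_ind (P := fun l => (l ∈ {m : JPartition | ∀ i ∈ m, (i : ℕ) ≤ k}) → topSum l 1 ≤ k) ?_ ?_ κ
      · simp [topSum, sP_zero]
      · intro k' κ hκ _ h
        rw [topSum, sP_cons _ _ hκ]; simpa using h k' (by simp)
    omega
  · intro m hm
    have hm : ¬ ∀ i ∈ m, (i : ℕ) ≤ k := hm
    push Not at hm
    obtain ⟨i, hi, hik⟩ := hm
    obtain ⟨m', rfl⟩ := Multiset.exists_cons_of_mem hi
    rw [← ML_consP, hf _ (by exact_mod_cast hik), map_zero]

lemma J_zero (H : JD α J) : J 0 = 1 := by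
  rw [← sub_eq_zero]
  apply ML_zero
  intro m
  by_cases hm : m = 0
  · rw [hm, sP_zero, ML_nil, coeff_sub, coeff_zero_one]
    have := H.norm 0
    rw [psize_zero, Finsupp.single_zero] at this
    rw [this, sub_self]
  · have hp : psize m ≠ 0 := by
      intro h
      obtain ⟨i, hi⟩ := Multiset.exists_mem_of_ne_zero hm
      obtain ⟨m', rfl⟩ := Multiset.exists_cons_of_mem hi
      rw [psize_cons] at h
      have := i.pos; omega
    refine hom_ML (n := 0) ?_ hp
    rw [map_sub, H.hom, psize_zero, eS_one]; simp

/-- skewing against pairing -/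
lemma hp_adj (H : JD α J) {k : ℕ+} {κ : JPartition} (hκ : ∀ i ∈ κ, i ≤ k) :
    ∃ s : K, s ≠ 0 ∧ ∀ (f : Sy K) (n : ℕ), eS f = (n : K) • f → (∀ j : ℤ, ((k : ℕ) : ℤ) < j → hp j f = 0) →
      pair α (hp ((k : ℕ) : ℤ) f) (J κ) = s * pair α f (J (k ::ₘ κ)) := by
  obtain ⟨r, hr, hr'⟩ := H.J_red hκ
  refine ⟨r * pair α (J κ) (J κ) / pair α (J (k ::ₘ κ)) (J (k ::ₘ κ)), div_ne_zero (mul_ne_zero hr (H.aniso _)) (H.aniso _), ?_⟩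
  intro f n hn hf
  have := H.span_le k hn hf
  clear hf hn
  induction this using Submodule.span_induction with
  | mem x hx =>
    obtain ⟨m, ⟨hm, _⟩, rfl⟩ := hx
    by_cases e : m = k ::ₘ κ
    · subst e
      rw [hr', map_smul, LinearMap.smul_apply, smul_eq_mul, div_mul_cancel₀ _ (H.aniso _)]
    · rw [H.orth _ _ e, mul_zero]
      revert hm e
      refine part_ind (P := fun m => (∀ i ∈ m, (i : ℕ) ≤ k) → m ≠ k ::ₘ κ → pair α (hp ((k : ℕ) : ℤ) (J m)) (J κ) = 0) ?_ ?_ m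
      · intro _ _
        rw [H.J_zero, hp_one, if_neg (by have := k.pos; omega)]; simp
      · intro k' μ hμ _ hm e
        rcases lt_or_eq_of_le (hm k' (by simp)) with h | h
        · rw [H.J_top hμ _ (by exact_mod_cast h)]; simp
        · have : k' = k := PNat.eq h
          subst this
          obtain ⟨r', _, hr2⟩ := H.J_red hμ
          rw [hr2, map_smul, LinearMap.smul_apply, H.orth, smul_zero]
          rintro rfl; exact e rfl
  | zero => simp
  | add x y _ _ hx hy => simp only [map_add, LinearMap.add_apply, hx, hy, mul_add]
  | smul a x _ hx => simp only [map_smul, LinearMap.smul_apply, hx, smul_eq_mul]; ring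
end JD
end B6
end JK
end

open scoped Classical
noncomputable section
set_option linter.unusedSectionVars false
set_option linter.unusedSimpArgs false
namespace JK
open MvPolynomial
section B7
variable {K : Type} [Field K] [CharZero K]

/-- content product -/
def wL (α : K) : List ℕ → K → K
  | [], _ => 1
  | k :: l, u => (∏ j ∈ Finset.range k, (u + α * j)) * wL α l (u - 1)

lemma pp_one_mul_nd (α : K) (f g : Sy K) : pair α (pp 1 * f) g = α * pair α f (nd 1 g) := pair_pp α 1 f g

namespace JD
variable {α : K} {J : JPartition → Sy K}

lemma nd_hom {f : Sy K} {n : ℕ} (hn : eS f = (n : K) • f) : eS (nd 1 f) = ((n : K) - 1) • nd 1 f := by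
  have h : ∀ f : Sy K, nd 1 (eS f) = eS (nd 1 f) + nd 1 f := by
    intro f
    refine ind_p (P := fun f : Sy K => nd 1 (eS f) = eS (nd 1 f) + nd 1 f) ?_ ?_ ?_ ?_ f
    · simp [eS_one, nd_one]
    · intro c f h; simp only [map_smul, h, smul_add]
    · intro f g h h'; simp only [map_add, h, h']; abel
    · intro f h c hc
      rw [eS_ppmul, map_add, map_smul, nd_pp, nd_pp, h, map_add, eS_ppmul]
      split_ifs with h1
      · subst h1; simp only [Nat.cast_one, one_smul, mul_add]
      · simp only [map_zero, mul_add]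
        module
  have h1 := h f
  rw [hn, map_smul] at h1
  rw [sub_smul, h1, one_smul]; abel

/-- size constraint -/
lemma pieri_size (H : JD α J) {l m : JPartition} (h : pair α (pp 1 * J l) (J m) ≠ 0) : psize m = psize l + 1 := by
  have h1 := pair_eS α (pp 1 * J l) (J m)
  rw [eS_ppmul, H.hom, H.hom, mul_smul_comm, ← add_smul, map_smul, LinearMap.smul_apply, map_smul, smul_eq_mul, smul_eq_mul] at h1
  have := mul_right_cancel₀ h h1
  exact_mod_cast this.symm

lemma hp_p1 (j : ℤ) (f : Sy K) : hp j (pp 1 * f) = pp 1 * hp j f + hp (j - 1) f := by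
  have := hp_pp j 1 Nat.one_pos f
  simpa using this

lemma hom_p1 {f : Sy K} {n : ℕ} (hn : eS f = (n : K) • f) : eS (pp 1 * f) = ((n + 1 : ℕ) : K) • (pp 1 * f) := by
  rw [eS_ppmul, hn, mul_smul_comm, ← add_smul]; push_cast; rfl

lemma pieri (H : JD α J) (m : JPartition) : ∀ l : JPartition, pair α (pp 1 * J l) (J m) ≠ 0 → ∀ u : K,
    wL α (sortedParts m) u = wL α (sortedParts l) u * (u + cL α (sortedParts m) - cL α (sortedParts l)) := by
  refine part_ind (P := fun m => ∀ l : JPartition, pair α (pp 1 * J l) (J m) ≠ 0 → ∀ u : K,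
    wL α (sortedParts m) u = wL α (sortedParts l) u * (u + cL α (sortedParts m) - cL α (sortedParts l))) ?_ ?_ m
  · intro l h
    have := H.pieri_size h
    rw [psize_zero] at this; omega
  · intro k' κ' hκ' ih l
    have hκ'' : ∀ i ∈ k' ::ₘ κ', i ≤ k' := by
      intro a ha
      rcases Multiset.mem_cons.1 ha with h' | h'
      · exact h'.le
      · exact hκ' a h'
    refine part_ind (P := fun l => pair α (pp 1 * J l) (J (k' ::ₘ κ')) ≠ 0 → ∀ u : K,
      wL α (sortedParts (k' ::ₘ κ')) u = wL α (sortedParts l) u * (u + cL α (sortedParts (k' ::ₘ κ')) - cL α (sortedParts l))) ?_ ?_ l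
    · intro h u
      have hs := H.pieri_size h
      rw [psize_cons, psize_zero] at hs
      have hk := k'.pos
      have hκ0 : κ' = 0 := by
        by_contra h0
        obtain ⟨i, hi⟩ := Multiset.exists_mem_of_ne_zero h0
        obtain ⟨m', rfl⟩ := Multiset.exists_cons_of_mem hi
        rw [psize_cons] at hs
        have := i.pos; omega
      have hk1 : (k' : ℕ) = 1 := by omega
      rw [sP_cons _ _ hκ', hκ0, sP_zero, hk1]
      simp [wL, cL, c2]
    · intro k κ hκ _ h u
      have hs := H.pieri_size h
      have hD : pair α (J (k ::ₘ κ)) (nd 1 (J (k' ::ₘ κ'))) ≠ 0 := by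
        intro h0; apply h; rw [pp_one_mul_nd, h0, mul_zero]
      have hn : eS (nd 1 (J (k' ::ₘ κ'))) = (psize (k ::ₘ κ) : K) • nd 1 (J (k' ::ₘ κ')) := by
        rw [nd_hom (H.hom _), hs]; push_cast; rw [add_sub_cancel_right]
      have htop : ∀ j : ℤ, ((k' : ℕ) : ℤ) < j → hp j (nd 1 (J (k' ::ₘ κ'))) = 0 := by
        intro j hj
        rw [hp_nd, H.J_top hκ' j hj, map_zero]
      have hle : (k : ℕ) ≤ k' := by
        by_contra hc
        apply hD
        rw [pair_symm]
        refine H.pair_span ?_ (H.span_le _ hn htop)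
        intro h'
        exact hc (h'.1 k (by simp))
      rcases hle.lt_or_eq with hlt | heq
      · -- the first row grows
        have htop2 : ∀ j : ℤ, ((k + 1 : ℕ) : ℤ) < j → hp j (pp 1 * J (k ::ₘ κ)) = 0 := by
          intro j hj
          rw [hp_p1, H.J_top hκ j (by push_cast at hj; omega), H.J_top hκ (j-1) (by push_cast at hj; omega)]; simp
        have hle2 : (k' : ℕ) ≤ k + 1 := by
          by_contra hc
          apply h
          refine H.pair_span ?_ (H.span_le _ (hom_p1 (H.hom _)) htop2)
          intro h'
          exact hc (h'.1 k' (by simp))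
        have hk' : (k' : ℕ) = k + 1 := by omega
        obtain ⟨s, hs0, hs'⟩ := H.hp_adj hκ'
        obtain ⟨r, hr, hr'⟩ := H.J_red hκ
        have h3 := hs' (pp 1 * J (k ::ₘ κ)) _ (hom_p1 (H.hom _)) (by rw [hk']; exact htop2)
        rw [hp_p1, H.J_top hκ _ (by exact_mod_cast hlt), show (((k' : ℕ) : ℤ) - 1) = ((k : ℕ) : ℤ) by omega, hr', mul_zero, zero_add] at h3
        have hκκ : κ = κ' := by
          by_contra hne
          rw [map_smul, LinearMap.smul_apply, H.orth _ _ hne, smul_zero] at h3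
          exact mul_ne_zero hs0 h h3.symm
        subst hκκ
        rw [sP_cons _ _ hκ', sP_cons _ _ hκ, hk', wL, wL, Finset.prod_range_succ, cL, cL, c2, c2]
        push_cast; ring
      · have : k = k' := PNat.eq heq
        subst this
        obtain ⟨s, hs0, hs'⟩ := H.hp_adj hκ
        obtain ⟨r, hr, hr'⟩ := H.J_red hκ'
        have h3 := hs' _ _ hn htop
        rw [hp_nd, hr', map_smul, map_smul, LinearMap.smul_apply, smul_eq_mul] at h3
        have h4 : pair α (pp 1 * J κ) (J κ') ≠ 0 := by
          rw [pp_one_mul_nd, pair_symm]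
          intro h0
          rcases mul_eq_zero.1 h0 with h' | h'
          · exact H.hα h'
          · rw [h', mul_zero] at h3
            rw [pair_symm] at hD
            exact mul_ne_zero hs0 hD h3.symm
        have h5 := ih κ h4 (u - 1)
        have h6 := H.pieri_size h4
        rw [sP_cons _ _ hκ', sP_cons _ _ hκ, wL, wL, h5, cL, cL, sP_sum, sP_sum, h6]
        push_cast; ring

lemma linInd (H : JD α J) : LinearIndependent K J :=
  LinearMap.BilinForm.linearIndependent_of_iIsOrtho (B := pair α) (v := J)
    (fun _ _ h => H.orth _ _ h) (fun i h => H.aniso i h)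

/-- the Jack basis -/
def bas (H : JD α J) : Module.Basis JPartition K (Sy K) :=
  Module.Basis.mk H.linInd (fun f _ => H.span_top f)

lemma bas_apply (H : JD α J) (l : JPartition) : H.bas l = J l := by simp [bas]

/-- the diagonal operator -/
def Wop (H : JD α J) (u : K) : Module.End K (Sy K) := H.bas.constr K (fun l => wL α (sortedParts l) u • J l)

lemma Wop_J (H : JD α J) (u : K) (l : JPartition) : H.Wop u (J l) = wL α (sortedParts l) u • J l := by
  rw [← H.bas_apply, Wop, Module.Basis.constr_basis]; simp [bas_apply]

lemma ind_J (H : JD α J) {P : Sy K → Prop} (hJ : ∀ l, P (J l)) (h0 : P 0) (ha : ∀ f g, P f → P g → P (f + g)) (hs : ∀ (c : K) f, P f → P (c • f)) (f : Sy K) : P f := by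
  have := H.span_top f
  induction this using Submodule.span_induction with
  | mem x hx => obtain ⟨l, rfl⟩ := hx; exact hJ l
  | zero => exact h0
  | add x y _ _ hx hy => exact ha _ _ hx hy
  | smul a x _ hx => exact hs _ _ hx

lemma pair_Wop (H : JD α J) (u : K) (m : JPartition) (f : Sy K) : pair α (H.Wop u f) (J m) = wL α (sortedParts m) u * pair α f (J m) := by
  refine H.ind_J (P := fun f => pair α (H.Wop u f) (J m) = wL α (sortedParts m) u * pair α f (J m)) ?_ ?_ ?_ ?_ f
  · intro l
    rw [H.Wop_J, map_smul, LinearMap.smul_apply, smul_eq_mul]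
    by_cases e : l = m
    · rw [e]
    · rw [H.orth _ _ e, mul_zero, mul_zero]
  · simp
  · intro f g h h'; simp only [map_add, LinearMap.add_apply, h, h', mul_add]
  · intro c f h; simp only [map_smul, LinearMap.smul_apply, h, smul_eq_mul]; ring

lemma pair_lieD (H : JD α J) (A : Module.End K (Sy K)) (l m : JPartition) :
    pair α (⁅(DS α : Module.End K (Sy K)), A⁆ (J l)) (J m) = (cL α (sortedParts m) - cL α (sortedParts l)) * pair α (A (J l)) (J m) := by
  rw [Ring.lie_def, LinearMap.sub_apply, Module.End.mul_apply, Module.End.mul_apply, map_sub, LinearMap.sub_apply, pair_DS, H.DJ, H.DJ, map_smul, map_smul, map_smul, LinearMap.smul_apply, smul_eq_mul, smul_eq_mul]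
  ring

lemma W_q (H : JD α J) (u : K) : H.Wop u * (JS H.hα).q = (JS H.hα).Bu u 1 * H.Wop u := by
  apply LinearMap.ext
  intro f
  refine H.ind_J (P := fun f => (H.Wop u * (JS H.hα).q) f = ((JS H.hα).Bu u 1 * H.Wop u) f) ?_ ?_ ?_ ?_ f
  · intro l
    apply H.ext_pair
    intro m
    rw [Module.End.mul_apply, Module.End.mul_apply, H.pair_Wop, H.Wop_J, map_smul, map_smul, LinearMap.smul_apply, Sys.Bu_one, LinearMap.add_apply, map_add, LinearMap.add_apply]
    have h1 : pair α ((JS H.hα).E1 (J l)) (J m) = (cL α (sortedParts m) - cL α (sortedParts l)) * pair α ((JS H.hα).q (J l)) (J m) := H.pair_lieD _ l m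
    rw [h1, LinearMap.smul_apply, map_smul, LinearMap.smul_apply, smul_eq_mul, smul_eq_mul]
    by_cases e : pair α ((JS H.hα).q (J l)) (J m) = 0
    · rw [e]; ring
    · have h2 := H.pieri m l (by
        intro h0; apply e
        have : (JS H.hα).q (J l) = α⁻¹ • (pp 1 * J l) := rfl
        rw [this, map_smul, LinearMap.smul_apply, h0, smul_zero]) u
      rw [h2]; ring
  · simp
  · intro f g h h'; rw [map_add, map_add, h, h']
  · intro c f h; rw [map_smul, map_smul, h]

lemma W_E1 (H : JD α J) (u : K) : H.Wop u * (JS H.hα).E1 = (JS H.hα).Eu u * H.Wop u := by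
  apply LinearMap.ext
  intro f
  refine H.ind_J (P := fun f => (H.Wop u * (JS H.hα).E1) f = ((JS H.hα).Eu u * H.Wop u) f) ?_ ?_ ?_ ?_ f
  · intro l
    apply H.ext_pair
    intro m
    rw [Module.End.mul_apply, Module.End.mul_apply, H.pair_Wop, H.Wop_J, map_smul, map_smul, LinearMap.smul_apply, Sys.Eu, LinearMap.add_apply, map_add, LinearMap.add_apply]
    have h1 : pair α ((JS H.hα).E1 (J l)) (J m) = (cL α (sortedParts m) - cL α (sortedParts l)) * pair α ((JS H.hα).q (J l)) (J m) := H.pair_lieD _ l m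
    have h3 : pair α ((JS H.hα).E2 (J l)) (J m) = (cL α (sortedParts m) - cL α (sortedParts l)) * pair α ((JS H.hα).E1 (J l)) (J m) := H.pair_lieD _ l m
    rw [h3, LinearMap.smul_apply, map_smul, LinearMap.smul_apply, smul_eq_mul, smul_eq_mul, h1]
    by_cases e : pair α ((JS H.hα).q (J l)) (J m) = 0
    · rw [e]; ring
    · have h2 := H.pieri m l (by
        intro h0; apply e
        have : (JS H.hα).q (J l) = α⁻¹ • (pp 1 * J l) := rfl
        rw [this, map_smul, LinearMap.smul_apply, h0, smul_zero]) u
      rw [h2]; ring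
  · simp
  · intro f g h h'; rw [map_add, map_add, h, h']
  · intro c f h; rw [map_smul, map_smul, h]

lemma E1_pn {α : K} (hα : α ≠ 0) (n : ℕ) : ⁅(JS hα).E1, (α⁻¹ • mp n : Module.End K (Sy K))⁆ = (n : K) • (α⁻¹ • mp (n+1) : Module.End K (Sy K)) := by
  have h : ∀ n, (α⁻¹ • mp n : Module.End K (Sy K)) = (JS hα).cpr ((JS hα).w ^ n) := by
    intro n
    apply LinearMap.ext
    intro f
    rw [Sys.cpr_apply]
    have : (JS hα).Th (((JS hα).w ^ n) ((JS hα).io f)) = pp n * f := Th_wpow_io n f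
    rw [this]; rfl
  rw [h, h, ← Sys.Good.cpr_lie (JS hα).Good_E1, liePow_sq (a := (JS hα).E1h) (b := (JS hα).w) (by rw [Sys.lie_E1_w, sq]), ← Nat.cast_smul_eq_nsmul K, Sys.cpr_smul]

lemma W_pn (H : JD α J) (u : K) (n : ℕ) : H.Wop u * (α⁻¹ • mp (n+1) : Module.End K (Sy K)) = (JS H.hα).Bu u (n+1) * H.Wop u := by
  induction n with
  | zero => exact H.W_q u
  | succ n ih =>
    have h1 := E1_pn H.hα (n+1)
    have h2 := (JS H.hα).ladder u (n+1)
    have h3 : ((n+1 : ℕ) : K) ≠ 0 := by exact_mod_cast Nat.succ_ne_zero n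
    have h4 : ((n+1 : ℕ) : K) • (H.Wop u * (α⁻¹ • mp (n+1+1) : Module.End K (Sy K))) = ((n+1 : ℕ) : K) • ((JS H.hα).Bu u (n+1+1) * H.Wop u) := by
      rw [← mul_smul_comm, ← h1, ← smul_mul_assoc, ← h2, Ring.lie_def, Ring.lie_def, mul_sub, ← mul_assoc, ← mul_assoc, ih, H.W_E1, mul_assoc, ih, mul_assoc, H.W_E1, sub_mul, mul_assoc, mul_assoc]
    exact smul_right_injective _ h3 h4

/-- the deformed complete operators -/
def Ph {α : K} (hα : α ≠ 0) (u : K) (k : ℕ) : Module.End K (Sy K) := expo (K := K) (fun n => (JS hα).Bu u n) k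

lemma W_gop (H : JD α J) (u : K) (k : ℕ) : H.Wop u * gop α k = Ph H.hα u k * H.Wop u := by
  induction k using Nat.strong_induction_on with
  | _ k ih =>
  cases k with
  | zero => rw [gop, Ph, expo_zero, expo_zero, mul_one, one_mul]
  | succ k =>
    have h3 : ((k+1 : ℕ) : K) ≠ 0 := by exact_mod_cast Nat.succ_ne_zero k
    apply smul_right_injective _ h3
    show ((k+1 : ℕ) : K) • (H.Wop u * gop α (k+1)) = ((k+1 : ℕ) : K) • (Ph H.hα u (k+1) * H.Wop u)
    rw [← mul_smul_comm, ← smul_mul_assoc, gop, Ph, expo_succ, expo_succ, Finset.mul_sum, Finset.sum_mul]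
    apply Finset.sum_congr rfl
    intro n hn
    have := ih (k - n) (by omega)
    rw [gop, Ph] at this
    rw [← mul_assoc, H.W_pn, mul_assoc, this, mul_assoc]
end JD
end B7
end JK
end

open scoped Classical
noncomputable section
set_option linter.unusedSectionVars false
set_option linter.unusedSimpArgs false
namespace JK
open MvPolynomial
section B8
variable {K : Type} [Field K] [CharZero K]

namespace JD
variable {α : K} {J : JPartition → Sy K}

lemma wL_ne (H : JD α J) (k : ℕ) (l : List ℕ) : ∀ i : ℕ, (∀ j ∈ l, j ≤ k) → wL α l (-(α * k) - i) ≠ 0 := by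
  induction l with
  | nil => intro i _; simp [wL]
  | cons a l ih =>
    intro i h
    rw [wL]
    apply mul_ne_zero
    · rw [Finset.prod_ne_zero_iff]
      intro j hj h0
      have h1 := h a (by simp)
      have h2 := Finset.mem_range.1 hj
      have := H.hT ((j : ℤ) - k) (-i) (by push_cast; linear_combination h0)
      omega
    · have := ih (i+1) (fun j hj => h j (by simp [hj]))
      push_cast at this
      rw [sub_sub]; exact this

lemma wL_zero (α : K) (k a : ℕ) (l : List ℕ) (h : k < a) : wL α (a :: l) (-(α * k)) = 0 := by
  rw [wL, Finset.prod_eq_zero (Finset.mem_range.2 h) (by ring), zero_mul]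

lemma sP_le {κ : JPartition} {k : ℕ} (hκ : ∀ i ∈ κ, (i : ℕ) ≤ k) : ∀ j ∈ sortedParts κ, j ≤ k := by
  intro j hj
  have : j ∈ ((sortedParts κ : List ℕ) : Multiset ℕ) := hj
  rw [sP_coe, Multiset.mem_map] at this
  obtain ⟨i, hi, rfl⟩ := this
  exact hκ i hi

lemma pair_Ph (H : JD α J) {k : ℕ} {κ : JPartition} (hκ : ∀ i ∈ κ, (i : ℕ) ≤ k) (j : ℕ) (m : JPartition) :
    wL α (sortedParts κ) (-(α * k)) * pair α (Ph H.hα (-(α * k)) j (J κ)) (J m) =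
      wL α (sortedParts m) (-(α * k)) * pair α (J κ) (hp (j : ℤ) (J m)) := by
  rw [← pair_gop H.hα, ← H.pair_Wop]
  have := LinearMap.congr_fun (H.W_gop (-(α * k)) j) (J κ)
  rw [Module.End.mul_apply, Module.End.mul_apply, H.Wop_J, map_smul] at this
  rw [this, map_smul, LinearMap.smul_apply, smul_eq_mul]

lemma wL_ne' (H : JD α J) {k : ℕ} {κ : JPartition} (hκ : ∀ i ∈ κ, (i : ℕ) ≤ k) : wL α (sortedParts κ) (-(α * k)) ≠ 0 := by
  have := H.wL_ne k (sortedParts κ) 0 (sP_le hκ)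
  simpa using this

lemma Ph_J_zero (H : JD α J) {k : ℕ} {κ : JPartition} (hκ : ∀ i ∈ κ, (i : ℕ) ≤ k) {j : ℕ} (hj : k < j) :
    Ph H.hα (-(α * k)) j (J κ) = 0 := by
  apply H.ext_pair
  intro m
  rw [map_zero, LinearMap.zero_apply]
  have h1 := H.pair_Ph hκ j m
  have h2 : wL α (sortedParts m) (-(α * k)) * pair α (J κ) (hp (j : ℤ) (J m)) = 0 := by
    refine part_ind (P := fun m => wL α (sortedParts m) (-(α * k)) * pair α (J κ) (hp (j : ℤ) (J m)) = 0) ?_ ?_ m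
    · rw [H.J_zero, hp_one, if_neg (by omega)]; simp
    · intro k' μ hμ _
      by_cases h : k < k'
      · rw [sP_cons _ _ hμ, wL_zero _ _ _ _ h, zero_mul]
      · rw [H.J_top hμ _ (by omega)]; simp
  rw [h2] at h1
  exact (mul_eq_zero.1 h1).resolve_left (H.wL_ne' hκ)

lemma Ph_J_top (H : JD α J) {k : ℕ+} {κ : JPartition} (hκ : ∀ i ∈ κ, i ≤ k) :
    ∃ c : K, Ph H.hα (-(α * (k : ℕ))) k (J κ) = c • J (k ::ₘ κ) := by
  refine ⟨_, H.prop_of ?_⟩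
  intro m
  have h1 := H.pair_Ph (k := k) (κ := κ) (fun i hi => hκ i hi) k m
  have hne := H.wL_ne' (k := k) (κ := κ) (fun i hi => hκ i hi)
  refine part_ind (P := fun m => (wL α (sortedParts κ) (-(α * (k : ℕ))) * pair α (Ph H.hα (-(α * (k : ℕ))) k (J κ)) (J m) =
      wL α (sortedParts m) (-(α * (k : ℕ))) * pair α (J κ) (hp ((k : ℕ) : ℤ) (J m))) → m ≠ k ::ₘ κ → pair α (Ph H.hα (-(α * (k : ℕ))) k (J κ)) (J m) = 0) ?_ ?_ m h1
  · intro h _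
    rw [H.J_zero, hp_one, if_neg (by have := k.pos; omega), map_zero, mul_zero] at h
    rw [H.J_zero]
    exact (mul_eq_zero.1 h).resolve_left hne
  · intro k' μ hμ _ h hm
    refine (mul_eq_zero.1 (h.trans ?_)).resolve_left hne
    rcases lt_trichotomy (k : ℕ) k' with h2 | h2 | h2
    · rw [sP_cons _ _ hμ, wL_zero _ _ _ _ h2, zero_mul]
    · have : k = k' := PNat.eq h2
      subst this
      obtain ⟨r, _, hr⟩ := H.J_red hμ
      rw [hr, map_smul, H.orth, smul_zero, mul_zero]
      rintro rfl; exact hm rfl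
    · rw [H.J_top hμ _ (by exact_mod_cast h2)]; simp
end JD

open JD
set_option maxHeartbeats 1600000 in
/-- commutator with the derivative -/
lemma dS1_Ph {α : K} (hα : α ≠ 0) (u : K) (k : ℕ) : ∀ f : Sy K,
    dS1 (Ph hα u (k+1) f) = Ph hα u (k+1) (dS1 f) + ((k : K) + u * α⁻¹) • Ph hα u k f := by
  have hrec : ∀ (k : ℕ) (f : Sy K), ((k+1 : ℕ) : K) • Ph hα u (k+1) f = ∑ n ∈ Finset.range (k+1), (JS hα).Bu u (n+1) (Ph hα u (k-n) f) := by
    intro k f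
    have := LinearMap.congr_fun (expo_succ (K := K) (fun n => (JS hα).Bu u n) k) f
    rw [LinearMap.smul_apply] at this
    rw [Ph, this, LinearMap.sum_apply]; rfl
  have h0 : ∀ f : Sy K, Ph hα u 0 f = f := by intro f; rw [Ph, expo_zero]; rfl
  have hB : ∀ n f, dS1 ((JS hα).Bu u (n+1) f) = (JS hα).Bu u (n+1) (dS1 f) + (if n = 0 then (u * α⁻¹) • f else ((n : K) + 1) • (JS hα).Bu u n f) :=
    fun n f => (JS hα).ds_Bu u n f
  induction k using Nat.strong_induction_on with
  | _ k ih =>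
  intro f
  have h3 : ((k+1 : ℕ) : K) ≠ 0 := by exact_mod_cast Nat.succ_ne_zero k
  apply smul_right_injective _ h3
  show ((k+1 : ℕ) : K) • dS1 (Ph hα u (k+1) f) = ((k+1 : ℕ) : K) • (Ph hα u (k+1) (dS1 f) + ((k : K) + u * α⁻¹) • Ph hα u k f)
  rw [smul_add, hrec, ← map_smul, hrec, map_sum]
  simp only [hB, Finset.sum_add_distrib]
  cases k with
  | zero =>
    simp only [Finset.sum_range_one, zero_add, if_true, h0]
    simp
  | succ k =>
    have e1 : ∑ n ∈ Finset.range (k+1+1), (JS hα).Bu u (n+1) (dS1 (Ph hα u (k+1-n) f)) =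
        ∑ n ∈ Finset.range (k+1+1), (JS hα).Bu u (n+1) (Ph hα u (k+1-n) (dS1 f)) +
        ∑ n ∈ Finset.range (k+1), ((k : K) - n + u * α⁻¹) • (JS hα).Bu u (n+1) (Ph hα u (k-n) f) := by
      rw [Finset.sum_range_succ, Finset.sum_range_succ _ (k+1)]
      rw [Nat.sub_self, h0, h0]
      have : ∀ n ∈ Finset.range (k+1), (JS hα).Bu u (n+1) (dS1 (Ph hα u (k+1-n) f)) = (JS hα).Bu u (n+1) (Ph hα u (k+1-n) (dS1 f)) + ((k : K) - n + u * α⁻¹) • (JS hα).Bu u (n+1) (Ph hα u (k-n) f) := by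
        intro n hn
        have hn := Finset.mem_range.1 hn
        rw [show k + 1 - n = (k - n) + 1 by omega, ih (k-n) (by omega), map_add, map_smul, Nat.cast_sub (by omega)]
      rw [Finset.sum_congr rfl this, Finset.sum_add_distrib]; abel
    have e2 : ∑ n ∈ Finset.range (k+1+1), (if n = 0 then (u * α⁻¹) • Ph hα u (k+1-n) f else ((n : K) + 1) • (JS hα).Bu u n (Ph hα u (k+1-n) f)) =
        ∑ n ∈ Finset.range (k+1), ((n : K) + 2) • (JS hα).Bu u (n+1) (Ph hα u (k-n) f) + (u * α⁻¹) • Ph hα u (k+1) f := by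
      rw [Finset.sum_range_succ', if_pos rfl, Nat.sub_zero]
      congr 1
      apply Finset.sum_congr rfl
      intro n hn
      rw [if_neg (by omega), show k + 1 - (n+1) = k - n by omega]
      push_cast; congr 1; ring
    have e3 : ∑ n ∈ Finset.range (k+1), ((n : K) + 2) • (JS hα).Bu u (n+1) (Ph hα u (k-n) f) + ∑ n ∈ Finset.range (k+1), ((k : K) - n + u * α⁻¹) • (JS hα).Bu u (n+1) (Ph hα u (k-n) f) = ((k : K) + 2 + u * α⁻¹) • ((k+1 : ℕ) : K) • Ph hα u (k+1) f := by
      rw [hrec, Finset.smul_sum, ← Finset.sum_add_distrib]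
      apply Finset.sum_congr rfl
      intro n _
      rw [← add_smul]; congr 1; ring
    rw [e1, e2]
    refine (add_assoc _ _ _).trans ?_
    refine congrArg₂ (· + ·) rfl ?_
    rw [← add_assoc, add_comm (∑ n ∈ Finset.range (k+1), ((k : K) - n + u * α⁻¹) • (JS hα).Bu u (n+1) (Ph hα u (k-n) f)), e3, smul_smul, smul_smul, ← add_smul]
    congr 1
    push_cast; ring

lemma eS_Ph {α : K} (hα : α ≠ 0) (u : K) (k : ℕ) : ∀ f : Sy K,
    eS (Ph hα u k f) = Ph hα u k (eS f) + (k : K) • Ph hα u k f := by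
  have hrec : ∀ (k : ℕ) (f : Sy K), ((k+1 : ℕ) : K) • Ph hα u (k+1) f = ∑ n ∈ Finset.range (k+1), (JS hα).Bu u (n+1) (Ph hα u (k-n) f) := by
    intro k f
    have := LinearMap.congr_fun (expo_succ (K := K) (fun n => (JS hα).Bu u n) k) f
    rw [LinearMap.smul_apply] at this
    rw [Ph, this, LinearMap.sum_apply]; rfl
  have h0 : ∀ f : Sy K, Ph hα u 0 f = f := by intro f; rw [Ph, expo_zero]; rfl
  have hB : ∀ n f, eS ((JS hα).Bu u n f) = (JS hα).Bu u n (eS f) + (n : K) • (JS hα).Bu u n f := by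
    intro n f
    rw [(JS hα).Bu_eq u n (n+1) (Nat.lt_succ_self n), LinearMap.sum_apply, LinearMap.sum_apply, map_sum, Finset.smul_sum, ← Finset.sum_add_distrib]
    apply Finset.sum_congr rfl
    intro l _
    have : eS ((JS hα).BB n l f) = (JS hα).BB n l (eS f) + (n : K) • (JS hα).BB n l f := (JS hα).ed_BB n l f
    rw [LinearMap.smul_apply, LinearMap.smul_apply, map_smul, this, smul_add, smul_comm]
  induction k using Nat.strong_induction_on with
  | _ k ih =>
  intro f
  cases k with
  | zero => simp [h0]
  | succ k =>
    have h3 : ((k+1 : ℕ) : K) ≠ 0 := by exact_mod_cast Nat.succ_ne_zero k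
    apply smul_right_injective _ h3
    show ((k+1 : ℕ) : K) • eS (Ph hα u (k+1) f) = ((k+1 : ℕ) : K) • (Ph hα u (k+1) (eS f) + ((k+1 : ℕ) : K) • Ph hα u (k+1) f)
    rw [smul_add, ← map_smul, hrec, hrec, map_sum, Finset.smul_sum, ← Finset.sum_add_distrib]
    apply Finset.sum_congr rfl
    intro n hn
    have hn := Finset.mem_range.1 hn
    rw [hB, ih (k-n) (by omega), map_add, map_smul, add_assoc, ← add_smul, Nat.cast_sub (by omega)]
    push_cast; congr 2; ring

/-- generating families -/
def Qf {α : K} (hα : α ≠ 0) : List ℕ → ℕ → Sy K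
  | [], d => if d = 0 then 1 else 0
  | k :: l, d => ∑ j ∈ Finset.range (d+1), Ph hα (-(α * k)) j (Qf hα l (d - j))

lemma Ph_zero {α : K} (hα : α ≠ 0) (u : K) (f : Sy K) : Ph hα u 0 f = f := by rw [Ph, expo_zero]; rfl

lemma Qf_zero {α : K} (hα : α ≠ 0) (l : List ℕ) : Qf hα l 0 = 1 := by
  induction l with
  | nil => rfl
  | cons k l ih => rw [Qf, Finset.sum_range_one, ih, Ph_zero]

lemma Qf_dS1 {α : K} (hα : α ≠ 0) (l : List ℕ) : ∀ d, dS1 (Qf hα l (d+1)) = ((d : K) - l.sum) • Qf hα l d := by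
  have d1 : dS1 (1 : Sy K) = 0 := by rw [dS1_nd, nd_one]
  induction l with
  | nil =>
    intro d
    rw [Qf, if_neg (by omega), map_zero, Qf]
    by_cases h : d = 0
    · subst h; simp
    · simp [h]
  | cons k l ih =>
    intro d
    rw [Qf, Finset.sum_range_succ', map_add, Ph_zero, Nat.sub_zero, ih, map_sum]
    have h1 : ∀ j ∈ Finset.range (d+1), dS1 (Ph hα (-(α * k)) (j+1) (Qf hα l (d+1-(j+1)))) =
        Ph hα (-(α * k)) (j+1) (dS1 (Qf hα l (d - j))) + ((j : K) - k) • Ph hα (-(α * k)) j (Qf hα l (d - j)) := by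
      intro j _
      rw [dS1_Ph, show d + 1 - (j+1) = d - j by omega]
      congr 2
      field_simp; ring
    rw [Finset.sum_congr rfl h1, Finset.sum_add_distrib, Finset.sum_range_succ, Nat.sub_self, Qf_zero, d1, map_zero, add_zero]
    have h2 : ∑ j ∈ Finset.range d, Ph hα (-(α * k)) (j+1) (dS1 (Qf hα l (d - j))) + ((d : K) - l.sum) • Qf hα l d =
        ∑ j ∈ Finset.range (d+1), ((d : K) - j - l.sum) • Ph hα (-(α * k)) j (Qf hα l (d - j)) := by
      rw [Finset.sum_range_succ', Ph_zero, Nat.sub_zero, Nat.cast_zero, sub_zero]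
      congr 1
      apply Finset.sum_congr rfl
      intro j hj
      have hj := Finset.mem_range.1 hj
      rw [show d - j = (d - (j+1)) + 1 by omega, ih, map_smul, Nat.cast_sub (by omega)]
    rw [add_right_comm, h2, ← Finset.sum_add_distrib, Qf, Finset.smul_sum]
    apply Finset.sum_congr rfl
    intro j _
    rw [← add_smul, List.sum_cons]; push_cast; congr 1; ring

lemma Qf_hom {α : K} (hα : α ≠ 0) (l : List ℕ) : ∀ d, eS (Qf hα l d) = (d : K) • Qf hα l d := by
  induction l with
  | nil =>
    intro d
    rw [Qf]
    by_cases h : d = 0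
    · subst h; simp [eS_one]
    · simp [h]
  | cons k l ih =>
    intro d
    rw [Qf, map_sum, Finset.smul_sum]
    apply Finset.sum_congr rfl
    intro j hj
    have hj := Finset.mem_range.1 hj
    rw [eS_Ph, ih, map_smul, ← add_smul, Nat.cast_sub (by omega), sub_add_cancel]

lemma coeff_dS1 (i : ℕ) : ∀ (f : Sy K) (x : ℕ+ →₀ ℕ), coeff x ((dS1 ^ i) f) =
    ((Nat.factorial i * Nat.choose (i + x 1) (x 1) : ℕ) : K) * coeff (x + Finsupp.single 1 i) f := by
  induction i with
  | zero => intro f x; simp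
  | succ i ih =>
    intro f x
    rw [pow_succ', Module.End.mul_apply]
    have : ∀ g : Sy K, coeff x (dS1 g) = coeff (x + Finsupp.single 1 1) g * (x 1 + 1) := fun g => coeff_pderiv _ _
    rw [this, ih, Finsupp.add_apply, Finsupp.single_eq_same, add_assoc x, ← Finsupp.single_add, add_comm 1 i]
    have h : Nat.factorial i * Nat.choose (i + (x 1 + 1)) (x 1 + 1) * (x 1 + 1) = Nat.factorial (i+1) * Nat.choose (i + 1 + x 1) (x 1) := by
      have h1 := Nat.add_choose_mul_factorial_mul_factorial i (x 1 + 1)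
      have h2 := Nat.add_choose_mul_factorial_mul_factorial (i+1) (x 1)
      rw [show i + (x 1 + 1) = i + 1 + x 1 by ring] at h1 ⊢
      rw [← h2, Nat.factorial_succ (x 1)] at h1
      have := Nat.factorial_pos (x 1)
      apply Nat.eq_of_mul_eq_mul_right this
      linarith
    rw [← h]; push_cast; ring

namespace JD
variable {α : K} {J : JPartition → Sy K}

lemma Qf_iter {α : K} (hα : α ≠ 0) (l : List ℕ) (i : ℕ) : ∀ d, d + i = l.sum → (dS1 ^ i) (Qf hα l l.sum) = ((-1 : K) ^ i * (Nat.factorial i : K)) • Qf hα l d := by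
  induction i with
  | zero => intro d hd; simp at hd; simp [hd]
  | succ i ih =>
    intro d hd
    rw [pow_succ', Module.End.mul_apply, ih (d+1) (by omega), map_smul, Qf_dS1, smul_smul, Nat.factorial_succ, ← hd]
    congr 1; push_cast; ring

lemma Qf_J (H : JD α J) (l : JPartition) : (∀ d, psize l < d → Qf H.hα (sortedParts l) d = 0) ∧
    ∃ c : K, Qf H.hα (sortedParts l) (psize l) = c • J l := by
  refine part_ind (P := fun l => (∀ d, psize l < d → Qf H.hα (sortedParts l) d = 0) ∧
    ∃ c : K, Qf H.hα (sortedParts l) (psize l) = c • J l) ?_ ?_ l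
  · rw [psize_zero, sP_zero, H.J_zero]
    exact ⟨fun d hd => by rw [Qf, if_neg (by omega)], 1, by simp [Qf]⟩
  · rintro k κ hκ ⟨h1, c, hc⟩
    -- vanishing of skewings of the lower family
    have htop : ∀ j : ℤ, ((k : ℕ) : ℤ) < j → hp j (J κ) = 0 := by
      refine part_ind (P := fun κ => (∀ i ∈ κ, i ≤ k) → ∀ j : ℤ, ((k : ℕ) : ℤ) < j → hp j (J κ) = 0) ?_ ?_ κ hκ
      · intro _ j hj; rw [H.J_zero, hp_one, if_neg (by omega)]
      · intro k' κ' hκ' _ hk j hj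
        have : (k' : ℕ) ≤ k := hk k' (by simp)
        exact H.J_top hκ' j (by omega)
    have hU : ∀ i d, d + i = psize κ → ∀ j : ℤ, ((k : ℕ) : ℤ) < j → hp j (Qf H.hα (sortedParts κ) d) = 0 := by
      intro i
      induction i with
      | zero =>
        intro d hd j hj
        rw [add_zero] at hd
        rw [hd, hc, map_smul, htop j hj, smul_zero]
      | succ i ih =>
        intro d hd j hj
        have e := Qf_dS1 H.hα (sortedParts κ) d
        have h2 := ih (d+1) (by omega) j hj
        have h3 : hp j (dS1 (Qf H.hα (sortedParts κ) (d+1))) = 0 := by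
          rw [dS1_nd, hp_nd, h2, map_zero]
        rw [e, map_smul] at h3
        refine (smul_eq_zero.1 h3).resolve_left ?_
        rw [sP_sum, ← hd]; push_cast
        have : ((i + 1 : ℕ) : K) ≠ 0 := by exact_mod_cast Nat.succ_ne_zero i
        intro h0; apply this; push_cast; linear_combination -h0
    have hz : ∀ d j : ℕ, (k : ℕ) < j → Ph H.hα (-(α * (k : ℕ))) j (Qf H.hα (sortedParts κ) d) = 0 := by
      intro d j hj
      by_cases hd : psize κ < d
      · rw [h1 d hd, map_zero]
      · have hs := H.span_le k (Qf_hom H.hα (sortedParts κ) d) (hU (psize κ - d) d (by omega))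
        generalize Qf H.hα (sortedParts κ) d = q at hs
        induction hs using Submodule.span_induction with
        | mem x hx => obtain ⟨m, hm, rfl⟩ := hx; exact H.Ph_J_zero hm.1 hj
        | zero => simp
        | add x y _ _ hx hy => rw [map_add, hx, hy, add_zero]
        | smul a x _ hx => rw [map_smul, hx, smul_zero]
    rw [sP_cons k κ hκ, psize_cons]
    constructor
    · intro d hd
      rw [Qf, Finset.sum_eq_zero]
      intro j hj
      by_cases h : (k : ℕ) < j
      · exact hz _ _ h
      · rw [h1 _ (by omega), map_zero]
    · obtain ⟨c', hc'⟩ := H.Ph_J_top hκ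
      refine ⟨c * c', ?_⟩
      rw [Qf, Finset.sum_eq_single (k : ℕ)]
      · rw [show (k : ℕ) + psize κ - k = psize κ by omega, hc, map_smul, hc', smul_smul]
      · intro j hj hne
        by_cases h : (k : ℕ) < j
        · exact hz _ _ h
        · rw [h1 _ (by omega), map_zero]
      · intro h; exfalso; apply h; rw [Finset.mem_range]; omega

/-- the key formula -/
lemma Qf_coeff (H : JD α J) (l : JPartition) (i d : ℕ) (hd : d + i = psize l) (x : ℕ+ →₀ ℕ) :
    coeff x (Qf H.hα (sortedParts l) d) = (-1 : K) ^ d * ((Nat.choose (i + x 1) (x 1) : ℕ) : K) * coeff (x + Finsupp.single 1 i) (J l) := by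
  obtain ⟨-, c, hc⟩ := H.Qf_J l
  have key : ∀ i d, d + i = psize l → ∀ x : ℕ+ →₀ ℕ, (-1 : K) ^ i * coeff x (Qf H.hα (sortedParts l) d) =
      c * (((Nat.choose (i + x 1) (x 1) : ℕ) : K) * coeff (x + Finsupp.single 1 i) (J l)) := by
    intro i d hd x
    have h1 := Qf_iter H.hα (sortedParts l) i d (by rw [sP_sum, hd])
    rw [sP_sum, hc, map_smul] at h1
    have h2 := congrArg (coeff x) h1
    rw [coeff_smul, coeff_smul, coeff_dS1, smul_eq_mul, smul_eq_mul] at h2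
    have h3 : (Nat.factorial i : K) ≠ 0 := by exact_mod_cast Nat.factorial_ne_zero i
    apply mul_left_cancel₀ h3
    push_cast at h2
    linear_combination -h2
  have hc1 : c = (-1 : K) ^ (psize l) := by
    have h1 := key (psize l) 0 (by simp) 0
    rw [Qf_zero, coeff_zero_one, zero_add, H.norm] at h1
    simp at h1
    exact h1.symm
  have h1 := key i d hd x
  rw [hc1, ← hd, pow_add] at h1
  have h2 : ((-1 : K) ^ i) ≠ 0 := pow_ne_zero _ (by norm_num)
  apply mul_left_cancel₀ h2
  rw [h1]; ring
end JD
end B8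
end JK
end

open scoped Classical
noncomputable section
set_option linter.unusedSectionVars false
set_option linter.unusedSimpArgs false
namespace JK
open MvPolynomial
section B9

lemma exists_trans : ∃ t : ℝ, 0 < t ∧ Transcendental ℚ t := by
  have h : Transcendental ℤ (liouvilleNumber (2 : ℕ)) := transcendental_liouvilleNumber le_rfl
  have h' : Transcendental ℚ (liouvilleNumber (2 : ℕ)) := by
    intro h1
    exact h ((IsFractionRing.isAlgebraic_iff ℤ ℚ ℝ).2 h1)
  rcases lt_trichotomy (liouvilleNumber (2 : ℕ)) 0 with h0 | h0 | h0
  · refine ⟨-liouvilleNumber (2 : ℕ), by linarith, ?_⟩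
    intro h1; exact h' (by simpa using h1.neg)
  · exfalso; apply h'; rw [h0]; exact isAlgebraic_zero
  · exact ⟨_, h0, h'⟩

lemma exists_emb : ∃ φ : F →+* ℝ, 0 < φ alpha := by
  obtain ⟨t, ht, htr⟩ := exists_trans
  have hinj : Function.Injective (Polynomial.aeval t : Polynomial ℚ →ₐ[ℚ] ℝ) :=
    transcendental_iff_injective.1 htr
  refine ⟨RatFunc.liftRingHom (Polynomial.aeval t : Polynomial ℚ →ₐ[ℚ] ℝ).toRingHom ?_, ?_⟩
  · intro p hp
    rw [Submonoid.mem_comap, mem_nonZeroDivisors_iff_ne_zero]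
    have := nonZeroDivisors.ne_zero hp
    intro h; apply this; apply hinj; rw [map_zero]; exact h
  · rw [alpha, RatFunc.liftRingHom_X]
    show 0 < Polynomial.aeval t Polynomial.X
    rw [Polynomial.aeval_X]; exact ht

lemma zalpha_eq (m : Exp) : zalpha m = zK alpha m := by
  rw [zalpha, zK, Finsupp.prod, Finsupp.prod, Finsupp.sum, map_prod, ← Finset.prod_pow_eq_pow_sum, ← Finset.prod_mul_distrib]
  apply Finset.prod_congr rfl
  intro i _
  rw [map_mul, map_pow, map_natCast, map_natCast, mul_pow]; ring

lemma hall_eq (f g : SymA) : hall f g = pair alpha f g := by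
  conv_rhs => rw [f.as_sum, map_sum, LinearMap.sum_apply]
  rw [hall]
  apply Finset.sum_congr rfl
  intro m _
  rw [pair_monomial, zalpha_eq]; ring

lemma hall_aniso (f : SymA) (hf : f ≠ 0) : hall f f ≠ 0 := by
  obtain ⟨φ, hφ⟩ := exists_emb
  intro h
  have h1 := congrArg φ h
  rw [hall, map_sum, map_zero] at h1
  have hz : ∀ m : Exp, 0 < φ (zalpha m) := by
    intro m
    rw [zalpha_eq, zK, Finsupp.prod, map_prod]
    apply Finset.prod_pos
    intro i _
    rw [map_mul, map_pow, map_mul, map_natCast, map_natCast]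
    have := i.pos
    positivity
  have h2 : 0 < ∑ m ∈ f.support, φ (coeff m f * coeff m f * zalpha m) := by
    apply Finset.sum_pos
    · intro m hm
      rw [map_mul, map_mul]
      have : φ (coeff m f) ≠ 0 := by
        rw [map_ne_zero]; exact mem_support_iff.1 hm
      have := mul_self_pos.2 this
      exact mul_pos this (hz m)
    · exact support_nonempty.2 hf
  linarith

lemma alpha_hT (a b : ℤ) (h : alpha * a + b = 0) : a = 0 ∧ b = 0 := by
  have h1 : algebraMap (Polynomial ℚ) (RatFunc ℚ) (Polynomial.X * Polynomial.C (a : ℚ) + Polynomial.C (b : ℚ)) = 0 := by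
    rw [map_add, map_mul, RatFunc.algebraMap_X]
    rw [show (Polynomial.C (a : ℚ)) = ((a : ℤ) : Polynomial ℚ) by simp, show (Polynomial.C (b : ℚ)) = ((b : ℤ) : Polynomial ℚ) by simp, map_intCast, map_intCast]
    exact h
  rw [map_eq_zero_iff _ (RatFunc.algebraMap_injective ℚ)] at h1
  have h2 := congrArg (fun p => Polynomial.coeff p 0) h1
  have h3 := congrArg (fun p => Polynomial.coeff p 1) h1
  simp only [Polynomial.coeff_add, Polynomial.coeff_X_mul_zero, Polynomial.coeff_C_zero, Polynomial.coeff_zero, zero_add] at h2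
  simp only [Polynomial.coeff_add, Polynomial.coeff_mul_C, Polynomial.coeff_X_one, Polynomial.coeff_C_succ, Polynomial.coeff_zero, one_mul, add_zero] at h3
  exact ⟨by exact_mod_cast h3, by exact_mod_cast h2⟩

lemma JD_of {J : JPartition → SymA} (hJ : IsJackFamily J) : JD alpha J where
  hT := alpha_hT
  orth l m h := by rw [← hall_eq]; exact hJ.orthogonal l m h
  aniso l := by
    rw [← hall_eq]; apply hall_aniso
    intro h
    have := hJ.normalized l
    rw [h] at this; simp at this
  tri l m h := by
    rw [← evalN_ML (psize l + psize m + plen m) (sortedParts m) (by rw [sP_len]; omega)]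
    exact hJ.triangular l m h
  norm := hJ.normalized

lemma toExp_apply (m : JPartition) (i : ℕ+) : toExp m i = m.count i := by
  rw [toExp, Finsupp.finsetSum_apply]
  simp only [Finsupp.single_apply]
  rw [Finset.sum_ite_eq']
  split_ifs with h
  · rfl
  · rw [Multiset.mem_toFinset] at h
    exact (Multiset.count_eq_zero.2 h).symm

lemma theta_eq {J : JPartition → SymA} (hJ : IsJackFamily J) (mu lam : JPartition) :
    theta J mu lam = (-1 : F) ^ psize mu * coeff (toExp mu) (Qf alpha_ne (sortedParts lam) (psize mu)) := by
  have H := JD_of hJ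
  rw [theta]
  split_ifs with h
  · have := (H.Qf_J lam).1 _ h
    rw [this]; simp
  · have := H.Qf_coeff lam (psize lam - psize mu) (psize mu) (by omega) (toExp mu)
    rw [this, ← mul_assoc, ← mul_assoc, ← mul_pow]
    simp only [mul_neg, mul_one, neg_neg, one_pow, one_mul]
    have e : toExp (addOnes mu (psize lam - psize mu)) = toExp mu + Finsupp.single 1 (psize lam - psize mu) := by
      ext i
      rw [Finsupp.add_apply, toExp_apply, toExp_apply, addOnes, Multiset.count_add, Multiset.count_replicate, Finsupp.single_apply]
    rw [e, toExp_apply]; rfl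
end B9
end JK
end

open scoped Classical
noncomputable section
set_option linter.unusedSectionVars false
set_option linter.unusedSimpArgs false
namespace JK
open MvPolynomial
section C1
variable {K : Type} [Field K] [CharZero K]

/-- operator-valued power series -/
abbrev RR (K : Type) [Field K] : Type := PowerSeries (Module.End K (Sy K))

/-- action of operator-valued series on families -/
def act (x : RR K) : (ℕ → Sy K) →ₗ[K] (ℕ → Sy K) where
  toFun h d := ∑ p ∈ Finset.HasAntidiagonal.antidiagonal d, (PowerSeries.coeff p.1 x) (h p.2)
  map_add' h h' := by funext d; simp [Finset.sum_add_distrib]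
  map_smul' c h := by funext d; simp [Finset.smul_sum]

lemma act_apply (x : RR K) (h : ℕ → Sy K) (d : ℕ) :
    act x h d = ∑ p ∈ Finset.HasAntidiagonal.antidiagonal d, (PowerSeries.coeff p.1 x) (h p.2) := rfl

lemma act_add (x y : RR K) (h : ℕ → Sy K) : act (x + y) h = act x h + act y h := by
  funext d
  simp only [act_apply, Pi.add_apply, map_add, LinearMap.add_apply, Finset.sum_add_distrib]

lemma act_zero (h : ℕ → Sy K) : act (0 : RR K) h = 0 := by
  funext d
  simp [act_apply]

lemma act_sum {ι : Type} (s : Finset ι) (x : ι → RR K) (h : ℕ → Sy K) : act (∑ i ∈ s, x i) h = ∑ i ∈ s, act (x i) h := by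
  induction s using Finset.induction_on with
  | empty => simp [act_zero]
  | insert a s ha ih => rw [Finset.sum_insert ha, Finset.sum_insert ha, act_add, ih]

lemma act_smul (c : K) (x : RR K) (h : ℕ → Sy K) : act (c • x) h = c • act x h := by
  funext d
  simp only [act_apply, Pi.smul_apply, Finset.smul_sum]
  rfl

lemma act_mul (x y : RR K) (h : ℕ → Sy K) : act (x * y) h = act x (act y h) := by
  funext d
  simp only [act_apply, PowerSeries.coeff_mul, LinearMap.sum_apply, map_sum, Module.End.mul_apply]
  rw [Finset.sum_sigma', Finset.sum_sigma']
  apply Finset.sum_nbij' (fun ⟨⟨_, j⟩, ⟨k, l⟩⟩ => ⟨(k, l + j), (l, j)⟩)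
    (fun ⟨⟨i, _⟩, ⟨k, l⟩⟩ => ⟨(i + k, l), (i, k)⟩)
  · rintro ⟨⟨a, b⟩, ⟨c, e⟩⟩ hh
    simp only [Finset.mem_sigma, Finset.HasAntidiagonal.mem_antidiagonal] at hh ⊢
    exact ⟨by show c + (e + b) = d; omega, trivial⟩
  · rintro ⟨⟨a, b⟩, ⟨c, e⟩⟩ hh
    simp only [Finset.mem_sigma, Finset.HasAntidiagonal.mem_antidiagonal] at hh ⊢
    exact ⟨by show (a + c) + e = d; omega, trivial⟩
  · rintro ⟨⟨a, b⟩, ⟨c, e⟩⟩ hh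
    simp only [Finset.mem_sigma, Finset.HasAntidiagonal.mem_antidiagonal] at hh ⊢
    obtain ⟨h1, rfl⟩ := hh
    rfl
  · rintro ⟨⟨a, b⟩, ⟨c, e⟩⟩ hh
    simp only [Finset.mem_sigma, Finset.HasAntidiagonal.mem_antidiagonal] at hh ⊢
    obtain ⟨h1, rfl⟩ := hh
    rfl
  · rintro ⟨⟨a, b⟩, ⟨c, e⟩⟩ hh
    rfl

lemma act_one (h : ℕ → Sy K) : act (1 : RR K) h = h := by
  funext d
  rw [act_apply, Finset.sum_eq_single (0, d)]
  · simp
  · rintro ⟨i, j⟩ hp hne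
    rw [PowerSeries.coeff_one, if_neg, LinearMap.zero_apply]
    rintro rfl; apply hne; simp at hp; simp [hp]
  · intro h; simp at h

variable {α : K} (hα : α ≠ 0)

/-- the series of the operators -/
def cc (l : ℕ) : RR K := PowerSeries.mk fun n => (JS hα).Cn l n

lemma cc_lie (i j : ℕ) : cc hα i * cc hα j - cc hα j * cc hα i =
    (if i = 0 then ((j : K) + 1) • cc hα (j+1) else 0) - (if j = 0 then ((i : K) + 1) • cc hα (i+1) else 0) := by
  ext1 N
  have h := (JS hα).Cn_lie i j N
  rw [map_sub, map_sub, PowerSeries.coeff_mul, PowerSeries.coeff_mul, ← Finset.Nat.sum_antidiagonal_swap (n := N) (f := fun p => PowerSeries.coeff p.1 (cc hα j) * PowerSeries.coeff p.2 (cc hα i)), ← Finset.sum_sub_distrib,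
    Finset.Nat.sum_antidiagonal_eq_sum_range_succ_mk]
  have e : ∀ l n, PowerSeries.coeff n (cc hα l) = (JS hα).Cn l n := fun l n => PowerSeries.coeff_mk _ _
  have e2 : ∀ (c : K) l n, PowerSeries.coeff n (c • cc hα l) = c • (JS hα).Cn l n := fun c l n => by
    rw [← e]; rfl
  simp only [Prod.fst_swap, Prod.snd_swap, e, ← Ring.lie_def]
  rw [h]
  congr 1 <;> split_ifs <;> simp [e2]

lemma cc_comm {i j : ℕ} (hi : i ≠ 0) (hj : j ≠ 0) : cc hα i * cc hα j = cc hα j * cc hα i := by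
  have := cc_lie hα i j
  rw [if_neg hi, if_neg hj, sub_zero] at this
  exact sub_eq_zero.1 this

lemma cc_zero_lie (j : ℕ) (hj : j ≠ 0) : cc hα 0 * cc hα j = cc hα j * cc hα 0 + ((j : K) + 1) • cc hα (j+1) := by
  have := cc_lie hα 0 j
  rw [if_pos rfl, if_neg hj, sub_zero] at this
  rw [← this]; abel

/-- operator on families -/
def Ch (l : ℕ) : (ℕ → Sy K) →ₗ[K] (ℕ → Sy K) := act (cc hα l)

lemma Ch_apply (l : ℕ) (h : ℕ → Sy K) (d : ℕ) : Ch hα l h d = ∑ p ∈ Finset.HasAntidiagonal.antidiagonal d, (JS hα).Cn l p.1 (h p.2) := by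
  rw [Ch, act_apply]
  apply Finset.sum_congr rfl
  intro p _
  rw [cc, PowerSeries.coeff_mk]

lemma Ch_comm {i j : ℕ} (hi : i ≠ 0) (hj : j ≠ 0) (h : ℕ → Sy K) : Ch hα i (Ch hα j h) = Ch hα j (Ch hα i h) := by
  rw [Ch, Ch, ← act_mul, cc_comm hα hi hj, act_mul]

lemma Ch_zero_lie (j : ℕ) (hj : j ≠ 0) (h : ℕ → Sy K) : Ch hα 0 (Ch hα j h) = Ch hα j (Ch hα 0 h) + ((j : K) + 1) • Ch hα (j+1) h := by
  rw [Ch, Ch, ← act_mul, cc_zero_lie hα j hj, act_add, act_mul, act_smul]; rfl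

/-- the unit family -/
def oneF : ℕ → Sy K := fun d => if d = 0 then 1 else 0

lemma Cn_one (d : ℕ) : (JS hα).Cn 0 d 1 = 0 := by
  rw [Sys.Cn, LinearMap.smul_apply, BB_one, smul_zero]

lemma Ch_oneF (l d : ℕ) : Ch hα l oneF d = (JS hα).Cn l d 1 := by
  rw [Ch_apply, Finset.sum_eq_single (d, 0)]
  · simp [oneF]
  · rintro ⟨i, j⟩ hp hne
    rw [oneF, if_neg, map_zero]
    rintro rfl; apply hne; simp at hp; simp [hp]
  · intro h; simp at h

lemma Ch_zero_one : Ch hα 0 oneF = 0 := by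
  funext d
  rw [Ch_oneF, Cn_one]; rfl

instance chLC : LeftCommutative (fun (k : ℕ+) (h : ℕ → Sy K) => Ch hα (k : ℕ) h) :=
  ⟨fun i j h => Ch_comm hα i.pos.ne' j.pos.ne' h⟩

/-- value on monomials -/
def Emon (m : Multiset ℕ+) : ℕ → Sy K := m.foldr (fun (k : ℕ+) (h : ℕ → Sy K) => Ch hα (k : ℕ) h) oneF

lemma Emon_zero : Emon hα 0 = oneF := rfl
lemma Emon_cons (k : ℕ+) (m : Multiset ℕ+) : Emon hα (k ::ₘ m) = Ch hα k (Emon hα m) := by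
  rw [Emon, Multiset.foldr_cons]; rfl

/-- evaluation map -/
def EE : Sy K →ₗ[K] (ℕ → Sy K) := (basisMonomials ℕ+ K).constr K (fun m => Emon hα (Finsupp.toMultiset m))

lemma EE_mon (m : ℕ+ →₀ ℕ) : EE hα (monomial m 1) = Emon hα (Finsupp.toMultiset m) := by
  have : (monomial m 1 : Sy K) = basisMonomials ℕ+ K m := by simp
  rw [this, EE, Module.Basis.constr_basis]

lemma EE_one : EE hα 1 = oneF := by
  have := EE_mon hα 0
  simpa [Emon_zero] using this

lemma EE_X (k : ℕ+) (f : Sy K) : EE hα (X k * f) = Ch hα k (EE hα f) := by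
  have : (EE hα).comp (LinearMap.mulLeft K (X k)) = (Ch hα (k : ℕ)).comp (EE hα) := by
    apply (basisMonomials ℕ+ K).ext
    intro m
    rw [LinearMap.comp_apply, LinearMap.comp_apply, coe_basisMonomials, LinearMap.mulLeft_apply, EE_mon]
    rw [X, monomial_mul, one_mul, EE_mon, map_add, Finsupp.toMultiset_single, one_smul, Multiset.singleton_add, Emon_cons]
  exact LinearMap.congr_fun this f

/-- the derivation corresponding to the zeroth operator -/
def del : Derivation K (Sy K) (Sy K) := mkDerivation K (fun k : ℕ+ => (((k : ℕ) : K) + 1) • X (k + 1))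

lemma EE_del (f : Sy K) : EE hα (del f) = Ch hα 0 (EE hα f) := by
  induction f using MvPolynomial.induction_on with
  | C a => rw [← algebraMap_eq, Derivation.map_algebraMap, map_zero, algebraMap_eq, ← mul_one (C a), ← smul_eq_C_mul, map_smul, EE_one, map_smul, Ch_zero_one, smul_zero]
  | add f g hf hg => rw [map_add, map_add, hf, hg, map_add, map_add]
  | mul_X f k hf =>
    rw [mul_comm, Derivation.leibniz, EE_X, Ch_zero_lie hα _ k.pos.ne', map_add, smul_eq_mul, EE_X, hf, smul_eq_mul]
    congr 1
    rw [del, mkDerivation_X, mul_smul_comm, map_smul, mul_comm, EE_X]; rfl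
end C1
end JK
end

open scoped Classical
noncomputable section
set_option linter.unusedSectionVars false
set_option linter.unusedSimpArgs false
namespace JK
open MvPolynomial
section C2
variable {K : Type} [Field K] [CharZero K]

section Exp
variable {A : Type} [Ring A] [Algebra K A]
/-- Euler operator on power series -/
def eul (x : PowerSeries A) : PowerSeries A := PowerSeries.mk fun n => (n : K) • PowerSeries.coeff n x

lemma coeff_eul (n : ℕ) (x : PowerSeries A) : PowerSeries.coeff n (eul (K := K) x) = (n : K) • PowerSeries.coeff n x := by
  rw [eul, PowerSeries.coeff_mk]

lemma ps_coeff_smul (n : ℕ) (c : K) (x : PowerSeries A) : PowerSeries.coeff n (c • x) = c • PowerSeries.coeff n x := rfl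

lemma eul_mul (x y : PowerSeries A) : eul (K := K) (x * y) = eul (K := K) x * y + x * eul (K := K) y := by
  ext n
  rw [coeff_eul, map_add, PowerSeries.coeff_mul, PowerSeries.coeff_mul, PowerSeries.coeff_mul, Finset.smul_sum, ← Finset.sum_add_distrib]
  apply Finset.sum_congr rfl
  intro p hp
  rw [Finset.HasAntidiagonal.mem_antidiagonal] at hp
  rw [coeff_eul, coeff_eul, smul_mul_assoc, mul_smul_comm, ← add_smul, ← hp]
  push_cast; rfl

lemma eul_pow (x : PowerSeries A) (h : eul (K := K) x * x = x * eul (K := K) x) (i : ℕ) : eul (K := K) (x ^ (i+1)) = ((i : K) + 1) • (eul (K := K) x * x ^ i) := by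
  induction i with
  | zero => simp
  | succ i ih =>
    rw [pow_succ' x (i+1), eul_mul, ih, mul_smul_comm, ← mul_assoc, ← h, mul_assoc, ← pow_succ', ← one_smul K (eul (K := K) x * x ^ (i+1)), smul_smul, ← add_smul, smul_smul]
    push_cast; congr 1; ring

lemma coeff_pow_zero (x : PowerSeries A) (h : PowerSeries.coeff 0 x = 0) (i : ℕ) : ∀ k < i, PowerSeries.coeff k (x ^ i) = 0 := by
  induction i with
  | zero => intro k hk; omega
  | succ i ih =>
    intro k hk
    rw [pow_succ', PowerSeries.coeff_mul]
    apply Finset.sum_eq_zero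
    intro p hp
    rw [Finset.HasAntidiagonal.mem_antidiagonal] at hp
    rcases Nat.eq_zero_or_pos p.1 with h0 | h0
    · rw [h0, h, zero_mul]
    · rw [ih p.2 (by omega), mul_zero]

/-- the series whose exponential is taken -/
def bser (K : Type) [Field K] {A : Type} [Ring A] [Algebra K A] (b : ℕ → A) : PowerSeries A := PowerSeries.mk fun n => (n : K)⁻¹ • b n

lemma expo_eq (b : ℕ → A) (hb : ∀ i j, b i * b j = b j * b i) (h0 : b 0 = 0) (M : ℕ) : ∀ k ≤ M,
    expo (K := K) b k = PowerSeries.coeff k (∑ i ∈ Finset.range (M+2), ((Nat.factorial i : K)⁻¹) • (bser K b) ^ i) := by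
  set x := bser K b with hx
  have cx : ∀ n, PowerSeries.coeff n x = (n : K)⁻¹ • b n := fun n => by rw [hx, bser, PowerSeries.coeff_mk]
  have cth : ∀ n, PowerSeries.coeff n (eul (K := K) x) = b n := by
    intro n
    rw [coeff_eul, cx, smul_smul]
    rcases Nat.eq_zero_or_pos n with h | h
    · subst h; simp [h0]
    · rw [mul_inv_cancel₀ (by exact_mod_cast h.ne'), one_smul]
  have hcomm : eul (K := K) x * x = x * eul (K := K) x := by
    ext n
    rw [PowerSeries.coeff_mul, PowerSeries.coeff_mul, ← Finset.Nat.sum_antidiagonal_swap]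
    apply Finset.sum_congr rfl
    intro p _
    rw [Prod.fst_swap, Prod.snd_swap, cth, cx, mul_smul_comm, smul_mul_assoc, hb]
  have hx0 : PowerSeries.coeff 0 x = 0 := by rw [cx, h0, smul_zero]
  set e := ∑ i ∈ Finset.range (M+2), ((Nat.factorial i : K)⁻¹) • x ^ i with he
  have hthe : eul (K := K) e = eul (K := K) x * ∑ i ∈ Finset.range (M+1), ((Nat.factorial i : K)⁻¹) • x ^ i := by
    have h1 : ∀ (s : Finset ℕ) (f : ℕ → PowerSeries A), eul (K := K) (∑ i ∈ s, f i) = ∑ i ∈ s, eul (K := K) (f i) := by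
      intro s f; ext n; simp only [coeff_eul, map_sum, Finset.smul_sum]
    have h2 : ∀ (c : K) (f : PowerSeries A), eul (K := K) (c • f) = c • eul (K := K) f := by
      intro c f; ext n; rw [coeff_eul, ps_coeff_smul, ps_coeff_smul, coeff_eul, smul_comm]
    have h3 : eul (K := K) (1 : PowerSeries A) = 0 := by
      ext n; rw [coeff_eul, PowerSeries.coeff_one]; split_ifs with h <;> simp [h]
    have h4 : eul (K := K) e = ∑ i ∈ Finset.range (M+2), ((Nat.factorial i : K)⁻¹) • eul (K := K) (x ^ i) := by
      rw [he, h1]; simp only [h2]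
    rw [h4, Finset.sum_range_succ', pow_zero, h3, smul_zero, add_zero, Finset.mul_sum]
    apply Finset.sum_congr rfl
    intro i _
    rw [eul_pow x hcomm, smul_smul, mul_smul_comm, Nat.factorial_succ]
    congr 1
    have : ((i : K) + 1) ≠ 0 := by exact_mod_cast Nat.succ_ne_zero i
    push_cast
    rw [mul_inv, mul_right_comm, inv_mul_cancel₀ this, one_mul]
  have hee : ∀ j ≤ M, PowerSeries.coeff j (∑ i ∈ Finset.range (M+1), ((Nat.factorial i : K)⁻¹) • x ^ i) = PowerSeries.coeff j e := by
    intro j hj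
    rw [he, Finset.sum_range_succ _ (M+1), map_add, ps_coeff_smul, coeff_pow_zero x hx0 (M+1) j (by omega), smul_zero, add_zero]
  intro k
  induction k using Nat.strong_induction_on with
  | _ k ih =>
  intro hk
  cases k with
  | zero =>
    rw [expo_zero, ← hee 0 hk, Finset.sum_range_succ', map_add, map_sum, Finset.sum_eq_zero]
    · simp
    · intro i _
      rw [ps_coeff_smul, coeff_pow_zero x hx0 (i+1) 0 (by omega), smul_zero]
  | succ k =>
    have h3 : ((k+1 : ℕ) : K) ≠ 0 := by exact_mod_cast Nat.succ_ne_zero k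
    apply smul_right_injective _ h3
    show ((k+1 : ℕ) : K) • expo (K := K) b (k+1) = ((k+1 : ℕ) : K) • PowerSeries.coeff (k+1) e
    rw [expo_succ, ← coeff_eul, hthe, PowerSeries.coeff_mul, Finset.Nat.sum_antidiagonal_succ, cth, h0, zero_mul, zero_add, Finset.Nat.sum_antidiagonal_eq_sum_range_succ_mk]
    apply Finset.sum_congr rfl
    intro n hn
    rw [cth, hee _ (by simp; omega), ih (k-n) (by omega) (by omega)]
end Exp
end C2
end JK
end

open scoped Classical
noncomputable section
set_option linter.unusedSectionVars false
set_option linter.unusedSimpArgs false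
namespace JK
open MvPolynomial
section C3
variable {K : Type} [Field K] [CharZero K]

/-- coefficientwise derivation -/
def delP : Derivation K (Polynomial (Sy K)) (Polynomial (Sy K)) :=
  letI : Differential (Sy K) := ⟨(del (K := K)).restrictScalars ℤ⟩
  Derivation.mk'
    { toFun := fun p => Differential.mapCoeffs p
      map_add' := fun p q => map_add _ p q
      map_smul' := fun c p => by
        ext1 i
        rw [RingHom.id_apply, Polynomial.coeff_smul, Differential.coeff_mapCoeffs, Differential.coeff_mapCoeffs, Polynomial.coeff_smul]
        exact (del (K := K)).map_smul c _ }
    (fun p q => by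
      exact Derivation.leibniz Differential.mapCoeffs p q)

lemma coeff_delP (p : Polynomial (Sy K)) (i : ℕ) : (delP p).coeff i = del (p.coeff i) := rfl

variable {α : K} (hα : α ≠ 0)

/-- filtration -/
def Iv (n : ℕ) : Submodule K (Sy K) where
  carrier := {f | ∀ d < n, EE hα f d = 0}
  add_mem' := by
    intro f g hf hg d hd
    rw [map_add, Pi.add_apply, hf d hd, hg d hd, add_zero]
  zero_mem' := by intro d _; rw [map_zero]; rfl
  smul_mem' := by
    intro c f hf d hd
    rw [map_smul, Pi.smul_apply, hf d hd, smul_zero]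

lemma mem_Iv {n : ℕ} {f : Sy K} : f ∈ Iv hα n ↔ ∀ d < n, EE hα f d = 0 := Iff.rfl

lemma Cn_zero {l n : ℕ} (h : n < l) : (JS hα).Cn l n = 0 := by
  rw [Sys.Cn, Sys.BB_zero _ h, smul_zero]

lemma Cn_z (l : ℕ) : (JS hα).Cn l 0 = 0 := by
  rw [Sys.Cn, Nat.cast_zero, inv_zero, zero_smul]

lemma Ch_van {l n k : ℕ} {h : ℕ → Sy K} (hl : k ≤ l ∨ k ≤ 1) (hh : ∀ d < n, h d = 0) : ∀ d < n + k, Ch hα l h d = 0 := by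
  intro d hd
  rw [Ch_apply]
  apply Finset.sum_eq_zero
  intro p hp
  rw [Finset.HasAntidiagonal.mem_antidiagonal] at hp
  by_cases h1 : p.2 < n
  · rw [hh _ h1, map_zero]
  · rcases hl with hl | hl
    · rw [Cn_zero hα (by omega), LinearMap.zero_apply]
    · rw [show p.1 = 0 by omega, Cn_z, LinearMap.zero_apply]

lemma Iv_X {n : ℕ} {f : Sy K} (k : ℕ+) (hf : f ∈ Iv hα n) : X k * f ∈ Iv hα (n + k) := by
  rw [mem_Iv, EE_X]
  exact Ch_van hα (Or.inl le_rfl) hf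

lemma Iv_del {n : ℕ} {f : Sy K} (hf : f ∈ Iv hα n) : del f ∈ Iv hα (n + 1) := by
  rw [mem_Iv, EE_del]
  exact Ch_van hα (Or.inr le_rfl) hf

lemma Iv_anti {n m : ℕ} (h : n ≤ m) {f : Sy K} (hf : f ∈ Iv hα m) : f ∈ Iv hα n := fun d hd => hf d (by omega)

lemma Iv_mul {n : ℕ} {f : Sy K} (g : Sy K) (hf : f ∈ Iv hα n) : g * f ∈ Iv hα n := by
  induction g using MvPolynomial.induction_on with
  | C a => rw [← smul_eq_C_mul]; exact (Iv hα n).smul_mem a hf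
  | add g g' h h' => rw [add_mul]; exact (Iv hα n).add_mem h h'
  | mul_X g k h => rw [mul_comm g, mul_assoc]; exact Iv_anti hα (by omega) (Iv_X hα k h)

lemma Iv_zero (f : Sy K) : f ∈ Iv hα 0 := fun d hd => by omega

lemma Iv_Xk (k : ℕ+) : (X k : Sy K) ∈ Iv hα k := by
  have := Iv_X hα k (Iv_zero hα 1)
  rwa [mul_one, zero_add] at this

/-- linear elements -/
def lin (N : ℕ) (q : ℕ → K) : Sy K := ∑ l ∈ Finset.range N, q l • X (Nat.succPNat l)

/-- polynomial version of the filtration -/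
def JJ (n : ℕ) : Ideal (Polynomial (Sy K)) where
  carrier := {p | ∀ i, p.coeff i ∈ Iv hα n}
  add_mem' := by
    intro f g hf hg i
    rw [Polynomial.coeff_add]; exact (Iv hα n).add_mem (hf i) (hg i)
  zero_mem' := by intro i; rw [Polynomial.coeff_zero]; exact (Iv hα n).zero_mem
  smul_mem' := by
    intro c f hf i
    rw [smul_eq_mul, Polynomial.coeff_mul]
    exact (Iv hα n).sum_mem (fun p _ => Iv_mul hα _ (hf _))

lemma JJ_X {n : ℕ} {p : Polynomial (Sy K)} (k : ℕ+) (hp : p ∈ JJ hα n) : Polynomial.C (X k) * p ∈ JJ hα (n + 1) := by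
  intro i
  rw [Polynomial.coeff_C_mul]
  exact Iv_anti hα (by have := k.pos; omega) (Iv_X hα k (hp i))

lemma JJ_Xk (k : ℕ+) : Polynomial.C (X k : Sy K) ∈ JJ hα k := by
  intro i
  rw [Polynomial.coeff_C]
  split_ifs
  · exact Iv_Xk hα k
  · exact (Iv hα _).zero_mem

lemma JJ_smul {n : ℕ} {p : Polynomial (Sy K)} (c : K) (hp : p ∈ JJ hα n) : c • p ∈ JJ hα n := by
  intro i
  rw [Polynomial.coeff_smul]; exact (Iv hα n).smul_mem c (hp i)

/-- embedding of scalar polynomials -/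
abbrev em (p : Polynomial K) : Polynomial (Sy K) := p.map (algebraMap K (Sy K))

/-- linear elements depending on a parameter -/
def linP (N : ℕ) (q : ℕ → Polynomial K) : Polynomial (Sy K) := ∑ l ∈ Finset.range N, em (q l) * Polynomial.C (X (Nat.succPNat l))

lemma linP_mul {n : ℕ} (N : ℕ) (q : ℕ → Polynomial K) {p : Polynomial (Sy K)} (hp : p ∈ JJ hα n) : linP N q * p ∈ JJ hα (n+1) := by
  rw [linP, Finset.sum_mul]
  apply Ideal.sum_mem
  intro l _
  rw [mul_assoc]
  exact Ideal.mul_mem_left _ _ (JJ_X hα _ hp)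

lemma linP_pow (N : ℕ) (q : ℕ → Polynomial K) (r : ℕ) : linP N q ^ r ∈ JJ hα r := by
  induction r with
  | zero => intro i; exact Iv_zero hα _
  | succ r ih => rw [pow_succ']; exact linP_mul hα N q ih

lemma exists_anti (p : Polynomial K) (a : K) : ∃ P : Polynomial K, Polynomial.derivative P = p ∧ P.eval 0 = a := by
  have h : ∃ P : Polynomial K, Polynomial.derivative P = p := by
    induction p using Polynomial.induction_on' with
    | add p q hp hq =>
      obtain ⟨P, rfl⟩ := hp
      obtain ⟨Q, rfl⟩ := hq
      exact ⟨P + Q, by simp⟩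
    | monomial n a =>
      refine ⟨Polynomial.monomial (n+1) (a * ((n : K) + 1)⁻¹), ?_⟩
      have : ((n : K) + 1) ≠ 0 := by exact_mod_cast Nat.succ_ne_zero n
      rw [Polynomial.derivative_monomial]
      simp [mul_assoc, inv_mul_cancel₀ this]
  obtain ⟨P, hP⟩ := h
  exact ⟨P + Polynomial.C (a - P.eval 0), by simp [hP], by simp⟩

lemma exists_path (u : K) (q : ℕ → K) : ∃ qs : ℕ → Polynomial K, (∀ l, (qs l).eval 0 = q l) ∧
    Polynomial.derivative (qs 0) = Polynomial.C u ∧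
    ∀ l, Polynomial.derivative (qs (l+1)) = Polynomial.C (u ^ (l+2)) + ((l : K) + 2) • qs l := by
  choose A hA using fun (p : Polynomial K) (a : K) => exists_anti p a
  refine ⟨fun l => Nat.rec (A (Polynomial.C u) (q 0)) (fun l p => A (Polynomial.C (u ^ (l+2)) + ((l : K) + 2) • p) (q (l+1))) l, ?_, ?_, ?_⟩
  · intro l
    cases l with
    | zero => exact (hA _ _).2
    | succ l => exact (hA _ _).2
  · exact (hA _ _).1
  · intro l; exact (hA _ _).1

/-- truncated exponential -/
def tex {R : Type} [CommRing R] [Algebra K R] (N : ℕ) (x : R) : R := ∑ r ∈ Finset.range N, ((Nat.factorial r : K)⁻¹) • x ^ r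

lemma tex_der {R : Type} [CommRing R] [Algebra K R] (D : Derivation K R R) (N : ℕ) (x : R) :
    D (tex (K := K) (N+1) x) = D x * tex (K := K) N x := by
  rw [tex, Finset.sum_range_succ', map_add, map_sum, pow_zero, D.map_smul, D.map_one_eq_zero, smul_zero, add_zero, tex, Finset.mul_sum]
  apply Finset.sum_congr rfl
  intro r _
  rw [D.map_smul, D.leibniz_pow, Nat.add_sub_cancel, mul_smul_comm, Nat.factorial_succ, smul_eq_mul, ← Nat.cast_smul_eq_nsmul K, smul_smul, mul_comm (x ^ r)]
  congr 1
  have : ((r : K) + 1) ≠ 0 := by exact_mod_cast Nat.succ_ne_zero r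
  push_cast
  rw [mul_inv, mul_right_comm, inv_mul_cancel₀ this, one_mul]

/-- the first order operator -/
def DD (N : ℕ) (u : K) (f : Sy K) : Sy K := del f + lin N (fun l => u ^ (l+1)) * f

lemma path_ode (N : ℕ) (u : K) (qs : ℕ → Polynomial K) (h0 : Polynomial.derivative (qs 0) = Polynomial.C u)
    (h1 : ∀ l, Polynomial.derivative (qs (l+1)) = Polynomial.C (u ^ (l+2)) + ((l : K) + 2) • qs l) :
    Polynomial.derivative (tex (K := K) (N+2) (linP N qs)) - (delP (tex (K := K) (N+2) (linP N qs)) +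
      Polynomial.C (lin N (fun l => u ^ (l+1))) * tex (K := K) (N+2) (linP N qs)) ∈ JJ hα (N+1) := by
  set Q := linP N qs with hQ
  set V : Polynomial (Sy K) := Polynomial.C (lin N (fun l => u ^ (l+1))) with hV
  have e1 : Polynomial.derivative (tex (K := K) (N+2) Q) = Polynomial.derivative Q * tex (K := K) (N+1) Q :=
    tex_der ((Polynomial.derivative' (R := Sy K)).restrictScalars K) (N+1) Q
  have e2 := tex_der (delP (K := K)) (N+1) Q
  have e3 : tex (K := K) (N+2) Q = tex (K := K) (N+1) Q + ((Nat.factorial (N+1) : K)⁻¹) • Q ^ (N+1) := by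
    rw [tex, Finset.sum_range_succ]; rfl
  have e4 : Polynomial.derivative Q - delP Q - V ∈ JJ hα (N+1) := by
    have hd : delP Q = ∑ l ∈ Finset.range N, em (qs l) * Polynomial.C (((l : K) + 2) • X (Nat.succPNat (l+1))) := by
      rw [hQ, linP, map_sum]
      apply Finset.sum_congr rfl
      intro l _
      ext1 i
      rw [coeff_delP, Polynomial.coeff_mul_C, Polynomial.coeff_mul_C, Polynomial.coeff_map, Derivation.leibniz, Derivation.map_algebraMap, smul_zero, add_zero, smul_eq_mul]
      congr 1
      rw [del, mkDerivation_X]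
      congr 1
      rw [Nat.succPNat_coe]; push_cast; ring
    have hder : Polynomial.derivative Q = ∑ l ∈ Finset.range N, em (Polynomial.derivative (qs l)) * Polynomial.C (X (Nat.succPNat l)) := by
      rw [hQ, linP, map_sum]
      apply Finset.sum_congr rfl
      intro l _
      rw [Polynomial.derivative_mul, Polynomial.derivative_C, mul_zero, add_zero, Polynomial.derivative_map]
    have hVV : V = ∑ l ∈ Finset.range N, em (Polynomial.C (u ^ (l+1))) * Polynomial.C (X (Nat.succPNat l)) := by
      rw [hV, lin, map_sum]
      apply Finset.sum_congr rfl
      intro l _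
      rw [em, Polynomial.map_C, ← Polynomial.C_mul, Algebra.smul_def]
    cases N with
    | zero => rw [hd, hder, hVV]; simp
    | succ N =>
      have : Polynomial.derivative Q - delP Q - V = - (em (qs N) * Polynomial.C (((N : K) + 2) • X (Nat.succPNat (N+1)))) := by
        rw [hd, hder, hVV, sub_right_comm, ← Finset.sum_sub_distrib, Finset.sum_range_succ', Finset.sum_range_succ]
        have : ∀ l ∈ Finset.range N, em (Polynomial.derivative (qs (l+1))) * Polynomial.C (X (Nat.succPNat (l+1))) - em (Polynomial.C (u ^ (l+1+1))) * Polynomial.C (X (Nat.succPNat (l+1))) = em (qs l) * Polynomial.C (((l : K) + 2) • X (Nat.succPNat (l+1))) := by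
          intro l _
          rw [← sub_mul, h1, em, em, Polynomial.map_add, show l + 1 + 1 = l + 2 by ring, add_sub_cancel_left, Algebra.smul_def, Algebra.smul_def, Polynomial.map_mul, Polynomial.C_mul, Polynomial.algebraMap_apply, Polynomial.map_C]
          simp only [Algebra.algebraMap_self, RingHom.id_apply]
          ring
        rw [Finset.sum_congr rfl this, h0]
        simp
      rw [this]
      apply Ideal.neg_mem_iff _ |>.2
      apply Ideal.mul_mem_left
      rw [← Polynomial.smul_C]
      exact JJ_smul hα _ (JJ_Xk hα (Nat.succPNat (N+1)))
  have e5 : Polynomial.derivative (tex (K := K) (N+2) Q) - (delP (tex (K := K) (N+2) Q) + V * tex (K := K) (N+2) Q) =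
      tex (K := K) (N+1) Q * (Polynomial.derivative Q - delP Q - V) - V * (((Nat.factorial (N+1) : K)⁻¹) • Q ^ (N+1)) := by
    rw [e1, e2, e3]; ring
  rw [e5]
  exact Ideal.sub_mem _ (Ideal.mul_mem_left _ _ e4) (Ideal.mul_mem_left _ _ (JJ_smul hα _ (linP_pow hα N qs (N+1))))
end C3
end JK
end

open scoped Classical
noncomputable section
set_option linter.unusedSectionVars false
set_option linter.unusedSimpArgs false
namespace JK
open MvPolynomial JD
section C4
variable {K : Type} [Field K] [CharZero K] {α : K} (hα : α ≠ 0)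

/-- linear version of the first order operator -/
def DL (N : ℕ) (u : K) : Module.End K (Sy K) := (del (K := K)).toLinearMap + LinearMap.mulLeft K (lin N (fun l => u ^ (l+1)))

lemma DL_apply (N : ℕ) (u : K) (f : Sy K) : DL N u f = del f + lin N (fun l => u ^ (l+1)) * f := rfl

lemma act_congr (x : RR K) {h h' : ℕ → Sy K} {N : ℕ} (hh : ∀ d ≤ N, h d = h' d) : ∀ d ≤ N, act x h d = act x h' d := by
  intro d hd
  rw [act_apply, act_apply]
  apply Finset.sum_congr rfl
  intro p hp
  rw [Finset.HasAntidiagonal.mem_antidiagonal] at hp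
  rw [hh p.2 (by omega)]

/-- the relevant series -/
abbrev xs (u : K) : RR K := bser K (fun n => (JS hα).Bu u n)

lemma act_xs (u : K) (N : ℕ) (h : ℕ → Sy K) : ∀ d ≤ N, act (xs hα u) h d = ∑ l ∈ Finset.range (N+1), u ^ l • Ch hα l h d := by
  intro d hd
  simp only [Ch_apply, Finset.smul_sum]
  rw [Finset.sum_comm, act_apply]
  apply Finset.sum_congr rfl
  intro p hp
  rw [Finset.HasAntidiagonal.mem_antidiagonal] at hp
  rw [xs, bser, PowerSeries.coeff_mk, Sys.Bu_eq _ u p.1 (N+1) (by omega), LinearMap.smul_apply, LinearMap.sum_apply, Finset.smul_sum]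
  apply Finset.sum_congr rfl
  intro l _
  rw [LinearMap.smul_apply, Sys.Cn, LinearMap.smul_apply, smul_comm]

lemma EE_DL (u : K) (N : ℕ) (g : Sy K) : ∀ d ≤ N, EE hα (DL N u g) d = act (xs hα u) (EE hα g) d := by
  intro d hd
  rw [act_xs hα u N _ d hd, Finset.sum_range_succ', DL_apply, map_add, Pi.add_apply, EE_del, pow_zero, one_smul, add_comm]
  congr 1
  rw [lin, Finset.sum_mul, map_sum, Finset.sum_apply]
  apply Finset.sum_congr rfl
  intro l _
  rw [smul_mul_assoc, map_smul, Pi.smul_apply, EE_X]; rfl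

lemma EE_DLpow (u : K) (N : ℕ) (g : Sy K) (i : ℕ) : ∀ d ≤ N, EE hα ((DL N u ^ i) g) d = act (xs hα u ^ i) (EE hα g) d := by
  induction i with
  | zero => intro d _; rw [pow_zero, pow_zero, act_one]; rfl
  | succ i ih =>
    intro d hd
    rw [pow_succ', Module.End.mul_apply, EE_DL hα u N _ d hd, pow_succ', act_mul]
    exact act_congr _ ih d hd

lemma Iv_DL (u : K) (N n : ℕ) {f : Sy K} (hf : f ∈ Iv hα n) : DL N u f ∈ Iv hα n := by
  rw [DL_apply]
  exact (Iv hα n).add_mem (Iv_anti hα (by omega) (Iv_del hα hf)) (Iv_mul hα _ hf)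

lemma Ph_sum (u : K) (h : ℕ → Sy K) (M d : ℕ) (hd : d ≤ M) : ∑ j ∈ Finset.range (d+1), Ph hα u j (h (d - j)) =
    ∑ i ∈ Finset.range (M+2), ((Nat.factorial i : K)⁻¹) • act (xs hα u ^ i) h d := by
  have hb : ∀ i j, (JS hα).Bu u i * (JS hα).Bu u j = (JS hα).Bu u j * (JS hα).Bu u i := by
    intro i j
    cases i with
    | zero => rw [Sys.Bu_zero, zero_mul, mul_zero]
    | succ i =>
      have := (JS hα).Bu_comm u i j
      rw [Ring.lie_def] at this
      exact sub_eq_zero.1 this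
  have h1 : act (∑ i ∈ Finset.range (M+2), ((Nat.factorial i : K)⁻¹) • (xs hα u) ^ i) h d =
      ∑ i ∈ Finset.range (M+2), ((Nat.factorial i : K)⁻¹) • act (xs hα u ^ i) h d := by
    rw [act_sum, Finset.sum_apply]
    apply Finset.sum_congr rfl
    intro i _
    rw [act_smul, Pi.smul_apply]
  rw [← h1, act_apply, Finset.Nat.sum_antidiagonal_eq_sum_range_succ_mk]
  apply Finset.sum_congr rfl
  intro j hj
  rw [Finset.mem_range] at hj
  rw [← expo_eq (K := K) (fun n => (JS hα).Bu u n) hb (Sys.Bu_zero _ u) M j (by omega)]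
  rfl

lemma taylor (N : ℕ) (u : K) (G : Polynomial (Sy K))
    (hG : Polynomial.derivative G - (delP G + Polynomial.C (lin N (fun l => u ^ (l+1))) * G) ∈ JJ hα (N+1)) (i : ℕ) :
    G.coeff i - ((Nat.factorial i : K)⁻¹) • (DL N u ^ i) (G.coeff 0) ∈ Iv hα (N+1) := by
  induction i with
  | zero => simp
  | succ i ih =>
    have h1 := hG i
    rw [Polynomial.coeff_sub, Polynomial.coeff_add, coeff_delP, Polynomial.coeff_C_mul, ← DL_apply, Polynomial.coeff_derivative] at h1
    have h2 := Iv_DL hα u N _ ih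
    rw [map_sub, map_smul, ← Module.End.mul_apply, ← pow_succ'] at h2
    have h3 := (Iv hα (N+1)).smul_mem (((i : K) + 1)⁻¹) ((Iv hα (N+1)).add_mem h1 h2)
    have h0 : ((i : K) + 1) ≠ 0 := by exact_mod_cast Nat.succ_ne_zero i
    convert h3 using 1
    rw [sub_add_sub_cancel, smul_sub, smul_smul, Nat.factorial_succ]
    push_cast
    rw [mul_inv]
    congr 1
    have : (G.coeff (i+1)) * ((i : Sy K) + 1) = ((i : K) + 1) • G.coeff (i+1) := by
      rw [Algebra.smul_def, mul_comm]; simp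
    rw [this, smul_smul, inv_mul_cancel₀ h0, one_smul]

lemma eval_tex (M N : ℕ) (qs : ℕ → Polynomial K) (c : K) :
    (tex (K := K) M (linP N qs)).eval (algebraMap K (Sy K) c) = tex (K := K) M (lin N (fun l => (qs l).eval c)) := by
  have h1 : (linP N qs).eval (algebraMap K (Sy K) c) = lin N (fun l => (qs l).eval c) := by
    rw [linP, lin, Polynomial.eval_finset_sum]
    apply Finset.sum_congr rfl
    intro l _
    rw [Polynomial.eval_mul, Polynomial.eval_C, em, Polynomial.eval_map, Polynomial.eval₂_at_apply, Algebra.smul_def]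
  rw [tex, tex, Polynomial.eval_finset_sum]
  apply Finset.sum_congr rfl
  intro r _
  rw [Polynomial.eval_smul, Polynomial.eval_pow, h1]

lemma Qf_exp (N : ℕ) (l : List ℕ) : ∃ q : ℕ → K, ∀ d ≤ N, Qf hα l d = EE hα (tex (K := K) (N+2) (lin N q)) d := by
  induction l with
  | nil =>
    refine ⟨fun _ => 0, fun d _ => ?_⟩
    have : tex (K := K) (N+2) (lin N (fun _ => (0 : K))) = 1 := by
      rw [tex, Finset.sum_range_succ', Finset.sum_eq_zero]
      · simp
      · intro i _
        simp [lin]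
    rw [this, EE_one]; rfl
  | cons k l ih =>
    obtain ⟨q, hq⟩ := ih
    set u : K := -(α * k) with hu
    obtain ⟨qs, hq0, hq1, hq2⟩ := exists_path u q
    set G := tex (K := K) (N+2) (linP N qs) with hG
    have hT := taylor hα N u G (path_ode hα N u qs hq1 hq2)
    have e0 : G.coeff 0 = tex (K := K) (N+2) (lin N q) := by
      have := eval_tex (N+2) N qs 0
      rw [map_zero, ← Polynomial.coeff_zero_eq_eval_zero] at this
      rw [hG, this]
      congr 2; funext l; exact hq0 l
    refine ⟨fun l => (qs l).eval 1, fun d hd => ?_⟩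
    set M := N + G.natDegree with hM
    have e1 : tex (K := K) (N+2) (lin N (fun l => (qs l).eval 1)) = ∑ i ∈ Finset.range (M+2), G.coeff i := by
      rw [← eval_tex, map_one, ← hG, Polynomial.eval_eq_sum_range' (n := M+2) (by omega)]
      simp
    rw [Qf, Ph_sum hα u _ M d (by omega), e1, map_sum, Finset.sum_apply]
    apply Finset.sum_congr rfl
    intro i _
    have h3 := hT i d (by omega)
    rw [map_sub, Pi.sub_apply, sub_eq_zero] at h3
    rw [h3, map_smul, Pi.smul_apply, EE_DLpow hα u N _ i d hd, e0, act_congr _ hq d hd]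
end C4
end JK
end

open scoped Classical
noncomputable section
set_option linter.unusedSectionVars false
set_option linter.unusedSimpArgs false
namespace JK
open MvPolynomial
open scoped TensorProduct
section D1
variable {K : Type} [Field K] [CharZero K] {α : K} (hα : α ≠ 0)

/-- power sum monomials -/
def mon (l : JPartition) : Sy K := (Multiset.map (fun i : ℕ+ => (X i : Sy K)) l).prod

lemma mon_zero : (mon 0 : Sy K) = 1 := by simp [mon]
lemma mon_cons (k : ℕ+) (l : JPartition) : (mon (k ::ₘ l) : Sy K) = X k * mon l := by simp [mon]
lemma mon_add (l m : JPartition) : (mon (l + m) : Sy K) = mon l * mon m := by simp [mon]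

lemma toExp_cons (k : ℕ+) (l : JPartition) : toExp (k ::ₘ l) = Finsupp.single k 1 + toExp l := by
  ext i
  rw [Finsupp.add_apply, toExp_apply, toExp_apply, Multiset.count_cons, Finsupp.single_apply, add_comm]
  congr 1
  simp only [eq_comm]

lemma toExp_inj {l m : JPartition} (h : toExp l = toExp m) : l = m := by
  ext i
  rw [← toExp_apply, ← toExp_apply, h]

lemma mon_eq (l : JPartition) : (mon l : Sy K) = monomial (toExp l) 1 := by
  induction l using Multiset.induction_on with
  | empty =>
    have : toExp 0 = 0 := by ext i; rw [toExp_apply]; simp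
    rw [this, mon_zero]; rfl
  | cons k l ih => rw [mon_cons, ih, toExp_cons, X, monomial_mul, one_mul]

lemma coeff_mon (l m : JPartition) : coeff (toExp m) (mon l : Sy K) = if l = m then 1 else 0 := by
  rw [mon_eq, coeff_monomial]
  congr 1
  exact propext ⟨toExp_inj, fun h => h ▸ rfl⟩

lemma lin_ext {V : Type} [AddCommGroup V] [Module K V] {f g : Sy K →ₗ[K] V} (h : ∀ l, f (mon l) = g (mon l)) : f = g := by
  apply (basisMonomials ℕ+ K).ext
  intro m
  have : toExp (Finsupp.toMultiset m) = m := by ext i; rw [toExp_apply, Finsupp.count_toMultiset]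
  have h2 := h (Finsupp.toMultiset m)
  rw [mon_eq, this] at h2
  rw [coe_basisMonomials]
  exact h2

lemma eS_mon (l : JPartition) : eS (mon l : Sy K) = (psize l : K) • mon l := by
  induction l using Multiset.induction_on with
  | empty => rw [mon_zero, eS_one, psize_zero]; simp
  | cons k l ih =>
    rw [mon_cons, ← pp_coe, eS_ppmul, ih, mul_smul_comm, ← add_smul, psize_cons]
    congr 1
    push_cast; ring

lemma coeff_eS (m : JPartition) (f : Sy K) : coeff (toExp m) (eS f) = (psize m : K) * coeff (toExp m) f := by
  have : (lcoeff K (toExp m)).comp eS = (psize m : K) • lcoeff K (toExp m) := by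
    apply lin_ext
    intro l
    rw [LinearMap.comp_apply, LinearMap.smul_apply, eS_mon, map_smul, lcoeff_apply, coeff_mon]
    split_ifs with h
    · rw [h]
    · simp
  exact LinearMap.congr_fun this f

/-- coefficient functionals -/
def psi (m : JPartition) : Sy K →ₗ[K] K := (lcoeff K (toExp m)).comp ((LinearMap.proj (psize m)).comp (EE hα))

lemma psi_apply (m : JPartition) (f : Sy K) : psi hα m f = coeff (toExp m) (EE hα f (psize m)) := rfl

lemma psi_Iv {m : JPartition} {n : ℕ} {f : Sy K} (hf : f ∈ Iv hα n) (h : psize m < n) : psi hα m f = 0 := by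
  rw [psi_apply, hf _ h, coeff_zero]

lemma mon_Iv (l : JPartition) : (mon l : Sy K) ∈ Iv hα (psize l) := by
  induction l using Multiset.induction_on with
  | empty => rw [psize_zero]; exact Iv_zero hα _
  | cons k l ih => rw [mon_cons, psize_cons, add_comm]; exact Iv_X hα k ih

/-- weights -/
def wei (α : K) (l : JPartition) : K := (Multiset.map (fun i : ℕ+ => α * ((i : ℕ) : K)) l).prod

lemma wei_cons (k : ℕ+) (l : JPartition) : wei α (k ::ₘ l) = (α * ((k : ℕ) : K)) * wei α l := by simp [wei]
lemma wei_add (l m : JPartition) : wei α (l + m) = wei α l * wei α m := by simp [wei]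

lemma kne (k : ℕ+) : ((k : ℕ) : K) ≠ 0 := by exact_mod_cast k.pos.ne'

lemma wei_ne {α : K} (hα : α ≠ 0) (l : JPartition) : wei α l ≠ 0 := by
  rw [wei]
  apply Multiset.prod_ne_zero
  simp only [Multiset.mem_map, not_exists, not_and]
  intro k _
  exact mul_ne_zero hα (kne k)

lemma EE_top (l : JPartition) : EE hα (mon l) (psize l) = (wei α l)⁻¹ • mon l := by
  induction l using Multiset.induction_on with
  | empty => rw [mon_zero, EE_one, psize_zero]; simp [oneF, wei]
  | cons k l ih =>
    have h0 := mon_Iv hα l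
    rw [mon_cons, EE_X, psize_cons, Ch_apply, Finset.sum_eq_single ((k : ℕ), psize l)]
    · rw [ih, Sys.Cn, LinearMap.smul_apply, BB_diag, pp_coe, wei_cons, mul_smul_comm, smul_smul, smul_smul]
      congr 1
      have := kne (K := K) k
      have := wei_ne hα l
      field_simp
    · rintro ⟨i, j⟩ hp hne
      rw [Finset.HasAntidiagonal.mem_antidiagonal] at hp
      simp only at hp
      by_cases h1 : j < psize l
      · show (JS hα).Cn k i (EE hα (mon l) j) = 0
        rw [h0 j h1, map_zero]
      · have : i < k := by
          by_contra h2
          apply hne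
          rw [Prod.mk.injEq]; omega
        rw [Cn_zero hα this, LinearMap.zero_apply]
    · intro h; simp at h

/-- the coefficients -/
def aa (l m : JPartition) : K := wei α l * psi hα m (mon l)

lemma aa_lt {l m : JPartition} (h : psize m < psize l) : aa hα l m = 0 := by
  rw [aa, psi_Iv hα (mon_Iv hα l) h, mul_zero]

lemma aa_eq {l m : JPartition} (h : psize m = psize l) : aa hα l m = if l = m then 1 else 0 := by
  rw [aa, psi_apply, h, EE_top, coeff_smul, smul_eq_mul, ← mul_assoc, mul_inv_cancel₀ (wei_ne hα l), one_mul, coeff_mon]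

/-- coproduct -/
def cop (K : Type) [Field K] [CharZero K] : Sy K →ₐ[K] (Sy K ⊗[K] Sy K) := aeval (fun k : ℕ+ => (1 : Sy K) ⊗ₜ[K] (X k : Sy K) + (X k : Sy K) ⊗ₜ[K] (1 : Sy K))

/-- pairing functional -/
def DF (m n : JPartition) : Sy K →ₗ[K] K := ((LinearMap.mul' K K).comp (TensorProduct.map (psi hα m) (psi hα n))).comp (cop K).toLinearMap

lemma DF_apply (m n : JPartition) (f : Sy K) : DF hα m n f = LinearMap.mul' K K (TensorProduct.map (psi hα m) (psi hα n) (cop K f)) := rfl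

lemma mon_left (l : JPartition) : (Multiset.map (fun k : ℕ+ => (X k : Sy K) ⊗ₜ[K] (1 : Sy K)) l).prod = mon l ⊗ₜ[K] (1 : Sy K) := by
  induction l using Multiset.induction_on with
  | empty => rw [mon_zero, Multiset.map_zero, Multiset.prod_zero]; rfl
  | cons k l ih => rw [Multiset.map_cons, Multiset.prod_cons, ih, mon_cons, Algebra.TensorProduct.tmul_mul_tmul, one_mul]

lemma mon_right (l : JPartition) : (Multiset.map (fun k : ℕ+ => (1 : Sy K) ⊗ₜ[K] (X k : Sy K)) l).prod = (1 : Sy K) ⊗ₜ[K] mon l := by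
  induction l using Multiset.induction_on with
  | empty => rw [mon_zero, Multiset.map_zero, Multiset.prod_zero]; rfl
  | cons k l ih => rw [Multiset.map_cons, Multiset.prod_cons, ih, mon_cons, Algebra.TensorProduct.tmul_mul_tmul, one_mul]

lemma cop_mon (l : JPartition) : cop K (mon l : Sy K) = (l.powerset.map fun x => (mon x : Sy K) ⊗ₜ[K] (mon (l - x) : Sy K)).sum := by
  have : cop K (mon l : Sy K) = (Multiset.map (fun k : ℕ+ => (1 : Sy K) ⊗ₜ[K] (X k : Sy K) + (X k : Sy K) ⊗ₜ[K] (1 : Sy K)) l).prod := by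
    rw [mon, map_multiset_prod, Multiset.map_map]
    congr 1
    apply Multiset.map_congr rfl
    intro k _
    rw [Function.comp_apply, cop, aeval_X]
  rw [this, Multiset.prod_map_add, Multiset.antidiagonal_eq_map_powerset, Multiset.map_map]
  congr 1
  apply Multiset.map_congr rfl
  intro x _
  rw [Function.comp_apply, mon_left, mon_right, Algebra.TensorProduct.tmul_mul_tmul, one_mul, mul_one]

/-- the splitting coefficients -/
def dd (l m n : JPartition) : K := (l.powerset.map fun x => aa hα x m * aa hα (l - x) n).sum

lemma dd_eq (l m n : JPartition) : dd hα l m n = wei α l * DF hα m n (mon l) := by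
  rw [DF_apply, cop_mon, map_multiset_sum, map_multiset_sum, Multiset.map_map, Multiset.map_map, ← smul_eq_mul, Multiset.smul_sum, Multiset.map_map, dd]
  congr 1
  apply Multiset.map_congr rfl
  intro x hx
  rw [Multiset.mem_powerset] at hx
  have : wei α l = wei α x * wei α (l - x) := by rw [← wei_add, add_tsub_cancel_of_le hx]
  simp only [Function.comp_apply, TensorProduct.map_tmul, LinearMap.mul'_apply, smul_eq_mul, aa]
  rw [this]; ring

lemma psize_add (l m : JPartition) : psize (l + m) = psize l + psize m := by simp [psize_def]

lemma dd_zero {l m n : JPartition} (h : psize m + psize n < psize l) : dd hα l m n = 0 := by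
  rw [dd]
  apply Multiset.sum_eq_zero
  simp only [Multiset.mem_map]
  rintro _ ⟨x, hx, rfl⟩
  rw [Multiset.mem_powerset] at hx
  have : psize l = psize x + psize (l - x) := by rw [← psize_add, add_tsub_cancel_of_le hx]
  rcases lt_or_ge (psize m) (psize x) with h1 | h1
  · rw [aa_lt hα h1, zero_mul]
  · rw [aa_lt hα (l := l - x) (by omega), mul_zero]

lemma lin_pow (N : ℕ) (q : ℕ → K) (r : ℕ) : lin N q ^ r ∈ Iv hα r := by
  induction r with
  | zero => exact Iv_zero hα _
  | succ r ih =>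
    rw [pow_succ', lin, Finset.sum_mul]
    apply Submodule.sum_mem
    intro l _
    rw [smul_mul_assoc]
    exact (Iv hα _).smul_mem _ (Iv_anti hα (by rw [Nat.succPNat_coe]; omega) (Iv_X hα _ ih))

lemma cop_lin (N : ℕ) (q : ℕ → K) : cop K (lin N q) = (lin N q) ⊗ₜ[K] (1 : Sy K) + (1 : Sy K) ⊗ₜ[K] (lin N q) := by
  rw [lin, map_sum, TensorProduct.sum_tmul, TensorProduct.tmul_sum, ← Finset.sum_add_distrib]
  apply Finset.sum_congr rfl
  intro l _
  rw [map_smul, cop, aeval_X, smul_add, add_comm, TensorProduct.smul_tmul', TensorProduct.tmul_smul]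

lemma conv_sum (A B : ℕ → K) (m n M : ℕ) (hA : ∀ i, m < i → A i = 0) (hB : ∀ i, n < i → B i = 0) (hM : m + n < M) :
    ∑ r ∈ Finset.range M, ∑ p ∈ Finset.HasAntidiagonal.antidiagonal r, A p.1 * B p.2 = (∑ i ∈ Finset.range M, A i) * (∑ i ∈ Finset.range M, B i) := by
  set P : Polynomial K := ∑ i ∈ Finset.range (m+1), Polynomial.monomial i (A i) with hP
  set Q : Polynomial K := ∑ i ∈ Finset.range (n+1), Polynomial.monomial i (B i) with hQ
  have cP : ∀ i, P.coeff i = A i := by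
    intro i
    rw [hP, Polynomial.finsetSum_coeff]
    simp only [Polynomial.coeff_monomial]
    rw [Finset.sum_ite_eq']
    split_ifs with h
    · rfl
    · rw [hA i (by simpa using h)]
  have cQ : ∀ i, Q.coeff i = B i := by
    intro i
    rw [hQ, Polynomial.finsetSum_coeff]
    simp only [Polynomial.coeff_monomial]
    rw [Finset.sum_ite_eq']
    split_ifs with h
    · rfl
    · rw [hB i (by simpa using h)]
  have dP : P.natDegree ≤ m := by
    rw [Polynomial.natDegree_le_iff_coeff_eq_zero]
    intro i hi; rw [cP, hA i hi]
  have dQ : Q.natDegree ≤ n := by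
    rw [Polynomial.natDegree_le_iff_coeff_eq_zero]
    intro i hi; rw [cQ, hB i hi]
  have h1 := Polynomial.eval_eq_sum_range' (p := P * Q) (n := M) (lt_of_le_of_lt Polynomial.natDegree_mul_le (by omega)) 1
  have h2 := Polynomial.eval_eq_sum_range' (p := P) (n := M) (by omega) 1
  have h3 := Polynomial.eval_eq_sum_range' (p := Q) (n := M) (by omega) 1
  rw [Polynomial.eval_mul, h2, h3] at h1
  simp only [one_pow, mul_one, cP, cQ, Polynomial.coeff_mul] at h1
  exact h1.symm

lemma DF_tex (m n : JPartition) (M N : ℕ) (q : ℕ → K) (hM : psize m + psize n < M) :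
    DF hα m n (tex (K := K) M (lin N q)) = psi hα m (tex (K := K) M (lin N q)) * psi hα n (tex (K := K) M (lin N q)) := by
  set Q := lin N q with hQ
  set A : ℕ → K := fun i => ((Nat.factorial i : K)⁻¹) * psi hα m (Q ^ i) with hA
  set B : ℕ → K := fun i => ((Nat.factorial i : K)⁻¹) * psi hα n (Q ^ i) with hB
  have e1 : psi hα m (tex (K := K) M Q) = ∑ i ∈ Finset.range M, A i := by
    rw [tex, map_sum]; simp only [map_smul, smul_eq_mul, hA]
  have e2 : psi hα n (tex (K := K) M Q) = ∑ i ∈ Finset.range M, B i := by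
    rw [tex, map_sum]; simp only [map_smul, smul_eq_mul, hB]
  rw [e1, e2, ← conv_sum A B (psize m) (psize n) M ?_ ?_ hM]
  · rw [tex, map_sum]
    apply Finset.sum_congr rfl
    intro r _
    rw [map_smul, smul_eq_mul, DF_apply, map_pow, hQ, cop_lin, ← hQ, (Commute.all _ _).add_pow', map_sum, map_sum, Finset.mul_sum]
    apply Finset.sum_congr rfl
    intro p hp
    rw [Finset.HasAntidiagonal.mem_antidiagonal] at hp
    rw [Algebra.TensorProduct.tmul_pow, Algebra.TensorProduct.tmul_pow, Algebra.TensorProduct.tmul_mul_tmul, one_pow, one_pow, one_mul, mul_one, map_nsmul, map_nsmul, TensorProduct.map_tmul, LinearMap.mul'_apply, nsmul_eq_mul, hA, hB]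
    have hc := Nat.add_choose_mul_factorial_mul_factorial p.1 p.2
    rw [hp, Nat.choose_symm_of_eq_add (show r = p.2 + p.1 by omega)] at hc
    have hc' : ((r.choose p.1 : ℕ) : K) * (Nat.factorial p.1 : K) * (Nat.factorial p.2 : K) = (Nat.factorial r : K) := by exact_mod_cast hc
    have f1 : (Nat.factorial p.1 : K) ≠ 0 := by exact_mod_cast Nat.factorial_ne_zero _
    have f2 : (Nat.factorial p.2 : K) ≠ 0 := by exact_mod_cast Nat.factorial_ne_zero _
    have f3 : (Nat.factorial r : K) ≠ 0 := by exact_mod_cast Nat.factorial_ne_zero _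
    field_simp
    rw [← hc']; ring
  · intro i hi
    simp only [hA]
    rw [psi_Iv hα (lin_pow hα N q i) hi, mul_zero]
  · intro i hi
    simp only [hB]
    rw [psi_Iv hα (lin_pow hα N q i) hi, mul_zero]
end D1
end JK
end

open scoped Classical
noncomputable section
set_option linter.unusedSectionVars false
set_option linter.unusedSimpArgs false
namespace JK
section D2
variable {K : Type} [Field K] {P : Type} (s : P → ℕ) (a : P → P → K) (d : P → K)

/-- value of a chain -/
def cv (a : P → P → K) (d : P → K) : P → List P → K
  | l, [] => d l
  | l, p :: L => a l p * cv a d p L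

/-- signed value of a chain -/
def ct (l : P) (L : List P) : K := if List.IsChain (fun x y : P => s x < s y) (l :: L) then (-1 : K) ^ L.length * cv a d l L else 0

lemma ct_nil (l : P) : ct s a d l [] = d l := by
  rw [ct, if_pos (List.IsChain.singleton _)]; simp [cv]

lemma ct_cons (l p : P) (L : List P) : ct s a d l (p :: L) = if s l < s p then -(a l p * ct s a d p L) else 0 := by
  have hiff : List.IsChain (fun x y : P => s x < s y) (l :: p :: L) ↔ s l < s p ∧ List.IsChain (fun x y : P => s x < s y) (p :: L) := List.isChain_cons_cons
  rw [ct, ct]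
  by_cases h1 : s l < s p <;> by_cases h2 : List.IsChain (fun x y : P => s x < s y) (p :: L)
  · rw [if_pos (hiff.2 ⟨h1, h2⟩), if_pos h1, if_pos h2, List.length_cons, cv, pow_succ]; ring
  · rw [if_neg (fun h => h2 (hiff.1 h).2), if_pos h1, if_neg h2]; simp
  · rw [if_neg (fun h => h1 (hiff.1 h).1), if_neg h1]
  · rw [if_neg (fun h => h1 (hiff.1 h).1), if_neg h1]

variable (N : ℕ) (hd : ∀ l, N < s l → d l = 0) (S : Finset P) (hS : ∀ p, p ∈ S ↔ s p ≤ N)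

lemma ct_big (hd : ∀ l, N < s l → d l = 0) (L : List P) : ∀ l, N < s l → ct s a d l L = 0 := by
  induction L with
  | nil => intro l h; rw [ct_nil, hd l h]
  | cons p L ih =>
    intro l h
    rw [ct_cons]
    split_ifs with h1
    · rw [ih p (by omega), mul_zero, neg_zero]
    · rfl

lemma ct_supp (hd : ∀ l, N < s l → d l = 0) (hS : ∀ p, p ∈ S ↔ s p ≤ N) (l : P) (f : P → Finset (List P)) (hf : ∀ p, s l < s p → Function.support (ct s a d p) ⊆ f p) :
    Function.support (ct s a d l) ⊆ ((insert [] ((S.filter (fun p => s l < s p)).biUnion (fun p => (f p).image (List.cons p))) : Finset (List P)) : Set (List P)) := by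
  intro L hL
  rw [Finset.mem_coe, Finset.mem_insert]
  cases L with
  | nil => exact Or.inl rfl
  | cons p L =>
    right
    rw [Function.mem_support, ct_cons] at hL
    split_ifs at hL with h1
    · have h2 : ct s a d p L ≠ 0 := fun h => hL (by rw [h, mul_zero, neg_zero])
      have h3 : s p ≤ N := by
        by_contra h3
        exact h2 (ct_big s a d N hd L p (by omega))
      rw [Finset.mem_biUnion]
      refine ⟨p, Finset.mem_filter.2 ⟨(hS p).2 h3, h1⟩, Finset.mem_image.2 ⟨L, ?_, rfl⟩⟩
      exact hf p h1 h2
    · exact absurd rfl hL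

lemma ct_fin (hd : ∀ l, N < s l → d l = 0) (hS : ∀ p, p ∈ S ↔ s p ≤ N) : ∀ k l, N + 1 ≤ s l + k → (Function.support (ct s a d l)).Finite := by
  intro k
  induction k with
  | zero =>
    intro l hl
    have : ct s a d l = 0 := funext fun L => ct_big s a d N hd L l (by omega)
    rw [this, Function.support_zero]; exact Set.finite_empty
  | succ k ih =>
    intro l hl
    refine (Finset.finite_toSet _).subset (ct_supp s a d N S hd hS l (fun p => if h : s l < s p then (ih p (by omega)).toFinset else ∅) ?_)
    intro p hp
    simp only [dif_pos hp, Set.Finite.coe_toFinset]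
    exact subset_rfl

/-- chain sums -/
def cs (l : P) : K := ∑ᶠ L, ct s a d l L

lemma cs_big (hd : ∀ l, N < s l → d l = 0) (l : P) (h : N < s l) : cs s a d l = 0 := by
  rw [cs]
  have : ct s a d l = fun _ => 0 := funext fun L => ct_big s a d N hd L l h
  rw [this, finsum_zero]

lemma cs_rec (hd : ∀ l, N < s l → d l = 0) (hS : ∀ p, p ∈ S ↔ s p ≤ N) (l : P) : cs s a d l = d l - ∑ p ∈ S.filter (fun p => s l < s p), a l p * cs s a d p := by
  have hfin : ∀ l, (Function.support (ct s a d l)).Finite := fun l => ct_fin s a d N S hd hS (N+1) l (by omega)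
  have hsub := ct_supp s a d N S hd hS l (fun p => (hfin p).toFinset) (fun p _ => by rw [Set.Finite.coe_toFinset])
  rw [cs, finsum_eq_sum_of_support_subset _ hsub, Finset.sum_insert, ct_nil, sub_eq_add_neg, ← Finset.sum_neg_distrib, Finset.sum_biUnion]
  · congr 1
    apply Finset.sum_congr rfl
    intro p hp
    rw [Finset.mem_filter] at hp
    rw [Finset.sum_image (by intro x _ y _ h; exact (List.cons.inj h).2), cs, finsum_eq_sum_of_support_subset _ (s := (hfin p).toFinset) (by rw [Set.Finite.coe_toFinset]), Finset.mul_sum, ← Finset.sum_neg_distrib]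
    apply Finset.sum_congr rfl
    intro L _
    rw [ct_cons, if_pos hp.2]
  · intro p _ p' _ hne
    rw [Function.onFun, Finset.disjoint_left]
    intro L h1 h2
    rw [Finset.mem_image] at h1 h2
    obtain ⟨L1, _, rfl⟩ := h1
    obtain ⟨L2, _, h⟩ := h2
    exact hne (List.cons.inj h).1.symm
  · simp

lemma cs_inv (hd : ∀ l, N < s l → d l = 0) (hS : ∀ p, p ∈ S ↔ s p ≤ N) (ha : ∀ l m, s m < s l → a l m = 0)
    (hb : ∀ l m, s m = s l → a l m = if l = m then 1 else 0) (l : P) : ∑ p ∈ S, a l p * cs s a d p = d l := by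
  rcases lt_or_ge N (s l) with h | h
  · rw [hd l h]
    apply Finset.sum_eq_zero
    intro p hp
    rw [hS] at hp
    rw [ha l p (by omega), zero_mul]
  · have h1 : ∑ p ∈ S.filter (fun p => ¬ s l < s p), a l p * cs s a d p = cs s a d l := by
      rw [Finset.sum_eq_single l]
      · rw [hb l l rfl, if_pos rfl, one_mul]
      · intro p hp hne
        rw [Finset.mem_filter] at hp
        rcases lt_or_ge (s p) (s l) with h2 | h2
        · rw [ha l p h2, zero_mul]
        · rw [hb l p (by omega), if_neg (Ne.symm hne), zero_mul]
      · intro h3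
        exact absurd (Finset.mem_filter.2 ⟨(hS l).2 h, by omega⟩) h3
    rw [← Finset.sum_filter_add_sum_filter_not S (fun p => s l < s p), h1, cs_rec s a d N S hd hS l]
    ring
end D2
end JK
end

open scoped Classical
noncomputable section
set_option linter.unusedSectionVars false
set_option linter.unusedSimpArgs false
namespace JK
open MvPolynomial
section D3
variable {K : Type} [Field K] [CharZero K] {α : K} (hα : α ≠ 0)

lemma DF_expand (m n : JPartition) (S : Finset JPartition) (hS : ∀ p, p ∈ S ↔ psize p ≤ psize m + psize n) (f : Sy K) :
    DF hα m n f = ∑ p ∈ S, cs psize (aa hα) (fun l => dd hα l m n) p * psi hα p f := by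
  have : DF hα m n = ∑ p ∈ S, cs psize (aa hα) (fun l => dd hα l m n) p • psi hα p := by
    apply lin_ext
    intro l
    have h := cs_inv psize (aa hα) (fun l => dd hα l m n) (psize m + psize n) S (fun l h => dd_zero hα h) hS
      (fun l m h => aa_lt hα h) (fun l m h => by rw [aa_eq hα h]; congr) l
    simp only [dd_eq] at h
    apply mul_left_cancel₀ (wei_ne hα l)
    rw [← h, LinearMap.sum_apply, Finset.mul_sum]
    apply Finset.sum_congr rfl
    intro p _
    simp only [LinearMap.smul_apply, smul_eq_mul, aa, dd_eq]
    ring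
  rw [this, LinearMap.sum_apply]
  rfl

lemma theta_psi {J : JPartition → SymA} (hJ : IsJackFamily J) (lam : JPartition) (N : ℕ) : ∃ q : ℕ → F, ∀ p, psize p ≤ N →
    theta J p lam = (-1 : F) ^ psize p * psi alpha_ne p (tex (K := F) (N+2) (lin N q)) := by
  obtain ⟨q, hq⟩ := Qf_exp alpha_ne N (sortedParts lam)
  refine ⟨q, fun p hp => ?_⟩
  rw [theta_eq hJ, hq _ hp, psi_apply]

lemma theta_mul {J : JPartition → SymA} (hJ : IsJackFamily J) (m n lam : JPartition) (S : Finset JPartition) (hS : ∀ p, p ∈ S ↔ psize p ≤ psize m + psize n) :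
    theta J m lam * theta J n lam = ∑ p ∈ S, ((-1 : F) ^ (psize m + psize n + psize p) * cs psize (aa alpha_ne) (fun l => dd alpha_ne l m n) p) * theta J p lam := by
  obtain ⟨q, hq⟩ := theta_psi hJ lam (psize m + psize n)
  rw [hq m (by omega), hq n (by omega), mul_mul_mul_comm, ← DF_tex alpha_ne m n _ _ q (by omega), DF_expand alpha_ne m n S hS, ← pow_add, Finset.mul_sum]
  apply Finset.sum_congr rfl
  intro p hp
  rw [hq p ((hS p).1 hp), pow_add _ _ (psize p)]
  have : (-1 : F) ^ psize p * (-1 : F) ^ psize p = 1 := by rw [← mul_pow]; simp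
  linear_combination (-(-1 : F) ^ (psize m + psize n) * cs psize (aa alpha_ne) (fun l => dd alpha_ne l m n) p * psi alpha_ne p (tex (K := F) (psize m + psize n + 2) (lin (psize m + psize n) q))) * this

lemma theta_ind {J : JPartition → SymA} (hJ : IsJackFamily J) (T : Finset JPartition) (h : JPartition → F)
    (hz : ∀ lam, ∑ p ∈ T, h p * theta J p lam = 0) : ∀ p ∈ T, h p = 0 := by
  have H := JD_of hJ
  have key : ∀ n, ∀ p ∈ T, psize p = n → h p = 0 := by
    intro n
    induction n using Nat.strong_induction_on with
    | _ n ih =>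
    intro p0 hp0 hn0
    set Λ : Sy F →ₗ[F] F := ∑ p ∈ T.filter (fun p => psize p = n), h p • lcoeff F (toExp p) with hΛ
    have hJ0 : ∀ lam, Λ (J lam) = 0 := by
      intro lam
      rw [hΛ, LinearMap.sum_apply]
      by_cases hl : psize lam = n
      · rw [← hz lam, Finset.sum_filter]
        apply Finset.sum_congr rfl
        intro p hp
        rw [LinearMap.smul_apply, lcoeff_apply, smul_eq_mul]
        split_ifs with h1
        · congr 1
          rw [theta, if_neg (by omega), hl, h1, Nat.sub_self, addOnes, Multiset.replicate_zero, add_zero]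
          simp
        · rcases lt_or_gt_of_ne h1 with h2 | h2
          · rw [ih _ h2 p hp rfl, zero_mul]
          · rw [theta, if_pos (by omega), mul_zero]
      · apply Finset.sum_eq_zero
        intro p hp
        rw [Finset.mem_filter] at hp
        rw [LinearMap.smul_apply, lcoeff_apply]
        have h1 := coeff_eS p (J lam)
        rw [H.hom, coeff_smul, smul_eq_mul] at h1
        have h2 : ((psize lam : F) - (psize p : F)) * coeff (toExp p) (J lam) = 0 := by rw [sub_mul, h1, sub_self]
        have h3 : (psize lam : F) - (psize p : F) ≠ 0 := by
          rw [sub_ne_zero]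
          intro h4
          have h5 : psize lam = psize p := Nat.cast_injective h4
          omega
        rw [(mul_eq_zero.1 h2).resolve_left h3, smul_zero]
    have hall0 : ∀ f : Sy F, Λ f = 0 := by
      intro f
      have hf : f ∈ LinearMap.ker Λ := by
        refine (Submodule.span_le.2 ?_) (H.span_top f)
        rintro _ ⟨lam, rfl⟩
        exact hJ0 lam
      exact hf
    have h1 := hall0 (mon p0)
    rw [hΛ, LinearMap.sum_apply, Finset.sum_eq_single p0] at h1
    · rw [LinearMap.smul_apply, lcoeff_apply, coeff_mon, if_pos rfl, smul_eq_mul, mul_one] at h1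
      exact h1
    · intro p _ hne
      rw [LinearMap.smul_apply, lcoeff_apply, coeff_mon, if_neg (Ne.symm hne), smul_zero]
    · intro h2
      exact absurd (Finset.mem_filter.2 ⟨hp0, hn0⟩) h2
  exact fun p hp => key _ p hp rfl

lemma applyC_eq (k : ℕ) (h : ℕ → SymA) : applyCpPlus k h = Ch alpha_ne k h := by
  funext d
  rw [Ch_apply, Finset.Nat.sum_antidiagonal_eq_sum_range_succ_mk, applyCpPlus]
  rw [Finset.sum_subset (s₂ := Finset.range (d+1))]
  · apply Finset.sum_congr rfl
    intro n _
    rw [Bc_eq, Sys.Cn, LinearMap.smul_apply]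
  · intro n hn
    rw [Finset.mem_Icc] at hn
    rw [Finset.mem_range]; omega
  · intro n hn h2
    rw [Finset.mem_range] at hn
    rw [Finset.mem_Icc] at h2
    rw [show n = 0 by omega, Nat.cast_zero, inv_zero, zero_smul]

lemma applyCL_eq (L : List ℕ+) : applyCpListPlus L oneFam = Emon alpha_ne (L : Multiset ℕ+) := by
  induction L with
  | nil => rfl
  | cons k L ih => rw [applyCpListPlus, applyC_eq, ih, ← Multiset.cons_coe, Emon_cons]

lemma aCoef_eq (l m : JPartition) : aCoef l m = aa alpha_ne l m := by
  have h1 : applyCpListPlus (l.sort (· ≤ ·)) oneFam = EE alpha_ne (mon l) := by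
    rw [applyCL_eq, Multiset.sort_eq, mon_eq, EE_mon]
    congr 1
    ext i
    rw [Finsupp.count_toMultiset, toExp_apply]
  rw [aCoef, h1, aa, psi_apply]
  congr 1
  rw [wei]
  congr 1
  have : (do let a ← l; pure (a : ℕ)) = Multiset.map (fun i : ℕ+ => (i : ℕ)) l := Multiset.bind_singleton _ _
  rw [this, Multiset.map_map]
  rfl

lemma dCoef_eq (l m n : JPartition) : dCoef l m n = dd alpha_ne l m n := by
  simp only [dCoef, dd, aCoef_eq]

lemma chainVal_eq (m n : JPartition) (L : List JPartition) : ∀ l, chainVal m n l L = cv (aa alpha_ne) (fun l => dd alpha_ne l m n) l L := by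
  induction L with
  | nil => intro l; rw [chainVal, cv, dCoef_eq]
  | cons p L ih => intro l; rw [chainVal, cv, ih, aCoef_eq]

lemma final (J : JPartition → SymA) (hJ : IsJackFamily J)
    (g : JPartition → JPartition → JPartition → F) (hg : IsStructCoeffs J g)
    (lam mu nu : JPartition) :
    g lam mu nu = (-1 : F) ^ (psize mu + psize nu + psize lam) * cs psize (aa alpha_ne) (fun l => dd alpha_ne l mu nu) lam := by
  set c : JPartition → F := fun p => (-1 : F) ^ (psize mu + psize nu + psize p) * cs psize (aa alpha_ne) (fun l => dd alpha_ne l mu nu) p with hc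
  set S := (fin_part (psize mu + psize nu)).toFinset with hSd
  have hS : ∀ p, p ∈ S ↔ psize p ≤ psize mu + psize nu := by intro p; rw [hSd, Set.Finite.mem_toFinset]; rfl
  set T := S ∪ (hg.1 mu nu).toFinset ∪ {lam} with hT
  have hcz : ∀ p, p ∉ S → c p = 0 := by
    intro p hp
    rw [hS, not_le] at hp
    simp only [hc]
    rw [cs_big psize (aa alpha_ne) _ (psize mu + psize nu) (fun l h => dd_zero alpha_ne h) p hp, mul_zero]
  have key := theta_ind hJ T (fun p => g p mu nu - c p) (fun l => by
    have h1 := theta_mul hJ mu nu l S hS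
    have h2 := hg.2 mu nu l
    rw [finsum_eq_sum_of_support_subset (s := T)] at h2
    · rw [Finset.sum_subset (s₂ := T)] at h1
      · simp only [sub_mul, Finset.sum_sub_distrib]
        rw [← h2, h1, sub_self]
      · intro p hp
        rw [hT, Finset.mem_union, Finset.mem_union]; exact Or.inl (Or.inl hp)
      · intro p _ hp
        have := hcz p hp
        simp only [hc] at this
        rw [this, zero_mul]
    · intro p hp
      rw [Finset.mem_coe, hT, Finset.mem_union, Finset.mem_union]
      left; right
      rw [Set.Finite.mem_toFinset]
      rw [Function.mem_support] at hp
      exact left_ne_zero_of_mul hp)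
  exact sub_eq_zero.1 (key lam (by rw [hT]; simp))
end D3
end JK
end

/-- **Theorem 6.2.** The explicit expression of the structure coefficients:
`g^λ_{μ,ν} = (-1)^{|μ|+|ν|-|λ|} ∑_{m≥0} (-1)^m
   ∑_{π₁,…,π_m, |λ|<|π₁|<⋯<|π_m|} a^λ_{π₁} a^{π₁}_{π₂} ⋯ a^{π_{m-1}}_{π_m} d^{π_m}_{μ,ν}`
(the `m = 0` term being `d^λ_{μ,ν}`). -/
theorem statement13
    (J : JPartition → SymA) (hJ : IsJackFamily J)
    (g : JPartition → JPartition → JPartition → F) (hg : IsStructCoeffs J g)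
    (lam mu nu : JPartition) :
    g lam mu nu =
      (-1 : F) ^ ((psize mu + psize nu : ℤ) - (psize lam : ℤ)) *
        ∑ᶠ L : List JPartition,
          if List.Chain (fun x y : JPartition => psize x < psize y) lam L then
            (-1 : F) ^ L.length * chainVal mu nu lam L
          else 0 := by
  have hsgn : (-1 : F) ^ ((psize mu + psize nu : ℤ) - (psize lam : ℤ)) = (-1 : F) ^ (psize mu + psize nu + psize lam) := by
    have h0 : (-1 : F) ≠ 0 := neg_ne_zero.2 one_ne_zero
    have h1 : ((-1 : F) ^ psize lam)⁻¹ = (-1 : F) ^ psize lam := by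
      rw [← inv_pow, inv_neg, inv_one]
    rw [zpow_sub₀ h0, zpow_add₀ h0, zpow_natCast, zpow_natCast, zpow_natCast, div_eq_mul_inv, h1, pow_add, pow_add]
  rw [JK.final J hJ g hg lam mu nu, hsgn]
  congr 1
  rw [JK.cs]
  apply finsum_congr
  intro L
  rw [JK.ct, JK.chainVal_eq]
  by_cases h : List.IsChain (fun x y : JPartition => psize x < psize y) (lam :: L)
  · rw [if_pos h]
    exact (if_pos h).symm
  · rw [if_neg h]
    exact (if_neg h).symm


end
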